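/- arXiv:2006.11531 — 2 statements merged into one kernel-verified Lean document; each statement's English description precedes it below -/
import Mathlib

section
/- Let T > 0, μ ∈ (1/2,1], β ∈ (0,2] and s ≥ −1/2. For every f ∈ L²_μ((0,T); X_β^s) and every g ∈ X_β^{s+1/2−(1−μ)} there exists a unique distributional solution u ∈ T_μ((0,T); X_β^s) ∩ L²_μ((0,T); X_β^{s+1}) of the fractional Kolmogorov equation ∂_t u + v·∇_x u + (−Δ_v)^{β/2} u = f on (0,T)×ℝ^{2n} whose time-continuous representative satisfies u(0) = g. -/
open MeasureTheory Set Filter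
open scoped ENNReal

noncomputable section

/-- `ℝⁿ` with the Euclidean norm. -/
abbrev En (n : ℕ) : Type := EuclideanSpace ℝ (Fin n)

/-- `ω_β(k,ξ) = 1 + ‖k‖^{β/(β+1)} + ‖ξ‖^β`. -/
def omegaB (n : ℕ) (β : ℝ) (k ξ : En n) : ℝ := 1 + ‖k‖ ^ (β / (β + 1)) + ‖ξ‖ ^ β

/-- Squared norm of the anisotropic Sobolev space `X_β^s`, on the Fourier side:
`w` is the Fourier transform `û(k,ξ)`. -/
def Xnorm (n : ℕ) (β s : ℝ) (w : En n → En n → ℂ) : ℝ≥0∞ :=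
  ∫⁻ (k : En n), ∫⁻ (ξ : En n), ENNReal.ofReal (omegaB n β k ξ ^ (2 * s) * ‖w k ξ‖ ^ 2)

/-- Squared norm of `L²_μ((0,T); X_β^s)`, on the Fourier side. -/
def L2X (n : ℕ) (β s T μ : ℝ) (U : ℝ → En n → En n → ℂ) : ℝ≥0∞ :=
  ∫⁻ t in Ioo 0 T, ENNReal.ofReal (t ^ (2 - 2*μ)) * Xnorm n β s (U t)

/-- The Fourier side of the kinetic transport derivative: `Ĥ = ∂_t Û − k·∇_ξ Û` in the
sense of distributions on `(0,T) × ℝ^{2n}` (a point of `ℝ^{2n}` is `q = (k,ξ)`); this is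
the Fourier transform of `h = ∂_t u + v·∇ₓ u`. -/
def IsFTransportDeriv (n : ℕ) (T : ℝ) (U H : ℝ → En n → En n → ℂ) : Prop :=
  ∀ φ : ℝ × (En n × En n) → ℝ, ContDiff ℝ ((⊤ : ℕ∞) : WithTop ℕ∞) φ → HasCompactSupport φ →
    (∀ p : ℝ × (En n × En n), p.1 ∉ Ioo 0 T → φ p = 0) →
    -(∫ t in Ioo 0 T, ∫ q : En n × En n,
        U t q.1 q.2 * (fderiv ℝ φ (t, q) ((1 : ℝ), ((0 : En n), -q.1)) : ℂ))
      = ∫ t in Ioo 0 T, ∫ q : En n × En n, H t q.1 q.2 * (φ (t, q) : ℂ)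

/-- Joint measurability of `U : ℝ → En n → En n → ℂ`. -/
def MeasU (n : ℕ) (U : ℝ → En n → En n → ℂ) : Prop :=
  Measurable (fun p : ℝ × En n × En n => U p.1 p.2.1 p.2.2)

/-- Squared `H^{-1}(ℝ^{2n})` norm, on the Fourier side. -/
def Hm1 (n : ℕ) (w : En n → En n → ℂ) : ℝ≥0∞ :=
  ∫⁻ (k : En n), ∫⁻ (ξ : En n), ENNReal.ofReal ((1 + ‖k‖ ^ 2 + ‖ξ‖ ^ 2)⁻¹ * ‖w k ξ‖ ^ 2)

/-- Membership `u ∈ T_μ((0,T);X_β^s) ∩ L²_μ((0,T);X_β^{s+1})`, on the Fourier side,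
where `H` is the (Fourier side) transport derivative `∂_t u + v·∇ₓ u` of `u`. -/
def SolSpace (n : ℕ) (β s T μ : ℝ) (U H : ℝ → En n → En n → ℂ) : Prop :=
  MeasU n U ∧ MeasU n H ∧ IsFTransportDeriv n T U H ∧
    L2X n β s T μ U < ⊤ ∧ L2X n β s T μ H < ⊤ ∧ L2X n β (s + 1) T μ U < ⊤

/-- The time-continuous representative of `u` has trace `g` at `t = 0`:
`u(t) → g` in `H^{-1}(ℝ^{2n})` as `t → 0⁺`. -/
def HasTrace (n : ℕ) (T : ℝ) (U : ℝ → En n → En n → ℂ) (G : En n → En n → ℂ) : Prop :=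
  Tendsto (fun t : ℝ => Hm1 n (fun k ξ => U t k ξ - G k ξ)) (nhdsWithin 0 (Ioo 0 T)) (nhds 0)

lemma one_le_omegaB (n : ℕ) (β : ℝ) (k ξ : En n) : 1 ≤ omegaB n β k ξ := by
  unfold omegaB
  have h1 : 0 ≤ ‖k‖ ^ (β / (β + 1)) := Real.rpow_nonneg (norm_nonneg _) _
  have h2 : 0 ≤ ‖ξ‖ ^ β := Real.rpow_nonneg (norm_nonneg _) _
  linarith

lemma omegaB_pos (n : ℕ) (β : ℝ) (k ξ : En n) : 0 < omegaB n β k ξ :=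
  lt_of_lt_of_le one_pos (one_le_omegaB n β k ξ)

lemma omegaB_neg_left (n : ℕ) (β : ℝ) (k ξ : En n) : omegaB n β (-k) ξ = omegaB n β k ξ := by
  simp [omegaB]

lemma continuous_omegaB (n : ℕ) {β : ℝ} (hβ : 0 < β) :
    Continuous (fun p : En n × En n => omegaB n β p.1 p.2) := by
  unfold omegaB
  have : 0 < β / (β + 1) := by positivity
  exact (continuous_const.add (continuous_fst.norm.rpow_const fun _ => Or.inr this.le)).add
    (continuous_snd.norm.rpow_const fun _ => Or.inr hβ.le)

/-- The phase accumulated along the characteristic `r ↦ η - r k` up to time `t`. -/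
def phase (n : ℕ) (β t : ℝ) (k η : En n) : ℝ := ∫ r in (0:ℝ)..t, ‖η - r • k‖ ^ β

lemma continuous_norm_rpow (n : ℕ) {β : ℝ} (hβ : 0 < β) (k η : En n) :
    Continuous (fun r : ℝ => ‖η - r • k‖ ^ β) :=
  Continuous.rpow_const (by fun_prop) fun _ => Or.inr hβ.le

lemma continuous_phase (n : ℕ) {β : ℝ} (hβ : 0 < β) :
    Continuous (fun p : ℝ × En n × En n => phase n β p.1 p.2.1 p.2.2) := by
  unfold phase
  apply intervalIntegral.continuous_parametric_intervalIntegral_of_continuous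
    (f := fun (p : ℝ × En n × En n) (r : ℝ) => ‖p.2.2 - r • p.2.1‖ ^ β)
  · exact Continuous.rpow_const (by fun_prop) fun _ => Or.inr hβ.le
  · fun_prop

lemma phase_nonneg (n : ℕ) (β : ℝ) {t : ℝ} (ht : 0 ≤ t) (k η : En n) : 0 ≤ phase n β t k η :=
  intervalIntegral.integral_nonneg ht fun _ _ => Real.rpow_nonneg (norm_nonneg _) _

/-- The phase between two times is the phase started at the first point. -/
lemma phase_sub_phase (n : ℕ) {β : ℝ} (hβ : 0 < β) (σ t : ℝ) (k η : En n) :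
    phase n β t k η - phase n β σ k η = phase n β (t - σ) k (η - σ • k) := by
  unfold phase
  rw [intervalIntegral.integral_interval_sub_left
    ((continuous_norm_rpow n hβ k η).intervalIntegrable _ _)
    ((continuous_norm_rpow n hβ k η).intervalIntegrable _ _)]
  have := intervalIntegral.integral_comp_add_right (a := 0) (b := t - σ)
    (fun r : ℝ => ‖η - r • k‖ ^ β) σ
  rw [zero_add, sub_add_cancel] at this
  rw [← this]
  congr 1; ext r; congr 2; module

/-- The phase between two times, read from the end point backwards. -/
lemma phase_sub_phase_reverse (n : ℕ) {β : ℝ} (hβ : 0 < β) (σ t : ℝ) (k η : En n) :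
    phase n β t k η - phase n β σ k η = phase n β (t - σ) (-k) (η - t • k) := by
  unfold phase
  rw [intervalIntegral.integral_interval_sub_left
    ((continuous_norm_rpow n hβ k η).intervalIntegrable _ _)
    ((continuous_norm_rpow n hβ k η).intervalIntegrable _ _)]
  have := intervalIntegral.integral_comp_sub_left (a := 0) (b := t - σ)
    (fun r : ℝ => ‖η - r • k‖ ^ β) t
  rw [sub_zero, sub_sub_cancel] at this
  rw [← this]
  congr 1; ext r; congr 2; module

/-- Lower bound of the phase by the larger of the two natural length scales. -/
lemma le_phase (n : ℕ) {β τ : ℝ} (hβ : 0 < β) (hτ : 0 ≤ τ) (k η : En n) :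
    τ / 2 * (max ‖η‖ (τ * ‖k‖) / 8) ^ β ≤ phase n β τ k η := by
  have hc := continuous_norm_rpow n hβ k η
  by_cases hcase : 2 * (τ * ‖k‖) ≤ ‖η‖
  · have hmax : max ‖η‖ (τ * ‖k‖) = ‖η‖ := by
      apply max_eq_left
      have : 0 ≤ τ * ‖k‖ := by positivity
      linarith
    rw [hmax]
    have h1 : ∀ r ∈ Icc 0 τ, (‖η‖ / 8) ^ β ≤ ‖η - r • k‖ ^ β := by
      intro r hr
      apply Real.rpow_le_rpow (by positivity) _ hβ.le
      have h2 := norm_sub_norm_le η (r • k)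
      rw [norm_smul, Real.norm_of_nonneg hr.1] at h2
      have h3 : r * ‖k‖ ≤ τ * ‖k‖ := mul_le_mul_of_nonneg_right hr.2 (norm_nonneg _)
      have := norm_nonneg η
      linarith
    have h2 := intervalIntegral.integral_mono_on hτ
      (intervalIntegrable_const (μ := volume) (c := (‖η‖ / 8) ^ β)) (hc.intervalIntegrable 0 τ) h1
    simp only [intervalIntegral.integral_const, sub_zero, smul_eq_mul] at h2
    refine le_trans ?_ h2
    have : 0 ≤ (‖η‖ / 8) ^ β := by positivity
    nlinarith
  · push Not at hcase
    have hc' : Continuous (fun r : ℝ => ‖η - (r + τ/2) • k‖ ^ β) :=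
      hc.comp (continuous_id.add continuous_const)
    have hM : max ‖η‖ (τ * ‖k‖) ≤ 2 * (τ * ‖k‖) := by
      apply max_le hcase.le
      have : 0 ≤ τ * ‖k‖ := by positivity
      linarith
    have hsplit : phase n β τ k η
        = ∫ r in (0:ℝ)..(τ/2), (‖η - r • k‖ ^ β + ‖η - (r + τ/2) • k‖ ^ β) := by
      rw [intervalIntegral.integral_add (hc.intervalIntegrable _ _)
        (hc'.intervalIntegrable _ _)]
      have := intervalIntegral.integral_comp_add_right (a := 0) (b := τ / 2)
        (fun r : ℝ => ‖η - r • k‖ ^ β) (τ / 2)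
      rw [this, zero_add, add_halves,
        intervalIntegral.integral_add_adjacent_intervals (hc.intervalIntegrable _ _)
          (hc.intervalIntegrable _ _)]
      rfl
    rw [hsplit]
    have h1 : ∀ r ∈ Icc 0 (τ/2), (max ‖η‖ (τ * ‖k‖) / 8) ^ β ≤
        ‖η - r • k‖ ^ β + ‖η - (r + τ/2) • k‖ ^ β := by
      intro r hr
      have h2 : τ / 2 * ‖k‖ ≤ ‖η - r • k‖ + ‖η - (r + τ/2) • k‖ := by
        have h3 := norm_sub_le (η - r • k) (η - (r + τ/2) • k)
        have h4 : (η - r • k) - (η - (r + τ/2) • k) = (τ/2) • k := by module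
        rwa [h4, norm_smul, Real.norm_of_nonneg (by positivity)] at h3
      have p1 : 0 ≤ ‖η - r • k‖ ^ β := by positivity
      have p2 : 0 ≤ ‖η - (r + τ/2) • k‖ ^ β := by positivity
      rcases le_total (τ / 4 * ‖k‖) ‖η - r • k‖ with h | h
      · have : (max ‖η‖ (τ * ‖k‖) / 8) ^ β ≤ ‖η - r • k‖ ^ β :=
          Real.rpow_le_rpow (by positivity) (by linarith) hβ.le
        linarith
      · have : (max ‖η‖ (τ * ‖k‖) / 8) ^ β ≤ ‖η - (r + τ/2) • k‖ ^ β :=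
          Real.rpow_le_rpow (by positivity) (by linarith) hβ.le
        linarith
    have h2 := intervalIntegral.integral_mono_on (by positivity : (0:ℝ) ≤ τ / 2)
      (intervalIntegrable_const (μ := volume) (c := (max ‖η‖ (τ * ‖k‖) / 8) ^ β))
      ((hc.add hc').intervalIntegrable 0 (τ/2)) h1
    simpa only [intervalIntegral.integral_const, sub_zero, smul_eq_mul, Pi.add_apply] using h2

/-- The phase dominates the rescaled elapsed time. -/
lemma exists_one_add_mul_omegaB_le (n : ℕ) {β : ℝ} (hβ : 0 < β) (T : ℝ) (hT : 0 < T) :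
    ∃ C : ℝ, 0 < C ∧ ∀ (τ : ℝ) (k η : En n), 0 ≤ τ → τ ≤ T →
      1 + τ * omegaB n β k η ≤ C * (1 + phase n β τ k η) := by
  set c : ℝ := 2 * 8 ^ β with hc
  have hcpos : 0 < c := by positivity
  refine ⟨2 + T + 2 * c, by positivity, fun τ k η hτ hτT => ?_⟩
  set P := phase n β τ k η with hP
  have hP0 : 0 ≤ P := phase_nonneg n β hτ k η
  have hlow := le_phase n hβ hτ k η
  rw [Real.div_rpow (by positivity) (by norm_num)] at hlow
  have h8 : (0:ℝ) < 8 ^ β := by positivity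
  have hmain : τ * (max ‖η‖ (τ * ‖k‖)) ^ β ≤ c * P := by
    have : τ * (max ‖η‖ (τ * ‖k‖)) ^ β
        = c * (τ / 2 * ((max ‖η‖ (τ * ‖k‖)) ^ β / 8 ^ β)) := by
      rw [hc]; field_simp
    rw [this]
    exact mul_le_mul_of_nonneg_left hlow hcpos.le
  have h1 : τ * ‖η‖ ^ β ≤ c * P := by
    refine le_trans ?_ hmain
    gcongr
    exact le_max_left _ _
  have h2 : τ * (τ * ‖k‖) ^ β ≤ c * P := by
    refine le_trans ?_ hmain
    gcongr
    exact le_max_right _ _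
  have h3 : τ * ‖k‖ ^ (β / (β + 1)) ≤ 1 + τ * (τ * ‖k‖) ^ β := by
    have hy : τ * (τ * ‖k‖) ^ β = (τ * ‖k‖ ^ (β / (β + 1))) ^ (β + 1) := by
      rw [Real.mul_rpow hτ (norm_nonneg _), Real.mul_rpow hτ (by positivity),
        ← Real.rpow_mul (norm_nonneg _), div_mul_cancel₀ _ (by positivity),
        Real.rpow_add_one' hτ (by positivity)]
      ring
    rw [hy]
    set y := τ * ‖k‖ ^ (β / (β + 1)) with hyd
    have hy0 : 0 ≤ y := by positivity
    rcases le_total y 1 with h | h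
    · have : 0 ≤ y ^ (β + 1) := by positivity
      linarith
    · have : y ^ (1:ℝ) ≤ y ^ (β + 1) := Real.rpow_le_rpow_of_exponent_le h (by linarith)
      rw [Real.rpow_one] at this
      linarith
  have h4 : 1 + τ * omegaB n β k η
      = 1 + τ + τ * ‖k‖ ^ (β / (β + 1)) + τ * ‖η‖ ^ β := by
    unfold omegaB; ring
  rw [h4]
  nlinarith [mul_nonneg hT.le hP0]

/-- Growth of the weight along characteristics. -/
lemma omegaB_sub_smul_le (n : ℕ) {β τ : ℝ} (hβ : β ∈ Ioc (0:ℝ) 2) (hτ : 0 ≤ τ) (k η : En n) :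
    omegaB n β k (η - τ • k) ≤ 9 * omegaB n β k η * (1 + τ * omegaB n β k η) ^ 2 := by
  set lam := omegaB n β k η with hl
  have hl1 : 1 ≤ lam := one_le_omegaB n β k η
  have hk0 : 0 ≤ ‖k‖ ^ (β / (β + 1)) := by positivity
  have hη0 : 0 ≤ ‖η‖ ^ β := by positivity
  have hkl : ‖k‖ ^ (β / (β + 1)) ≤ lam := by rw [hl]; unfold omegaB; linarith
  have hηl : ‖η‖ ^ β ≤ lam := by rw [hl]; unfold omegaB; linarith
  have hβ1 : 0 < β + 1 := by linarith [hβ.1]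
  have hkβ : ‖k‖ ^ β ≤ lam ^ (β + 1) := by
    have : ‖k‖ ^ β = (‖k‖ ^ (β / (β + 1))) ^ (β + 1) := by
      rw [← Real.rpow_mul (norm_nonneg _), div_mul_cancel₀ _ hβ1.ne']
    rw [this]
    exact Real.rpow_le_rpow hk0 hkl hβ1.le
  have hx0 : 0 ≤ τ * lam := by positivity
  have hτk : (τ * ‖k‖) ^ β ≤ lam * (1 + τ * lam) ^ 2 := by
    calc (τ * ‖k‖) ^ β = τ ^ β * ‖k‖ ^ β := Real.mul_rpow hτ (norm_nonneg _)
      _ ≤ τ ^ β * lam ^ (β + 1) := by gcongr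
      _ = lam * (τ * lam) ^ β := by
          rw [Real.mul_rpow hτ (by positivity), Real.rpow_add_one (by positivity)]; ring
      _ ≤ lam * (1 + τ * lam) ^ β := by
          gcongr
          · exact hβ.1.le
          · linarith
      _ ≤ lam * (1 + τ * lam) ^ (2:ℝ) := by
          gcongr
          · linarith
          · exact hβ.2
      _ = lam * (1 + τ * lam) ^ 2 := by rw [Real.rpow_two]
  have hsum : ‖η - τ • k‖ ^ β ≤ 4 * (‖η‖ ^ β + (τ * ‖k‖) ^ β) := by
    have h1 : ‖η - τ • k‖ ≤ 2 * max ‖η‖ (τ * ‖k‖) := by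
      have := norm_sub_le η (τ • k)
      rw [norm_smul, Real.norm_of_nonneg hτ] at this
      have h2 := le_max_left ‖η‖ (τ * ‖k‖)
      have h3 := le_max_right ‖η‖ (τ * ‖k‖)
      linarith
    have h2 : (max ‖η‖ (τ * ‖k‖)) ^ β ≤ ‖η‖ ^ β + (τ * ‖k‖) ^ β := by
      have p2 : 0 ≤ (τ * ‖k‖) ^ β := by positivity
      rcases max_choice ‖η‖ (τ * ‖k‖) with h | h <;> rw [h] <;> linarith
    have h4 : (2:ℝ) ^ β ≤ 4 := by
      have : (2:ℝ) ^ β ≤ 2 ^ (2:ℝ) := Real.rpow_le_rpow_of_exponent_le (by norm_num) hβ.2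
      rw [Real.rpow_two] at this
      linarith
    calc ‖η - τ • k‖ ^ β ≤ (2 * max ‖η‖ (τ * ‖k‖)) ^ β :=
          Real.rpow_le_rpow (norm_nonneg _) h1 hβ.1.le
      _ = 2 ^ β * (max ‖η‖ (τ * ‖k‖)) ^ β := Real.mul_rpow (by norm_num) (by positivity)
      _ ≤ 4 * (‖η‖ ^ β + (τ * ‖k‖) ^ β) := by
          apply mul_le_mul h4 h2 (by positivity) (by norm_num)
  have h1x : 1 ≤ (1 + τ * lam) ^ 2 := by nlinarith
  have hll : lam ≤ lam * (1 + τ * lam) ^ 2 := le_mul_of_one_le_right (by linarith) h1x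
  have : omegaB n β k (η - τ • k) ≤ lam + 4 * (‖η‖ ^ β + (τ * ‖k‖) ^ β) := by
    have h5 : lam = 1 + ‖k‖ ^ (β / (β + 1)) + ‖η‖ ^ β := rfl
    unfold omegaB
    linarith
  linarith

/-- Exponential decay of the propagator absorbs every power of the weight. -/
lemma exists_omegaB_rpow_mul_exp_le (n : ℕ) {β : ℝ} (hβ : β ∈ Ioc (0:ℝ) 2) (T p : ℝ)
    (hT : 0 < T) (hp : 0 ≤ p) :
    ∃ C : ℝ, 0 < C ∧ ∀ (τ : ℝ) (k η : En n), 0 ≤ τ → τ ≤ T →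
      omegaB n β k (η - τ • k) ^ p * Real.exp (-phase n β τ k η)
        ≤ C * omegaB n β k η ^ p / (1 + τ * omegaB n β k η) ^ 3 := by
  obtain ⟨C, hC, hCb⟩ := exists_one_add_mul_omegaB_le n hβ.1 T hT
  obtain ⟨N, hN⟩ := exists_nat_ge (2 * p + 3)
  refine ⟨9 ^ p * (C ^ N * (N.factorial * Real.exp 1)), by positivity, fun τ k η hτ hτT => ?_⟩
  set lam := omegaB n β k η with hl
  have hl1 : 1 ≤ lam := one_le_omegaB n β k η
  set P := phase n β τ k η with hP
  have hP0 : 0 ≤ P := phase_nonneg n β hτ k η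
  set x := 1 + τ * lam with hx
  have hx1 : 1 ≤ x := by
    have : 0 ≤ τ * lam := by positivity
    linarith
  have hxpos : 0 < x := by linarith
  have h1 : omegaB n β k (η - τ • k) ^ p ≤ 9 ^ p * lam ^ p * x ^ (2 * p) := by
    calc omegaB n β k (η - τ • k) ^ p ≤ (9 * lam * x ^ 2) ^ p :=
          Real.rpow_le_rpow (omegaB_pos _ _ _ _).le (omegaB_sub_smul_le n hβ hτ k η) hp
      _ = 9 ^ p * lam ^ p * x ^ (2 * p) := by
          rw [Real.mul_rpow (by positivity) (by positivity),
            Real.mul_rpow (by positivity) (by positivity), Real.rpow_mul hxpos.le, Real.rpow_two]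
  have h2 : Real.exp (-P) ≤ C ^ N * (N.factorial * Real.exp 1) / x ^ N := by
    rw [le_div_iff₀ (by positivity)]
    have h3 : x ^ N ≤ C ^ N * (1 + P) ^ N := by
      rw [← mul_pow]
      exact pow_le_pow_left₀ hxpos.le (hCb τ k η hτ hτT) N
    have h4 : (1 + P) ^ N ≤ N.factorial * (Real.exp 1 * Real.exp P) := by
      have := Real.pow_div_factorial_le_exp (1 + P) (by linarith) N
      rw [div_le_iff₀ (by positivity), Real.exp_add] at this
      linarith
    calc Real.exp (-P) * x ^ N
        ≤ Real.exp (-P) * (C ^ N * (N.factorial * (Real.exp 1 * Real.exp P))) := by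
          gcongr
          exact h3.trans (by gcongr)
      _ = C ^ N * (N.factorial * Real.exp 1) * (Real.exp (-P) * Real.exp P) := by ring
      _ = C ^ N * (N.factorial * Real.exp 1) := by
          rw [← Real.exp_add]; simp
  have h5 : x ^ (2 * p) / x ^ N ≤ 1 / x ^ 3 := by
    rw [div_le_div_iff₀ (by positivity) (by positivity), one_mul, ← Real.rpow_natCast,
      ← Real.rpow_natCast, ← Real.rpow_add hxpos]
    exact Real.rpow_le_rpow_of_exponent_le hx1 (by push_cast; linarith)
  calc omegaB n β k (η - τ • k) ^ p * Real.exp (-P)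
      ≤ (9 ^ p * lam ^ p * x ^ (2 * p)) * (C ^ N * (N.factorial * Real.exp 1) / x ^ N) :=
        mul_le_mul h1 h2 (Real.exp_pos _).le (by positivity)
    _ = 9 ^ p * (C ^ N * (N.factorial * Real.exp 1)) * lam ^ p * (x ^ (2 * p) / x ^ N) := by
        ring
    _ ≤ 9 ^ p * (C ^ N * (N.factorial * Real.exp 1)) * lam ^ p * (1 / x ^ 3) := by gcongr
    _ = _ := by ring

lemma lintegral_Ioi_div_one_add_mul_sq_le {lam : ℝ} (hl : 0 < lam) :
    ∫⁻ x in Ioi (0:ℝ), ENNReal.ofReal (lam / (1 + x * lam) ^ 2) ≤ 1 := by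
  have hd : ∀ x ∈ Ioi (0:ℝ),
      HasDerivAt (fun x : ℝ => -(1 + x * lam)⁻¹) (lam / (1 + x * lam) ^ 2) x := by
    intro x hx
    have hx' : (0:ℝ) < x := hx
    have h1 : HasDerivAt (fun x : ℝ => 1 + x * lam) lam x := by
      simpa using ((hasDerivAt_id x).mul_const lam).const_add 1
    have := (h1.inv (by positivity)).neg
    convert! this using 1
    ring
  have hcont : ContinuousWithinAt (fun x : ℝ => -(1 + x * lam)⁻¹) (Ici 0) 0 := by
    apply ContinuousAt.continuousWithinAt
    apply ContinuousAt.neg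
    apply ContinuousAt.inv₀ (by fun_prop) (by simp)
  have hlim : Tendsto (fun x : ℝ => -(1 + x * lam)⁻¹) atTop (nhds (-0)) := by
    apply Tendsto.neg
    apply tendsto_inv_atTop_zero.comp
    exact tendsto_atTop_add_const_left _ _ (tendsto_id.atTop_mul_const hl)
  have hpos : ∀ x ∈ Ioi (0:ℝ), 0 ≤ lam / (1 + x * lam) ^ 2 := fun x hx => by positivity
  have hInt := integrableOn_Ioi_deriv_of_nonneg hcont hd hpos hlim
  have hval := integral_Ioi_of_hasDerivAt_of_nonneg hcont hd hpos hlim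
  rw [← ofReal_integral_eq_lintegral_ofReal hInt
    ((ae_restrict_iff' measurableSet_Ioi).2 (ae_of_all _ hpos)), hval]
  simp

lemma lintegral_Ioo_div_one_add_sub_mul_sq_le {lam : ℝ} (hl : 0 < lam) (a b : ℝ) :
    ∫⁻ x in Ioo a b, ENNReal.ofReal (lam / (1 + (x - a) * lam) ^ 2) ≤ 1 := by
  calc _ ≤ ∫⁻ x in Ioi a, ENNReal.ofReal (lam / (1 + (x - a) * lam) ^ 2) :=
        lintegral_mono_set fun x hx => hx.1
    _ = ∫⁻ x, (Ioi (0:ℝ)).indicator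
          (fun x => ENNReal.ofReal (lam / (1 + x * lam) ^ 2)) (x - a) := by
        rw [← lintegral_indicator measurableSet_Ioi]
        congr 1; ext x
        simp [indicator]
    _ ≤ 1 := by
        rw [lintegral_sub_right_eq_self (fun x => (Ioi (0:ℝ)).indicator
          (fun x => ENNReal.ofReal (lam / (1 + x * lam) ^ 2)) x) a,
          lintegral_indicator measurableSet_Ioi]
        exact lintegral_Ioi_div_one_add_mul_sq_le hl

lemma lintegral_Ioo_div_one_add_sub_mul_sq_le' {lam : ℝ} (hl : 0 < lam) (a b : ℝ) :
    ∫⁻ x in Ioo a b, ENNReal.ofReal (lam / (1 + (b - x) * lam) ^ 2) ≤ 1 := by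
  calc _ ≤ ∫⁻ x in Iio b, ENNReal.ofReal (lam / (1 + (b - x) * lam) ^ 2) :=
        lintegral_mono_set fun x hx => hx.2
    _ = ∫⁻ x, (Ioi (0:ℝ)).indicator
          (fun x => ENNReal.ofReal (lam / (1 + x * lam) ^ 2)) (b - x) := by
        rw [← lintegral_indicator measurableSet_Iio]
        congr 1; ext x
        simp [indicator]
    _ ≤ 1 := by
        rw [lintegral_sub_left_eq_self (fun x => (Ioi (0:ℝ)).indicator
          (fun x => ENNReal.ofReal (lam / (1 + x * lam) ^ 2)) x) b,
          lintegral_indicator measurableSet_Ioi]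
        exact lintegral_Ioi_div_one_add_mul_sq_le hl

lemma lintegral_Ioo_rpow_neg {γ t : ℝ} (hγ : γ < 1) (ht : 0 < t) :
    ∫⁻ σ in Ioo 0 t, ENNReal.ofReal (σ ^ (-γ)) = ENNReal.ofReal (t ^ (1 - γ) / (1 - γ)) := by
  have hi : IntervalIntegrable (fun σ : ℝ => σ ^ (-γ)) volume 0 t :=
    intervalIntegral.intervalIntegrable_rpow' (by linarith)
  rw [restrict_Ioo_eq_restrict_Ioc, ← ofReal_integral_eq_lintegral_ofReal ((intervalIntegrable_iff_integrableOn_Ioc_of_le ht.le).1 hi)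
    ((ae_restrict_iff' measurableSet_Ioc).2 (ae_of_all _ fun x hx => Real.rpow_nonneg hx.1.le _)),
    ← intervalIntegral.integral_of_le ht.le, integral_rpow (Or.inl (by linarith))]
  rw [Real.zero_rpow (by linarith)]
  congr 1
  rw [sub_zero]; congr 1 <;> ring_nf

/-- Time integral of the weighted free propagator. -/
lemma exists_lintegral_free_le (n : ℕ) {β : ℝ} (hβ : β ∈ Ioc (0:ℝ) 2) (T p α : ℝ)
    (hT : 0 < T) (hp : 0 ≤ p) (hα : 0 ≤ α) (hα' : α ≤ 1) :
    ∃ C : ℝ, 0 < C ∧ ∀ (k η : En n),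
      ∫⁻ t in Ioo 0 T, ENNReal.ofReal
        (t ^ α * (omegaB n β k (η - t • k) ^ p * Real.exp (-phase n β t k η) ^ 2))
        ≤ ENNReal.ofReal (C * omegaB n β k η ^ (p - α - 1)) := by
  obtain ⟨C, hC, hCb⟩ := exists_omegaB_rpow_mul_exp_le n hβ T p hT hp
  refine ⟨C, hC, fun k η => ?_⟩
  set lam := omegaB n β k η with hl
  have hl0 : 0 < lam := omegaB_pos n β k η
  have hpt : ∀ t ∈ Ioo 0 T, ENNReal.ofReal
      (t ^ α * (omegaB n β k (η - t • k) ^ p * Real.exp (-phase n β t k η) ^ 2))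
      ≤ ENNReal.ofReal (C * lam ^ (p - α - 1)) *
        ENNReal.ofReal (lam / (1 + (t - 0) * lam) ^ 2) := by
    intro t ht
    rw [← ENNReal.ofReal_mul (by positivity)]
    apply ENNReal.ofReal_le_ofReal
    have ht0 : 0 < t := ht.1
    set x := 1 + t * lam with hx
    have hx1 : 1 ≤ x := by
      have : 0 ≤ t * lam := by positivity
      linarith
    have h1 := hCb t k η ht.1.le ht.2.le
    have he : Real.exp (-phase n β t k η) ^ 2 ≤ Real.exp (-phase n β t k η) := by
      have h0 := Real.exp_pos (-phase n β t k η)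
      have : Real.exp (-phase n β t k η) ≤ 1 :=
        Real.exp_le_one_iff.2 (by linarith [phase_nonneg n β ht.1.le k η])
      nlinarith
    have h2 : t ^ α ≤ x * lam ^ (-α) := by
      have : t ^ α = (t * lam) ^ α * lam ^ (-α) := by
        rw [Real.mul_rpow ht0.le hl0.le, mul_assoc, ← Real.rpow_add hl0]; simp
      rw [this]
      gcongr
      calc (t * lam) ^ α ≤ x ^ α :=
            Real.rpow_le_rpow (by positivity) (by linarith) hα
        _ ≤ x ^ (1:ℝ) := Real.rpow_le_rpow_of_exponent_le hx1 hα'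
        _ = x := Real.rpow_one x
    have hom := Real.rpow_nonneg (omegaB_pos n β k (η - t • k)).le p
    calc t ^ α * (omegaB n β k (η - t • k) ^ p * Real.exp (-phase n β t k η) ^ 2)
        ≤ (x * lam ^ (-α)) * (C * lam ^ p / x ^ 3) := by
          apply mul_le_mul h2 _ (by positivity) (by positivity)
          exact (mul_le_mul_of_nonneg_left he hom).trans h1
      _ = C * (lam ^ p * lam ^ (-α)) / x ^ 2 := by field_simp
      _ = C * (lam ^ (p - α - 1) * lam) / x ^ 2 := by
          rw [← Real.rpow_add hl0, ← Real.rpow_add_one hl0.ne']; ring_nf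
      _ = _ := by rw [hx, sub_zero]; ring
  calc _ ≤ ∫⁻ t in Ioo 0 T, ENNReal.ofReal (C * lam ^ (p - α - 1)) *
        ENNReal.ofReal (lam / (1 + (t - 0) * lam) ^ 2) := setLIntegral_mono' measurableSet_Ioo hpt
    _ = ENNReal.ofReal (C * lam ^ (p - α - 1)) *
        ∫⁻ t in Ioo 0 T, ENNReal.ofReal (lam / (1 + (t - 0) * lam) ^ 2) :=
        lintegral_const_mul' _ _ ENNReal.ofReal_ne_top
    _ ≤ ENNReal.ofReal (C * lam ^ (p - α - 1)) * 1 := by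
        gcongr; exact lintegral_Ioo_div_one_add_sub_mul_sq_le hl0 0 T
    _ = _ := mul_one _

/-- Forward Schur bound of the propagator. -/
lemma exists_lintegral_forward_le (n : ℕ) {β : ℝ} (hβ : β ∈ Ioc (0:ℝ) 2) (T p : ℝ)
    (hT : 0 < T) (hp : 0 ≤ p) :
    ∃ C : ℝ, 0 < C ∧ ∀ (k η : En n) (σ : ℝ), 0 ≤ σ →
      ∫⁻ t in Ioo σ T, ENNReal.ofReal
        (omegaB n β k (η - t • k) ^ p * Real.exp (-(phase n β t k η - phase n β σ k η)))
        ≤ ENNReal.ofReal (C * omegaB n β k (η - σ • k) ^ (p - 1)) := by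
  obtain ⟨C, hC, hCb⟩ := exists_omegaB_rpow_mul_exp_le n hβ T p hT hp
  refine ⟨C, hC, fun k η σ hσ => ?_⟩
  set lam := omegaB n β k (η - σ • k) with hl
  have hl0 : 0 < lam := omegaB_pos n β k _
  have hpt : ∀ t ∈ Ioo σ T, ENNReal.ofReal
      (omegaB n β k (η - t • k) ^ p * Real.exp (-(phase n β t k η - phase n β σ k η)))
      ≤ ENNReal.ofReal (C * lam ^ (p - 1)) *
        ENNReal.ofReal (lam / (1 + (t - σ) * lam) ^ 2) := by
    intro t ht
    rw [← ENNReal.ofReal_mul (by positivity)]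
    apply ENNReal.ofReal_le_ofReal
    have hts : 0 ≤ t - σ := sub_nonneg.2 ht.1.le
    have h1 := hCb (t - σ) k (η - σ • k) hts (by linarith [ht.2])
    rw [← phase_sub_phase n hβ.1, show η - σ • k - (t - σ) • k = η - t • k by module,
      ← hl] at h1
    refine h1.trans ?_
    have hx1 : 1 ≤ 1 + (t - σ) * lam := by
      have : 0 ≤ (t - σ) * lam := by positivity
      linarith
    calc C * lam ^ p / (1 + (t - σ) * lam) ^ 3 ≤ C * lam ^ p / (1 + (t - σ) * lam) ^ 2 := by
          gcongr
          norm_num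
      _ = C * (lam ^ (p - 1) * lam) / (1 + (t - σ) * lam) ^ 2 := by
          rw [← Real.rpow_add_one hl0.ne']; ring_nf
      _ = _ := by ring
  calc _ ≤ ∫⁻ t in Ioo σ T, ENNReal.ofReal (C * lam ^ (p - 1)) *
        ENNReal.ofReal (lam / (1 + (t - σ) * lam) ^ 2) := setLIntegral_mono' measurableSet_Ioo hpt
    _ = ENNReal.ofReal (C * lam ^ (p - 1)) *
        ∫⁻ t in Ioo σ T, ENNReal.ofReal (lam / (1 + (t - σ) * lam) ^ 2) :=
        lintegral_const_mul' _ _ ENNReal.ofReal_ne_top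
    _ ≤ ENNReal.ofReal (C * lam ^ (p - 1)) * 1 := by
        gcongr; exact lintegral_Ioo_div_one_add_sub_mul_sq_le hl0 σ T
    _ = _ := mul_one _

/-- Backward weighted Schur bound of the propagator. -/
lemma exists_lintegral_backward_le (n : ℕ) {β : ℝ} (hβ : β ∈ Ioc (0:ℝ) 2) (T α : ℝ)
    (hT : 0 < T) (hα : 0 ≤ α) (hα' : α < 1) :
    ∃ C : ℝ, 0 < C ∧ ∀ (k η : En n) (t : ℝ), 0 < t → t ≤ T →
      ∫⁻ σ in Ioo 0 t, ENNReal.ofReal (omegaB n β k (η - t • k) * t ^ α *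
        (σ ^ (-α) * Real.exp (-(phase n β t k η - phase n β σ k η)))) ≤ ENNReal.ofReal C := by
  obtain ⟨C, hC, hCb⟩ := exists_omegaB_rpow_mul_exp_le n hβ T 0 hT le_rfl
  have h1α : 0 < 1 - α := by linarith
  refine ⟨C * (2 + 1 / (1 - α)), by positivity, fun k η t ht htT => ?_⟩
  set w := omegaB n β k (η - t • k) with hw
  have hw0 : 0 < w := omegaB_pos n β k _
  have hpt : ∀ σ ∈ Ioo 0 t, ENNReal.ofReal (w * t ^ α *
        (σ ^ (-α) * Real.exp (-(phase n β t k η - phase n β σ k η))))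
      ≤ ENNReal.ofReal C * (2 * ENNReal.ofReal (w / (1 + (t - σ) * w) ^ 2)
          + ENNReal.ofReal (t ^ (α - 1)) * ENNReal.ofReal (σ ^ (-α))) := by
    intro σ hσ
    have hσ0 : 0 < σ := hσ.1
    have hts : 0 ≤ t - σ := sub_nonneg.2 hσ.2.le
    rw [show (2:ℝ≥0∞) = ENNReal.ofReal 2 by simp, ← ENNReal.ofReal_mul (by norm_num),
      ← ENNReal.ofReal_mul (by positivity), ← ENNReal.ofReal_add (by positivity) (by positivity),
      ← ENNReal.ofReal_mul hC.le]
    apply ENNReal.ofReal_le_ofReal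
    have h1 := hCb (t - σ) (-k) (η - t • k) hts (by linarith)
    rw [← phase_sub_phase_reverse n hβ.1, omegaB_neg_left, omegaB_neg_left, ← hw,
      Real.rpow_zero, Real.rpow_zero, one_mul, mul_one] at h1
    have hx1 : 1 ≤ 1 + (t - σ) * w := by
      have : 0 ≤ (t - σ) * w := by positivity
      linarith
    have h2 : Real.exp (-(phase n β t k η - phase n β σ k η)) ≤ C / (1 + (t - σ) * w) ^ 2 := by
      refine h1.trans ?_
      gcongr
      norm_num
    have h3 : w * t ^ α * (σ ^ (-α) * (1 / (1 + (t - σ) * w) ^ 2)) ≤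
        2 * (w / (1 + (t - σ) * w) ^ 2) + t ^ (α - 1) * σ ^ (-α) := by
      have hq0 : 0 ≤ w / (1 + (t - σ) * w) ^ 2 := by positivity
      have hr0 : 0 ≤ t ^ (α - 1) * σ ^ (-α) := by positivity
      rcases le_total t (2 * σ) with h | h
      · have h4 : t ^ α * σ ^ (-α) ≤ 2 := by
          rw [Real.rpow_neg hσ0.le, ← div_eq_mul_inv, ← Real.div_rpow ht.le hσ0.le]
          calc (t / σ) ^ α ≤ 2 ^ α := by
                apply Real.rpow_le_rpow (by positivity) _ hα
                rwa [div_le_iff₀ hσ0]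
            _ ≤ 2 ^ (1:ℝ) := Real.rpow_le_rpow_of_exponent_le (by norm_num) hα'.le
            _ = 2 := Real.rpow_one 2
        calc w * t ^ α * (σ ^ (-α) * (1 / (1 + (t - σ) * w) ^ 2))
            = (t ^ α * σ ^ (-α)) * (w / (1 + (t - σ) * w) ^ 2) := by ring
          _ ≤ 2 * (w / (1 + (t - σ) * w) ^ 2) := by gcongr
          _ ≤ _ := by linarith
      · have h4 : t * w * (1 / (1 + (t - σ) * w) ^ 2) ≤ 1 := by
          rw [mul_one_div, div_le_one (by positivity)]
          nlinarith [mul_pos ht hw0, sq_nonneg ((t - σ) * w)]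
        have h5 : t ^ α = t ^ (α - 1) * t := by
          rw [← Real.rpow_add_one ht.ne']; ring_nf
        calc w * t ^ α * (σ ^ (-α) * (1 / (1 + (t - σ) * w) ^ 2))
            = (t ^ (α - 1) * σ ^ (-α)) * (t * w * (1 / (1 + (t - σ) * w) ^ 2)) := by
              rw [h5]; ring
          _ ≤ (t ^ (α - 1) * σ ^ (-α)) * 1 := by gcongr
          _ ≤ _ := by linarith
    calc w * t ^ α * (σ ^ (-α) * Real.exp (-(phase n β t k η - phase n β σ k η)))
        ≤ w * t ^ α * (σ ^ (-α) * (C / (1 + (t - σ) * w) ^ 2)) := by gcongr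
      _ = C * (w * t ^ α * (σ ^ (-α) * (1 / (1 + (t - σ) * w) ^ 2))) := by ring
      _ ≤ _ := by gcongr
  calc _ ≤ ∫⁻ σ in Ioo 0 t, ENNReal.ofReal C * (2 * ENNReal.ofReal (w / (1 + (t - σ) * w) ^ 2)
          + ENNReal.ofReal (t ^ (α - 1)) * ENNReal.ofReal (σ ^ (-α))) :=
        setLIntegral_mono' measurableSet_Ioo hpt
    _ = ENNReal.ofReal C * (2 * (∫⁻ σ in Ioo 0 t, ENNReal.ofReal (w / (1 + (t - σ) * w) ^ 2))
          + ENNReal.ofReal (t ^ (α - 1)) * ∫⁻ σ in Ioo 0 t, ENNReal.ofReal (σ ^ (-α))) := by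
        rw [lintegral_const_mul' _ _ ENNReal.ofReal_ne_top, lintegral_add_right _ (by fun_prop),
          lintegral_const_mul' _ _ (by simp), lintegral_const_mul' _ _ ENNReal.ofReal_ne_top]
    _ ≤ ENNReal.ofReal C * (2 * 1 + ENNReal.ofReal (1 / (1 - α))) := by
        gcongr
        · exact lintegral_Ioo_div_one_add_sub_mul_sq_le' hw0 0 t
        · rw [lintegral_Ioo_rpow_neg hα' ht, ← ENNReal.ofReal_mul (by positivity)]
          apply ENNReal.ofReal_le_ofReal
          rw [← mul_div_assoc, ← Real.rpow_add ht]
          simp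
    _ = _ := by
        rw [mul_one, show (2:ℝ≥0∞) = ENNReal.ofReal 2 by simp,
          ← ENNReal.ofReal_add (by norm_num) (by positivity), ← ENNReal.ofReal_mul hC.le]

lemma sq_lintegral_mul_le {X : Type*} [MeasurableSpace X] {ν : Measure X} {f g : X → ℝ≥0∞}
    (hf : AEMeasurable f ν) (hg : AEMeasurable g ν) :
    (∫⁻ x, f x * g x ∂ν) ^ 2 ≤ (∫⁻ x, f x ^ 2 ∂ν) * ∫⁻ x, g x ^ 2 ∂ν := by
  have h := ENNReal.lintegral_mul_le_Lp_mul_Lq ν Real.HolderConjugate.two_two hf hg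
  have h2 : ∀ a : ℝ≥0∞, (a ^ (1 / (2:ℝ))) ^ 2 = a := fun a => by
    rw [← ENNReal.rpow_natCast, ← ENNReal.rpow_mul]; simp
  calc (∫⁻ x, f x * g x ∂ν) ^ 2
      ≤ ((∫⁻ x, f x ^ (2:ℝ) ∂ν) ^ (1 / (2:ℝ)) * (∫⁻ x, g x ^ (2:ℝ) ∂ν) ^ (1 / (2:ℝ))) ^ 2 := by
        gcongr; exact h
    _ = _ := by
        rw [mul_pow, h2, h2]; simp

/-- The weight `(1 + ‖k‖² + ‖ξ‖²)⁻¹` of `H^{-1}`. -/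
def hweight (n : ℕ) (k ξ : En n) : ℝ := (1 + ‖k‖ ^ 2 + ‖ξ‖ ^ 2)⁻¹

lemma hweight_pos (n : ℕ) (k ξ : En n) : 0 < hweight n k ξ := by
  unfold hweight; positivity

lemma continuous_hweight (n : ℕ) : Continuous (fun q : En n × En n => hweight n q.1 q.2) := by
  unfold hweight
  exact Continuous.inv₀ (by fun_prop) fun q => by positivity

lemma hweight_le_mul_hweight_sub_smul (n : ℕ) {τ T : ℝ} (hτ : |τ| ≤ T) (k ξ : En n) :
    hweight n k ξ ≤ (2 + 2 * T ^ 2) * hweight n k (ξ - τ • k) := by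
  unfold hweight
  rw [← div_eq_mul_inv, inv_eq_one_div, div_le_div_iff₀ (by positivity) (by positivity), one_mul]
  have h1 : ‖ξ - τ • k‖ ≤ ‖ξ‖ + T * ‖k‖ := by
    have := norm_sub_le ξ (τ • k)
    rw [norm_smul, Real.norm_eq_abs] at this
    have h2 := mul_le_mul_of_nonneg_right hτ (norm_nonneg k)
    linarith
  have h2 : ‖ξ - τ • k‖ ^ 2 ≤ (‖ξ‖ + T * ‖k‖) ^ 2 := pow_le_pow_left₀ (norm_nonneg _) h1 2
  nlinarith [sq_nonneg (‖ξ‖ - T * ‖k‖), sq_nonneg ‖k‖, sq_nonneg T, sq_nonneg ‖ξ‖,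
    mul_nonneg (sq_nonneg T) (sq_nonneg ‖ξ‖)]

lemma hweight_le_omegaB_rpow (n : ℕ) {β p : ℝ} (hβ : β ∈ Ioc (0:ℝ) 2) (hp : -1 ≤ p)
    (k ξ : En n) : hweight n k ξ ≤ 3 * omegaB n β k ξ ^ p := by
  have key : ∀ x a : ℝ, 0 ≤ x → 0 ≤ a → a ≤ 2 → x ^ a ≤ 1 + x ^ 2 := by
    intro x a hx ha ha2
    rcases le_total x 1 with h | h
    · have := Real.rpow_le_one hx h ha
      nlinarith [sq_nonneg x]
    · have := Real.rpow_le_rpow_of_exponent_le h ha2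
      rw [Real.rpow_two] at this
      linarith
  have hβ0 := hβ.1
  have h1 : ‖k‖ ^ (β / (β + 1)) ≤ 1 + ‖k‖ ^ 2 := by
    apply key _ _ (norm_nonneg _) (by positivity)
    rw [div_le_iff₀ (by positivity)]; linarith
  have h2 : ‖ξ‖ ^ β ≤ 1 + ‖ξ‖ ^ 2 := key _ _ (norm_nonneg _) hβ.1.le hβ.2
  have h3 : omegaB n β k ξ ≤ 3 * (1 + ‖k‖ ^ 2 + ‖ξ‖ ^ 2) := by
    unfold omegaB
    nlinarith [sq_nonneg ‖k‖, sq_nonneg ‖ξ‖]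
  have h4 : omegaB n β k ξ ^ (-1 : ℝ) ≤ omegaB n β k ξ ^ p :=
    Real.rpow_le_rpow_of_exponent_le (one_le_omegaB n β k ξ) hp
  refine le_trans ?_ (mul_le_mul_of_nonneg_left h4 (by norm_num))
  have := omegaB_pos n β k ξ
  unfold hweight
  rw [Real.rpow_neg_one, ← div_eq_mul_inv, inv_eq_one_div,
    div_le_div_iff₀ (by positivity) this]
  linarith

/-- The shear `(k,ξ) ↦ (k, ξ - t k)` of phase space. -/
def shear (n : ℕ) (t : ℝ) : (En n × En n) ≃ₜ (En n × En n) where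
  toFun q := (q.1, q.2 - t • q.1)
  invFun q := (q.1, q.2 + t • q.1)
  left_inv q := by simp
  right_inv q := by simp
  continuous_toFun := by fun_prop
  continuous_invFun := by fun_prop

lemma shear_apply (n : ℕ) (t : ℝ) (q : En n × En n) : shear n t q = (q.1, q.2 - t • q.1) := rfl

lemma shear_symm_apply (n : ℕ) (t : ℝ) (q : En n × En n) :
    (shear n t).symm q = (q.1, q.2 + t • q.1) := rfl

lemma continuous_shear_uncurry (n : ℕ) :
    Continuous (fun p : ℝ × En n × En n => shear n p.1 p.2) := by
  simp only [shear_apply]; fun_prop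

lemma measurePreserving_shear (n : ℕ) (t : ℝ) :
    MeasurePreserving (shear n t) (volume : Measure (En n × En n)) volume := by
  have := MeasurePreserving.skew_product (MeasurePreserving.id (volume : Measure (En n)))
    (g := fun k ξ => ξ - t • k) (μc := (volume : Measure (En n))) (μd := (volume : Measure (En n)))
    (by fun_prop) (ae_of_all _ fun k => (measurePreserving_sub_right volume (t • k)).map_eq)
  exact this

lemma lintegral_shear (n : ℕ) (t : ℝ) (f : En n × En n → ℝ≥0∞) :
    ∫⁻ q, f (shear n t q) = ∫⁻ q, f q :=
  (measurePreserving_shear n t).lintegral_comp_emb (shear n t).measurableEmbedding f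

lemma integral_shear (n : ℕ) (t : ℝ) (f : En n × En n → ℂ) :
    ∫ q, f (shear n t q) = ∫ q, f q :=
  (measurePreserving_shear n t).integral_comp (shear n t).measurableEmbedding f

lemma lintegral_lintegral_shear_swap (n : ℕ) (T : ℝ) {f : ℝ × En n × En n → ℝ≥0∞}
    (hf : Measurable f) :
    ∫⁻ t in Ioo 0 T, ∫⁻ q, f (t, q) = ∫⁻ q, ∫⁻ t in Ioo 0 T, f (t, shear n t q) := by
  simp_rw [← fun t => lintegral_shear n t (fun q => f (t, q))]
  apply lintegral_lintegral_swap
  exact (hf.comp (measurable_fst.prodMk (continuous_shear_uncurry n).measurable)).aemeasurable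

lemma Xnorm_eq (n : ℕ) {β : ℝ} (hβ : 0 < β) (s : ℝ) {w : En n → En n → ℂ}
    (hw : Measurable (fun q : En n × En n => w q.1 q.2)) :
    Xnorm n β s w = ∫⁻ q : En n × En n,
      ENNReal.ofReal (omegaB n β q.1 q.2 ^ (2 * s)) * ‖w q.1 q.2‖ₑ ^ 2 := by
  have h : ∀ k ξ : En n, ENNReal.ofReal (omegaB n β k ξ ^ (2 * s) * ‖w k ξ‖ ^ 2) =
      ENNReal.ofReal (omegaB n β k ξ ^ (2 * s)) * ‖w k ξ‖ₑ ^ 2 := fun k ξ => by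
    rw [ENNReal.ofReal_mul (Real.rpow_nonneg (omegaB_pos _ _ _ _).le _),
      ENNReal.ofReal_pow (norm_nonneg _), ofReal_norm]
  unfold Xnorm
  simp_rw [h]
  rw [Measure.volume_eq_prod, lintegral_prod]
  have := (continuous_omegaB n hβ).measurable
  fun_prop

lemma L2X_eq (n : ℕ) {β : ℝ} (hβ : 0 < β) (s T μ : ℝ) {U : ℝ → En n → En n → ℂ}
    (hU : MeasU n U) :
    L2X n β s T μ U = ∫⁻ t in Ioo 0 T, ∫⁻ q : En n × En n, ENNReal.ofReal (t ^ (2 - 2 * μ)) *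
      (ENNReal.ofReal (omegaB n β q.1 q.2 ^ (2 * s)) * ‖U t q.1 q.2‖ₑ ^ 2) := by
  unfold L2X
  congr 1; ext t
  rw [Xnorm_eq n hβ s (w := U t) (hU.comp (measurable_const.prodMk measurable_id)),
    lintegral_const_mul' _ _ ENNReal.ofReal_ne_top]

lemma Hm1_eq (n : ℕ) {w : En n → En n → ℂ}
    (hw : Measurable (fun q : En n × En n => w q.1 q.2)) :
    Hm1 n w = ∫⁻ q : En n × En n,
      ENNReal.ofReal (hweight n q.1 q.2) * ‖w q.1 q.2‖ₑ ^ 2 := by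
  have h : ∀ k ξ : En n, ENNReal.ofReal ((1 + ‖k‖ ^ 2 + ‖ξ‖ ^ 2)⁻¹ * ‖w k ξ‖ ^ 2) =
      ENNReal.ofReal (hweight n k ξ) * ‖w k ξ‖ₑ ^ 2 := fun k ξ => by
    rw [ENNReal.ofReal_mul (by positivity),
      ENNReal.ofReal_pow (norm_nonneg _), ofReal_norm, hweight]
  unfold Hm1
  simp_rw [h]
  rw [Measure.volume_eq_prod, lintegral_prod]
  have := (continuous_hweight n).measurable
  fun_prop

/-- The squared norm of `L²((0,T), t^α dt; H^{-1})` on the Fourier side. -/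
def L2Hm1 (n : ℕ) (T α : ℝ) (U : ℝ → En n → En n → ℂ) : ℝ≥0∞ :=
  ∫⁻ t in Ioo 0 T, ∫⁻ q : En n × En n, ENNReal.ofReal (t ^ α) *
      (ENNReal.ofReal (hweight n q.1 q.2) * ‖U t q.1 q.2‖ₑ ^ 2)

lemma L2Hm1_lt_top (n : ℕ) {β s T μ : ℝ} (hβ : β ∈ Ioc (0:ℝ) 2) (hs : -(1 / 2 : ℝ) ≤ s)
    {U : ℝ → En n → En n → ℂ} (hU : MeasU n U) (h : L2X n β s T μ U < ⊤) :
    L2Hm1 n T (2 - 2 * μ) U < ⊤ := by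
  rw [L2X_eq n hβ.1 s T μ hU] at h
  refine lt_of_le_of_lt ?_ (ENNReal.mul_lt_top (a := 3) (by simp) h)
  rw [← lintegral_const_mul' _ _ (by simp)]
  refine lintegral_mono fun t => ?_
  rw [← lintegral_const_mul' _ _ (by simp)]
  refine lintegral_mono fun q => ?_
  have h1 : ENNReal.ofReal (hweight n q.1 q.2)
      ≤ 3 * ENNReal.ofReal (omegaB n β q.1 q.2 ^ (2 * s)) := by
    rw [show (3:ℝ≥0∞) = ENNReal.ofReal 3 by simp, ← ENNReal.ofReal_mul (by norm_num)]
    exact ENNReal.ofReal_le_ofReal (hweight_le_omegaB_rpow n hβ (by linarith) _ _)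
  calc ENNReal.ofReal (t ^ (2 - 2 * μ)) *
      (ENNReal.ofReal (hweight n q.1 q.2) * ‖U t q.1 q.2‖ₑ ^ 2)
      ≤ ENNReal.ofReal (t ^ (2 - 2 * μ)) *
      (3 * ENNReal.ofReal (omegaB n β q.1 q.2 ^ (2 * s)) * ‖U t q.1 q.2‖ₑ ^ 2) := by gcongr
    _ = _ := by ring

/-- A phase-space field read along the characteristics of the transport operator. -/
def alongChar (n : ℕ) (U : ℝ → En n → En n → ℂ) : ℝ → En n → En n → ℂ :=
  fun t k η => U t k (η - t • k)

lemma measU_alongChar (n : ℕ) {U : ℝ → En n → En n → ℂ} (hU : MeasU n U) :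
    MeasU n (alongChar n U) :=
  hU.comp (measurable_fst.prodMk (continuous_shear_uncurry n).measurable)

lemma L2Hm1_alongChar_lt_top (n : ℕ) {T α : ℝ} {U : ℝ → En n → En n → ℂ}
    (h : L2Hm1 n T α U < ⊤) : L2Hm1 n T α (alongChar n U) < ⊤ := by
  refine lt_of_le_of_lt ?_ (ENNReal.mul_lt_top (a := ENNReal.ofReal (2 + 2 * T ^ 2)) (by simp) h)
  unfold L2Hm1
  rw [← lintegral_const_mul' _ _ (by simp)]
  refine setLIntegral_mono' measurableSet_Ioo fun t ht => ?_
  rw [← lintegral_const_mul' _ _ (by simp), ← lintegral_shear n t (fun q =>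
    ENNReal.ofReal (2 + 2 * T ^ 2) * (ENNReal.ofReal (t ^ α) *
      (ENNReal.ofReal (hweight n q.1 q.2) * ‖U t q.1 q.2‖ₑ ^ 2)))]
  refine lintegral_mono fun q => ?_
  have h1 : ENNReal.ofReal (hweight n q.1 q.2)
      ≤ ENNReal.ofReal (2 + 2 * T ^ 2) * ENNReal.ofReal (hweight n q.1 (q.2 - t • q.1)) := by
    rw [← ENNReal.ofReal_mul (by positivity)]
    apply ENNReal.ofReal_le_ofReal
    apply hweight_le_mul_hweight_sub_smul
    rw [abs_of_pos ht.1]; exact ht.2.le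
  simp only [shear_apply, alongChar]
  calc _ ≤ ENNReal.ofReal (t ^ α) *
      (ENNReal.ofReal (2 + 2 * T ^ 2) * ENNReal.ofReal (hweight n q.1 (q.2 - t • q.1)) *
        ‖U t q.1 (q.2 - t • q.1)‖ₑ ^ 2) := by gcongr
    _ = _ := by ring

lemma integrableOn_rpow_neg {α : ℝ} (hα : α < 1) (T : ℝ) :
    IntegrableOn (fun t : ℝ => t ^ (-α)) (Ioo 0 T) := by
  rcases le_total 0 T with hT | hT
  · have hi : IntervalIntegrable (fun σ : ℝ => σ ^ (-α)) volume 0 T :=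
      intervalIntegral.intervalIntegrable_rpow' (by linarith)
    exact ((intervalIntegrable_iff_integrableOn_Ioc_of_le hT).1 hi).mono_set Ioo_subset_Ioc_self
  · rw [Ioo_eq_empty (not_lt.2 hT)]; exact integrableOn_empty

lemma mul_le_weighted_sq_add {t α m x B : ℝ} (ht : 0 < t) (hm : 0 < m) :
    x * B ≤ t ^ α * (m * x ^ 2) + B ^ 2 * (t ^ (-α) * m⁻¹) := by
  have h1 : 0 < t ^ α := by positivity
  rw [Real.rpow_neg ht.le]
  set c := t ^ α * m with hc
  have hcpos : 0 < c := by positivity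
  have h2 : t ^ α * (m * x ^ 2) + B ^ 2 * ((t ^ α)⁻¹ * m⁻¹) = c * x ^ 2 + B ^ 2 / c := by
    rw [hc]; field_simp
  rw [h2]
  have h3 : c * x ^ 2 + B ^ 2 / c - 2 * (x * B) = (c * x - B) ^ 2 / c := by
    field_simp; ring
  have h4 : 0 ≤ (c * x - B) ^ 2 / c := by positivity
  have h5 : 0 ≤ c * x ^ 2 + B ^ 2 / c := by positivity
  linarith

/-- Fields of finite weighted `H^{-1}` norm are integrable against bounded functions with
compact support in phase space. -/
lemma integrable_mul_of_L2Hm1 (n : ℕ) {T α : ℝ} (hα' : α < 1)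
    {U : ℝ → En n → En n → ℂ} (hU : MeasU n U) (h : L2Hm1 n T α U < ⊤)
    {Φ : ℝ × En n × En n → ℝ} (hΦ : Measurable Φ) {B : ℝ} (hB : ∀ p, |Φ p| ≤ B)
    {K : Set (En n × En n)} (hK : IsCompact K) (hΦK : ∀ p, p.2 ∉ K → Φ p = 0) :
    Integrable (fun p : ℝ × En n × En n => U p.1 p.2.1 p.2.2 * (Φ p : ℂ))
      ((volume.restrict (Ioo 0 T)).prod volume) := by
  have hm := (continuous_hweight n).measurable
  have i1 : Integrable (fun p : ℝ × En n × En n =>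
      p.1 ^ α * (hweight n p.2.1 p.2.2 * ‖U p.1 p.2.1 p.2.2‖ ^ 2))
      ((volume.restrict (Ioo 0 T)).prod volume) := by
    have hmeas : Measurable (fun p : ℝ × En n × En n =>
      p.1 ^ α * (hweight n p.2.1 p.2.2 * ‖U p.1 p.2.1 p.2.2‖ ^ 2)) :=
      (measurable_fst.pow_const α).mul ((hm.comp measurable_snd).mul (hU.norm.pow_const 2))
    refine ⟨hmeas.aestronglyMeasurable, ?_⟩
    rw [HasFiniteIntegral, lintegral_prod _ hmeas.enorm.aemeasurable]
    refine lt_of_le_of_lt (le_of_eq ?_) h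
    refine setLIntegral_congr_fun measurableSet_Ioo fun t ht => ?_
    refine lintegral_congr fun q => ?_
    have := hweight_pos n q.1 q.2
    have ht0 : 0 < t := ht.1
    rw [Real.enorm_of_nonneg (by positivity), ENNReal.ofReal_mul (by positivity),
      ENNReal.ofReal_mul this.le, ENNReal.ofReal_pow (norm_nonneg _), ofReal_norm]
  have i2 : Integrable (fun p : ℝ × En n × En n => B ^ 2 * (p.1 ^ (-α) *
      K.indicator (fun q => (hweight n q.1 q.2)⁻¹) p.2))
      ((volume.restrict (Ioo 0 T)).prod volume) := by
    apply Integrable.const_mul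
    apply Integrable.mul_prod (integrableOn_rpow_neg hα' T)
    rw [integrable_indicator_iff hK.measurableSet]
    apply ContinuousOn.integrableOn_compact hK
    exact ((continuous_hweight n).inv₀ fun q => (hweight_pos n _ _).ne').continuousOn
  refine (i1.add i2).mono'
    (hU.mul (Complex.measurable_ofReal.comp hΦ)).aestronglyMeasurable ?_
  have hae : ∀ᵐ p : ℝ × En n × En n ∂((volume.restrict (Ioo 0 T)).prod volume),
      p.1 ∈ Ioo 0 T :=
    Measure.quasiMeasurePreserving_fst.ae (ae_restrict_mem measurableSet_Ioo)
  filter_upwards [hae] with p hp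
  have hw := hweight_pos n p.2.1 p.2.2
  have hp0 : 0 < p.1 := hp.1
  simp only [Pi.add_apply]
  by_cases hpK : p.2 ∈ K
  · rw [indicator_of_mem hpK, norm_mul, Complex.norm_real, Real.norm_eq_abs]
    calc _ ≤ ‖U p.1 p.2.1 p.2.2‖ * B := by gcongr; exact hB p
      _ ≤ _ := mul_le_weighted_sq_add hp.1 hw
  · rw [hΦK p hpK, indicator_of_notMem hpK]
    simp only [Complex.ofReal_zero, mul_zero, norm_zero, add_zero]
    positivity

lemma ae_integrableOn_of_L2Hm1 (n : ℕ) {T α : ℝ} (hα' : α < 1)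
    {U : ℝ → En n → En n → ℂ} (hU : MeasU n U) (h : L2Hm1 n T α U < ⊤) :
    ∀ᵐ q : En n × En n, IntegrableOn (fun t => U t q.1 q.2) (Ioo 0 T) := by
  have hm := (continuous_hweight n).measurable
  have hmeas : Measurable (fun p : ℝ × En n × En n => ENNReal.ofReal (p.1 ^ α) *
      (ENNReal.ofReal (hweight n p.2.1 p.2.2) * ‖U p.1 p.2.1 p.2.2‖ₑ ^ 2)) :=
    (measurable_fst.pow_const α).ennreal_ofReal.mul
      (((hm.comp measurable_snd).ennreal_ofReal).mul (hU.enorm.pow_const 2))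
  unfold L2Hm1 at h
  rw [lintegral_lintegral_swap hmeas.aemeasurable] at h
  have hms : Measurable (fun q : En n × En n => ∫⁻ t in Ioo 0 T, ENNReal.ofReal (t ^ α) *
      (ENNReal.ofReal (hweight n q.1 q.2) * ‖U t q.1 q.2‖ₑ ^ 2)) :=
    Measurable.lintegral_prod_left' (f := fun p : ℝ × En n × En n => ENNReal.ofReal (p.1 ^ α) *
      (ENNReal.ofReal (hweight n p.2.1 p.2.2) * ‖U p.1 p.2.1 p.2.2‖ₑ ^ 2)) hmeas
  filter_upwards [ae_lt_top hms h.ne] with q hq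
  have hUq : Measurable (fun t => U t q.1 q.2) := hU.comp (measurable_id.prodMk measurable_const)
  have i1 : IntegrableOn (fun t : ℝ => t ^ α * (hweight n q.1 q.2 * ‖U t q.1 q.2‖ ^ 2))
      (Ioo 0 T) := by
    refine ⟨((measurable_id.pow_const α).mul
      (measurable_const.mul (hUq.norm.pow_const 2))).aestronglyMeasurable, ?_⟩
    refine lt_of_le_of_lt (le_of_eq ?_) hq
    refine setLIntegral_congr_fun measurableSet_Ioo fun t ht => ?_
    have := hweight_pos n q.1 q.2
    have ht0 : 0 < t := ht.1
    rw [Real.enorm_of_nonneg (by positivity), ENNReal.ofReal_mul (by positivity),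
      ENNReal.ofReal_mul this.le, ENNReal.ofReal_pow (norm_nonneg _), ofReal_norm]
  have i2 : IntegrableOn (fun t : ℝ => (1:ℝ) ^ 2 * (t ^ (-α) * (hweight n q.1 q.2)⁻¹)) (Ioo 0 T) :=
    ((integrableOn_rpow_neg hα' T).mul_const _).const_mul _
  refine (i1.add i2).mono' hUq.aestronglyMeasurable ?_
  refine (ae_restrict_iff' measurableSet_Ioo).2 (ae_of_all _ fun t ht => ?_)
  have := mul_le_weighted_sq_add (α := α) (x := ‖U t q.1 q.2‖) (B := 1) ht.1
    (hweight_pos n q.1 q.2)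
  simpa using this

lemma continuousOn_primitive_Ioo {T : ℝ} {h : ℝ → ℂ} (hh : IntegrableOn h (Ioo 0 T)) :
    ContinuousOn (fun t => ∫ σ in Ioo 0 t, h σ) (Icc 0 T) := by
  have := intervalIntegral.continuousOn_primitive ((integrableOn_Icc_iff_integrableOn_Ioo (by simp) (by simp)).2 hh)
  simpa only [integral_Ioc_eq_integral_Ioo] using this

lemma integral_primitive_mul_deriv {T : ℝ} {h : ℝ → ℂ} (hh : IntegrableOn h (Ioo 0 T))
    {ψ ψ' : ℝ → ℝ} (hd : ∀ t, HasDerivAt ψ (ψ' t) t) (hc : Continuous ψ') :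
    ∫ t in Ioo 0 T, (∫ σ in Ioo 0 t, h σ) * (ψ' t : ℂ)
      = ∫ σ in Ioo 0 T, h σ * ((ψ T - ψ σ : ℝ) : ℂ) := by
  have hS : MeasurableSet {p : ℝ × ℝ | p.2 < p.1} := measurableSet_lt measurable_snd measurable_fst
  have hInt : Integrable (fun p : ℝ × ℝ => {p : ℝ × ℝ | p.2 < p.1}.indicator
      (fun p => (ψ' p.1 : ℂ) * h p.2) p)
      ((volume.restrict (Ioo 0 T)).prod (volume.restrict (Ioo 0 T))) := by
    apply Integrable.indicator _ hS
    have i : Integrable (fun t => (ψ' t : ℂ)) (volume.restrict (Ioo 0 T)) :=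
      ((Complex.continuous_ofReal.comp hc).continuousOn.integrableOn_compact
        isCompact_Icc).mono_set Ioo_subset_Icc_self
    exact Integrable.mul_prod i hh
  calc ∫ t in Ioo 0 T, (∫ σ in Ioo 0 t, h σ) * (ψ' t : ℂ)
      = ∫ t in Ioo 0 T, ∫ σ in Ioo 0 T, {p : ℝ × ℝ | p.2 < p.1}.indicator
          (fun p => (ψ' p.1 : ℂ) * h p.2) (t, σ) := by
        refine setIntegral_congr_fun measurableSet_Ioo fun t ht => ?_
        have : (fun σ => {p : ℝ × ℝ | p.2 < p.1}.indicator
          (fun p => (ψ' p.1 : ℂ) * h p.2) (t, σ)) =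
            (Iio t).indicator (fun σ => (ψ' t : ℂ) * h σ) := by
          ext σ; simp [indicator]
        simp only [this]
        rw [setIntegral_indicator measurableSet_Iio, Ioo_inter_Iio, min_eq_right ht.2.le,
          integral_const_mul, mul_comm]
    _ = ∫ σ in Ioo 0 T, ∫ t in Ioo 0 T, {p : ℝ × ℝ | p.2 < p.1}.indicator
          (fun p => (ψ' p.1 : ℂ) * h p.2) (t, σ) :=
        integral_integral_swap (f := fun t σ => {p : ℝ × ℝ | p.2 < p.1}.indicator
          (fun p => (ψ' p.1 : ℂ) * h p.2) (t, σ)) hInt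
    _ = ∫ σ in Ioo 0 T, h σ * ((ψ T - ψ σ : ℝ) : ℂ) := by
        refine setIntegral_congr_fun measurableSet_Ioo fun σ hσ => ?_
        have : (fun t => {p : ℝ × ℝ | p.2 < p.1}.indicator
          (fun p => (ψ' p.1 : ℂ) * h p.2) (t, σ)) =
            (Ioi σ).indicator (fun t => (ψ' t : ℂ) * h σ) := by
          ext t; simp [indicator]
        simp only [this]
        rw [setIntegral_indicator measurableSet_Ioi, Ioo_inter_Ioi, max_eq_right hσ.1.le,
          integral_mul_const, mul_comm, ← integral_Ioc_eq_integral_Ioo,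
          ← intervalIntegral.integral_of_le hσ.2.le, intervalIntegral.integral_ofReal,
          intervalIntegral.integral_eq_sub_of_hasDerivAt (fun t _ => hd t)
            (hc.intervalIntegrable _ _)]

lemma integral_const_add_primitive_mul_deriv {T : ℝ} (hT : 0 ≤ T) {h : ℝ → ℂ}
    (hh : IntegrableOn h (Ioo 0 T)) {ψ ψ' : ℝ → ℝ} (hd : ∀ t, HasDerivAt ψ (ψ' t) t)
    (hc : Continuous ψ') (h0 : ψ 0 = 0) (h1 : ψ T = 0) (c : ℂ) :
    ∫ t in Ioo 0 T, (c + ∫ σ in Ioo 0 t, h σ) * (ψ' t : ℂ)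
      = -∫ σ in Ioo 0 T, h σ * (ψ σ : ℂ) := by
  have hcc : Continuous (fun t => (ψ' t : ℂ)) := Complex.continuous_ofReal.comp hc
  have i1 : IntegrableOn (fun t => c * (ψ' t : ℂ)) (Ioo 0 T) :=
    ((continuous_const.mul hcc).continuousOn.integrableOn_compact
      isCompact_Icc).mono_set Ioo_subset_Icc_self
  have i2 : IntegrableOn (fun t => (∫ σ in Ioo 0 t, h σ) * (ψ' t : ℂ)) (Ioo 0 T) :=
    (((continuousOn_primitive_Ioo hh).mul hcc.continuousOn).integrableOn_compact
      isCompact_Icc).mono_set Ioo_subset_Icc_self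
  simp_rw [add_mul]
  rw [integral_add i1 i2, integral_primitive_mul_deriv hh hd hc, integral_const_mul,
    ← integral_Ioc_eq_integral_Ioo (f := fun t => (ψ' t : ℂ)),
    ← intervalIntegral.integral_of_le hT, intervalIntegral.integral_ofReal,
    intervalIntegral.integral_eq_sub_of_hasDerivAt (fun t _ => hd t) (hc.intervalIntegrable _ _),
    h0, h1, ← integral_neg]
  simp

lemma exists_contDiff_nonneg_integral_eq_one {ε : ℝ} (hε : 0 < ε) :
    ∃ ρ : ℝ → ℝ, ContDiff ℝ ((⊤ : ℕ∞) : WithTop ℕ∞) ρ ∧ (∀ t, 0 ≤ ρ t) ∧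
      (∀ t ∉ Ioo 0 ε, ρ t = 0) ∧ ∫ t, ρ t = 1 ∧ Integrable ρ := by
  let f : ContDiffBump (ε / 2) := ⟨ε / 8, ε / 4, by positivity, by linarith⟩
  refine ⟨f.normed volume, f.contDiff_normed, f.nonneg_normed, fun t ht => ?_,
    f.integral_normed, f.integrable_normed⟩
  by_contra hne
  have : t ∈ Function.support (f.normed volume) := hne
  rw [f.support_normed_eq, Real.ball_eq_Ioo] at this
  have hr : f.rOut = ε / 4 := rfl
  rw [hr] at this
  exact ht ⟨by linarith [this.1], by linarith [this.2]⟩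

/-- One-dimensional distributional equation `v' = w` with initial value `c`. -/
lemma ae_eq_const_add_primitive_of_weak {T : ℝ} (hT : 0 < T) {v w : ℝ → ℂ}
    (hv : IntegrableOn v (Ioo 0 T)) (hw : IntegrableOn w (Ioo 0 T)) {c : ℂ}
    (hlim : Tendsto v (nhdsWithin 0 (Ioo 0 T)) (nhds c))
    (hweak : ∀ θ : ℝ → ℝ, ContDiff ℝ ((⊤ : ℕ∞) : WithTop ℕ∞) θ → (∀ t ∉ Ioo 0 T, θ t = 0) →
      -(∫ t in Ioo 0 T, v t * ((deriv θ t : ℝ) : ℂ)) = ∫ t in Ioo 0 T, w t * (θ t : ℂ)) :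
    ∀ᵐ t ∂(volume.restrict (Ioo 0 T)), v t = c + ∫ σ in Ioo 0 t, w σ := by
  have hWc := continuousOn_primitive_Ioo hw
  set W : ℝ → ℂ := fun t => c + ∫ σ in Ioo 0 t, w σ with hW
  have hWcont : ContinuousOn W (Icc 0 T) := continuousOn_const.add hWc
  have hWint : IntegrableOn W (Ioo 0 T) :=
    (hWcont.integrableOn_compact isCompact_Icc).mono_set Ioo_subset_Icc_self
  set z : ℝ → ℂ := fun t => v t - W t with hz
  have hzint : IntegrableOn z (Ioo 0 T) := hv.sub hWint
  have hzlim : Tendsto z (nhdsWithin 0 (Ioo 0 T)) (nhds 0) := by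
    have h1 : Tendsto W (nhdsWithin 0 (Ioo 0 T)) (nhds (W 0)) :=
      (hWcont 0 (left_mem_Icc.2 hT.le)).mono Ioo_subset_Icc_self
    have h2 : W 0 = c := by simp [hW]
    rw [h2] at h1
    simpa using hlim.sub h1
  have bdd_mul : ∀ {g : ℝ → ℝ}, Continuous g → ∀ {f : ℝ → ℂ}, IntegrableOn f (Ioo 0 T) →
      IntegrableOn (fun t => f t * (g t : ℂ)) (Ioo 0 T) := by
    intro g hg f hf
    obtain ⟨C, hC⟩ := (isCompact_Icc (a := (0:ℝ)) (b := T)).exists_bound_of_continuousOn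
      hg.continuousOn
    refine Integrable.mul_bdd (c := C) hf
      (Complex.continuous_ofReal.comp hg).aestronglyMeasurable ?_
    refine (ae_restrict_iff' measurableSet_Ioo).2 (ae_of_all _ fun t ht => ?_)
    simpa using hC t (Ioo_subset_Icc_self ht)
  have hzθ : ∀ θ : ℝ → ℝ, ContDiff ℝ ((⊤ : ℕ∞) : WithTop ℕ∞) θ → (∀ t ∉ Ioo 0 T, θ t = 0) →
      ∫ t in Ioo 0 T, z t * ((deriv θ t : ℝ) : ℂ) = 0 := by
    intro θ hθ hθ0
    have hd : ∀ t, HasDerivAt θ (deriv θ t) t := fun t =>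
      ((hθ.differentiable (by simp)) t).hasDerivAt
    have hc : Continuous (deriv θ) := hθ.continuous_deriv (by simp)
    have e1 := integral_const_add_primitive_mul_deriv hT.le hw hd hc (hθ0 0 (by simp))
      (hθ0 T (by simp)) c
    have e2 := hweak θ hθ hθ0
    simp only [hz, sub_mul]
    rw [integral_sub (bdd_mul hc hv) (bdd_mul hc hWint)]
    rw [show (∫ t in Ioo 0 T, W t * ((deriv θ t : ℝ) : ℂ)) = _ from e1, ← e2]
    ring
  have key : ∀ᵐ t, t ∈ Ioo 0 T → z t = 0 := by
    apply isOpen_Ioo.ae_eq_zero_of_integral_contDiff_smul_eq_zero hzint.locallyIntegrableOn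
    intro φ hφ hφc hφs
    have hφ0 : ∀ t ∉ Ioo 0 T, φ t = 0 := fun t ht => by
      by_contra hne
      exact ht (hφs (subset_tsupport φ hne))
    have hφi : Integrable φ := hφ.continuous.integrable_of_hasCompactSupport hφc
    have hset : ∫ t, φ t • z t = ∫ t in Ioo 0 T, z t * (φ t : ℂ) := by
      rw [← integral_indicator measurableSet_Ioo]
      congr 1; ext t
      by_cases ht : t ∈ Ioo 0 T
      · simp [indicator_of_mem ht, mul_comm]
      · simp [indicator_of_notMem ht, hφ0 t ht]
    rw [hset]
    set I : ℝ := ∫ t, φ t with hI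
    have main : ∀ δ > 0, ‖∫ t in Ioo 0 T, z t * (φ t : ℂ)‖ ≤ |I| * δ := by
      intro δ hδ
      have hev : ∀ᶠ t in nhdsWithin 0 (Ioo 0 T), ‖z t‖ < δ := by
        have := hzlim.norm
        rw [norm_zero] at this
        exact this.eventually (gt_mem_nhds hδ)
      rw [nhdsWithin_Ioo_eq_nhdsGT hT] at hev
      obtain ⟨ε, hε, hεz⟩ := mem_nhdsGT_iff_exists_Ioo_subset.1 hev
      have hε0 : (0:ℝ) < ε := hε
      have hmin : 0 < min ε T := lt_min hε0 hT
      obtain ⟨ρ, hρ, hρn, hρ0, hρ1, hρi⟩ := exists_contDiff_nonneg_integral_eq_one hmin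
      have hρT : ∀ t ∉ Ioo 0 T, ρ t = 0 := fun t ht => hρ0 t fun h =>
        ht ⟨h.1, h.2.trans_le (min_le_right _ _)⟩
      set g : ℝ → ℝ := fun t => φ t - I * ρ t with hg
      have hgs : ContDiff ℝ ((⊤ : ℕ∞) : WithTop ℕ∞) g := hφ.sub (contDiff_const.mul hρ)
      have hgi : Integrable g := hφi.sub (hρi.const_mul I)
      have hg0 : ∀ t ∉ Ioo 0 T, g t = 0 := fun t ht => by simp [hg, hφ0 t ht, hρT t ht]
      have hgI : ∫ t, g t = 0 := by
        rw [hg, integral_sub hφi (hρi.const_mul I), integral_const_mul, hρ1]; simp [hI]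
      set θ : ℝ → ℝ := fun t => ∫ r in (0:ℝ)..t, g r with hθ
      have hθd : ∀ t, HasDerivAt θ (g t) t := fun t =>
        intervalIntegral.integral_hasDerivAt_right (hgs.continuous.intervalIntegrable _ _)
          (hgs.continuous.stronglyMeasurableAtFilter _ _) hgs.continuous.continuousAt
      have hθderiv : deriv θ = g := funext fun t => (hθd t).deriv
      have hθs : ContDiff ℝ ((⊤ : ℕ∞) : WithTop ℕ∞) θ := by
        rw [contDiff_infty_iff_deriv]
        exact ⟨fun t => (hθd t).differentiableAt, by rw [hθderiv]; exact hgs⟩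
      have hθ0 : ∀ t ∉ Ioo 0 T, θ t = 0 := by
        intro t ht
        rcases le_or_gt t 0 with h | h
        · simp only [hθ]
          rw [intervalIntegral.integral_symm, intervalIntegral.integral_of_le h,
            setIntegral_congr_fun measurableSet_Ioc (g := fun _ => (0:ℝ))]
          · simp
          · intro r hr
            exact hg0 r fun h' => absurd h'.1 (not_lt.2 hr.2)
        · have hTt : T ≤ t := by
            by_contra hlt
            exact ht ⟨h, not_le.1 hlt⟩
          simp only [hθ]
          rw [intervalIntegral.integral_of_le h.le, setIntegral_eq_integral_of_forall_compl_eq_zero,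
            hgI]
          intro r hr
          exact hg0 r fun h' => hr ⟨h'.1, h'.2.le.trans hTt⟩
      have e1 := hzθ θ hθs hθ0
      rw [hθderiv] at e1
      have e2 : ∫ t in Ioo 0 T, z t * (φ t : ℂ) = I * ∫ t in Ioo 0 T, z t * (ρ t : ℂ) := by
        rw [← integral_const_mul, ← sub_eq_zero, ← integral_sub (bdd_mul hφ.continuous hzint)
          ((bdd_mul hρ.continuous hzint).const_mul _), ← e1]
        congr 1; ext t; simp only [hg]; push_cast; ring
      rw [e2, norm_mul, Complex.norm_real, Real.norm_eq_abs]
      gcongr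
      calc ‖∫ t in Ioo 0 T, z t * (ρ t : ℂ)‖ ≤ ∫ t in Ioo 0 T, δ * ρ t := by
            apply norm_integral_le_of_norm_le (hρi.integrableOn.const_mul δ)
            refine ae_of_all _ fun t => ?_
            rw [norm_mul, Complex.norm_real, Real.norm_of_nonneg (hρn t)]
            by_cases ht : t ∈ Ioo 0 (min ε T)
            · exact mul_le_mul_of_nonneg_right
                (le_of_lt (hεz ⟨ht.1, ht.2.trans_le (min_le_left _ _)⟩)) (hρn t)
            · simp [hρ0 t ht]
        _ = δ := by
            rw [integral_const_mul, setIntegral_eq_integral_of_forall_compl_eq_zero hρT, hρ1,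
              mul_one]
    rw [← norm_le_zero_iff]
    have hl : Tendsto (fun δ : ℝ => |I| * δ) (nhdsWithin 0 (Ioi 0)) (nhds 0) := by
      have : Tendsto (fun δ : ℝ => |I| * δ) (nhds 0) (nhds (|I| * 0)) :=
        (continuous_const.mul continuous_id).tendsto 0
      rw [mul_zero] at this
      exact this.mono_left nhdsWithin_le_nhds
    exact ge_of_tendsto hl (eventually_mem_nhdsWithin.mono fun δ hδ => main δ hδ)
  refine (ae_restrict_iff' measurableSet_Ioo).2 (key.mono fun t ht hmem => ?_)
  exact sub_eq_zero.1 (ht hmem)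

lemma ae_eq_zero_of_forall_integral_Ioo_rat {f : ℝ → ℂ} (hf : Integrable f)
    (h : ∀ a b : ℚ, ∫ t in Ioo (a : ℝ) b, f t = 0) (huniv : ∫ t, f t = 0) :
    ∀ᵐ t, f t = 0 := by
  apply Integrable.ae_eq_zero_of_forall_setIntegral_eq_zero hf
  intro s hs hfin
  clear hfin
  induction s, hs using MeasurableSpace.induction_on_inter
    (Real.borel_eq_generateFrom_Ioo_rat ▸ BorelSpace.measurable_eq) Real.isPiSystem_Ioo_rat with
  | empty => simp
  | basic t ht =>
    simp only [mem_iUnion, mem_singleton_iff] at ht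
    obtain ⟨a, b, _, rfl⟩ := ht
    exact h a b
  | compl t htm ih =>
    have h1 := integral_add_compl htm hf
    rwa [ih, zero_add, huniv] at h1
  | iUnion g hd hm ih =>
    rw [integral_iUnion hm hd hf.integrableOn]
    simp [ih]

/-- The shear of space-time which straightens the characteristics. -/
def spaceTimeShear (n : ℕ) : (ℝ × En n × En n) ≃ₜ (ℝ × En n × En n) where
  toFun p := (p.1, p.2.1, p.2.2 - p.1 • p.2.1)
  invFun p := (p.1, p.2.1, p.2.2 + p.1 • p.2.1)
  left_inv p := by simp
  right_inv p := by simp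
  continuous_toFun := by fun_prop
  continuous_invFun := by fun_prop

lemma contDiff_spaceTimeShear (n : ℕ) :
    ContDiff ℝ ((⊤ : ℕ∞) : WithTop ℕ∞) (spaceTimeShear n) := by
  change ContDiff ℝ _ (fun p : ℝ × En n × En n => (p.1, p.2.1, p.2.2 - p.1 • p.2.1))
  fun_prop

lemma contDiff_spaceTimeShear_symm (n : ℕ) :
    ContDiff ℝ ((⊤ : ℕ∞) : WithTop ℕ∞) (spaceTimeShear n).symm := by
  change ContDiff ℝ _ (fun p : ℝ × En n × En n => (p.1, p.2.1, p.2.2 + p.1 • p.2.1))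
  fun_prop

lemma fderiv_comp_spaceTimeShear (n : ℕ) {φ : ℝ × En n × En n → ℝ} (hφ : Differentiable ℝ φ)
    (t : ℝ) (q : En n × En n) :
    fderiv ℝ (φ ∘ spaceTimeShear n) (t, q) ((1 : ℝ), (0 : En n × En n))
      = fderiv ℝ φ (t, shear n t q) ((1 : ℝ), ((0 : En n), -(shear n t q).1)) := by
  have hd : DifferentiableAt ℝ (φ ∘ spaceTimeShear n) (t, q) :=
    (hφ _).comp _ (((contDiff_spaceTimeShear n).differentiable (by simp)) _)
  rw [← hd.lineDeriv_eq_fderiv, ← (hφ _).lineDeriv_eq_fderiv]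
  unfold lineDeriv
  congr 1; ext r
  simp only [Function.comp, spaceTimeShear, shear_apply, Homeomorph.homeomorph_mk_coe,
    Equiv.coe_fn_mk]
  congr 1
  ext1
  · simp
  · ext1
    · simp
    · simp only [Prod.smul_mk, Prod.mk_add_mk, smul_eq_mul, mul_one, smul_zero, add_zero]
      module

/-- The equation `∂_t V = h` in the sense of distributions on `(0,T) × ℝ^{2n}`. -/
def IsWeakTimeDeriv (n : ℕ) (T : ℝ) (V h : ℝ → En n → En n → ℂ) : Prop :=
  ∀ ψ : ℝ × (En n × En n) → ℝ, ContDiff ℝ ((⊤ : ℕ∞) : WithTop ℕ∞) ψ → HasCompactSupport ψ →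
    (∀ p : ℝ × (En n × En n), p.1 ∉ Ioo 0 T → ψ p = 0) →
    -(∫ t in Ioo 0 T, ∫ q : En n × En n,
        V t q.1 q.2 * ((fderiv ℝ ψ (t, q) ((1 : ℝ), (0 : En n × En n)) : ℝ) : ℂ))
      = ∫ t in Ioo 0 T, ∫ q : En n × En n, h t q.1 q.2 * (ψ (t, q) : ℂ)

lemma integral_alongChar_mul_fderiv (n : ℕ) (T : ℝ) (U : ℝ → En n → En n → ℂ)
    {φ : ℝ × En n × En n → ℝ} (hφ : Differentiable ℝ φ) :
    ∫ t in Ioo 0 T, ∫ q : En n × En n, alongChar n U t q.1 q.2 *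
        ((fderiv ℝ (φ ∘ spaceTimeShear n) (t, q) ((1 : ℝ), (0 : En n × En n)) : ℝ) : ℂ)
      = ∫ t in Ioo 0 T, ∫ q : En n × En n, U t q.1 q.2 *
        ((fderiv ℝ φ (t, q) ((1 : ℝ), ((0 : En n), -q.1)) : ℝ) : ℂ) := by
  congr 1; ext t
  rw [← integral_shear n t (fun q => U t q.1 q.2 *
    ((fderiv ℝ φ (t, q) ((1 : ℝ), ((0 : En n), -q.1)) : ℝ) : ℂ))]
  congr 1; ext q
  rw [fderiv_comp_spaceTimeShear n hφ]
  rfl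

lemma integral_alongChar_mul (n : ℕ) (T : ℝ) (U : ℝ → En n → En n → ℂ)
    (φ : ℝ × En n × En n → ℝ) :
    ∫ t in Ioo 0 T, ∫ q : En n × En n, alongChar n U t q.1 q.2 *
        ((φ ∘ spaceTimeShear n) (t, q) : ℂ)
      = ∫ t in Ioo 0 T, ∫ q : En n × En n, U t q.1 q.2 * (φ (t, q) : ℂ) := by
  congr 1; ext t
  rw [← integral_shear n t (fun q => U t q.1 q.2 * (φ (t, q) : ℂ))]
  rfl

lemma isFTransportDeriv_iff (n : ℕ) (T : ℝ) (U H : ℝ → En n → En n → ℂ) :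
    IsFTransportDeriv n T U H ↔ IsWeakTimeDeriv n T (alongChar n U) (alongChar n H) := by
  constructor
  · intro h ψ hψ hψc hψ0
    have hs : ContDiff ℝ ((⊤ : ℕ∞) : WithTop ℕ∞) (ψ ∘ (spaceTimeShear n).symm) :=
      hψ.comp (contDiff_spaceTimeShear_symm n)
    have he : ψ = (ψ ∘ (spaceTimeShear n).symm) ∘ spaceTimeShear n := by
      ext p; simp
    have := h (ψ ∘ (spaceTimeShear n).symm) hs (hψc.comp_homeomorph _)
      (fun p hp => hψ0 _ hp)
    rw [he, integral_alongChar_mul_fderiv n T U (hs.differentiable (by simp)),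
      integral_alongChar_mul]
    exact this
  · intro h φ hφ hφc hφ0
    have := h (φ ∘ spaceTimeShear n) (hφ.comp (contDiff_spaceTimeShear n))
      (hφc.comp_homeomorph _) (fun p hp => hφ0 _ hp)
    rwa [integral_alongChar_mul_fderiv n T U (hφ.differentiable (by simp)),
      integral_alongChar_mul] at this

lemma measurable_primitive (n : ℕ) {h : ℝ → En n → En n → ℂ} (hh : MeasU n h) :
    Measurable (fun p : ℝ × En n × En n => ∫ σ in Ioo 0 p.1, h σ p.2.1 p.2.2) := by
  have e : (fun p : ℝ × En n × En n => ∫ σ in Ioo 0 p.1, h σ p.2.1 p.2.2) = fun p =>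
      ∫ σ, {x : (ℝ × En n × En n) × ℝ | x.2 ∈ Ioo 0 x.1.1}.indicator
        (fun x => h x.2 x.1.2.1 x.1.2.2) (p, σ) := by
    ext p
    rw [← integral_indicator measurableSet_Ioo]
    rfl
  rw [e]
  have hS : MeasurableSet {x : (ℝ × En n × En n) × ℝ | x.2 ∈ Ioo 0 x.1.1} :=
    (measurableSet_lt measurable_const measurable_snd).inter
      (measurableSet_lt measurable_snd (measurable_fst.comp measurable_fst))
  have hm : Measurable (fun x : (ℝ × En n × En n) × ℝ => h x.2 x.1.2.1 x.1.2.2) :=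
    hh.comp (measurable_snd.prodMk (measurable_snd.comp measurable_fst))
  exact ((hm.indicator hS).stronglyMeasurable.integral_prod_right').measurable

lemma exists_compact_fderiv_bound (n : ℕ) {ψ : ℝ × En n × En n → ℝ}
    (hψ : ContDiff ℝ ((⊤ : ℕ∞) : WithTop ℕ∞) ψ) (hψc : HasCompactSupport ψ) :
    ∃ K : Set (En n × En n), IsCompact K ∧ (∀ p : ℝ × En n × En n, p.2 ∉ K → ψ p = 0) ∧
      (∀ p : ℝ × En n × En n, p.2 ∉ K →
        fderiv ℝ ψ p ((1 : ℝ), (0 : En n × En n)) = 0) ∧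
      (∃ B : ℝ, ∀ p, |ψ p| ≤ B) ∧
      ∃ B : ℝ, ∀ p, |fderiv ℝ ψ p ((1 : ℝ), (0 : En n × En n))| ≤ B := by
  have hc : Continuous (fun p => fderiv ℝ ψ p ((1 : ℝ), (0 : En n × En n))) :=
    (hψ.continuous_fderiv (by simp)).clm_apply continuous_const
  have hcs : HasCompactSupport (fun p => fderiv ℝ ψ p ((1 : ℝ), (0 : En n × En n))) :=
    hψc.fderiv_apply ℝ _
  refine ⟨Prod.snd '' tsupport ψ, hψc.isCompact.image continuous_snd, fun p hp => ?_,
    fun p hp => ?_, ?_, ?_⟩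
  · exact image_eq_zero_of_notMem_tsupport fun h => hp ⟨p, h, rfl⟩
  · rw [show fderiv ℝ ψ p = 0 from
      image_eq_zero_of_notMem_tsupport (f := fderiv ℝ ψ)
        fun h => hp ⟨p, tsupport_fderiv_subset ℝ h, rfl⟩]
    rfl
  · simpa using hψc.exists_bound_of_continuous hψ.continuous
  · simpa using hcs.exists_bound_of_continuous hc

lemma isWeakTimeDeriv_of_mild (n : ℕ) {T α : ℝ} (hT : 0 ≤ T) (hα' : α < 1)
    {V h : ℝ → En n → En n → ℂ} (hV : MeasU n V) (hVfin : L2Hm1 n T α V < ⊤)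
    (hh : MeasU n h) (hhfin : L2Hm1 n T α h < ⊤) {G : En n → En n → ℂ}
    (hmild : ∀ᵐ q : En n × En n, ∀ t ∈ Ioo 0 T,
      V t q.1 q.2 = G q.1 q.2 + ∫ σ in Ioo 0 t, h σ q.1 q.2) :
    IsWeakTimeDeriv n T V h := by
  intro ψ hψ hψc hψ0
  obtain ⟨K, hK, hK1, hK2, ⟨B1, hB1⟩, ⟨B2, hB2⟩⟩ := exists_compact_fderiv_bound n hψ hψc
  have hc : Continuous (fun p => fderiv ℝ ψ p ((1 : ℝ), (0 : En n × En n))) :=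
    (hψ.continuous_fderiv (by simp)).clm_apply continuous_const
  have i1 := integrable_mul_of_L2Hm1 n hα' hV hVfin hc.measurable hB2 hK hK2
  have i2 := integrable_mul_of_L2Hm1 n hα' hh hhfin hψ.continuous.measurable hB1 hK hK1
  rw [integral_integral_swap (f := fun t (q : En n × En n) => V t q.1 q.2 *
      ((fderiv ℝ ψ (t, q) ((1 : ℝ), (0 : En n × En n)) : ℝ) : ℂ)) i1,
    integral_integral_swap (f := fun t (q : En n × En n) => h t q.1 q.2 * (ψ (t, q) : ℂ)) i2,
    ← integral_neg]
  apply integral_congr_ae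
  filter_upwards [hmild, ae_integrableOn_of_L2Hm1 n hα' hh hhfin] with q hq hi
  have hd : ∀ t, HasDerivAt (fun t => ψ (t, q))
      (fderiv ℝ ψ (t, q) ((1 : ℝ), (0 : En n × En n))) t := fun t =>
    ((hψ.differentiable (by simp)) (t, q)).hasFDerivAt.comp_hasDerivAt t
      ((hasDerivAt_id t).prodMk (hasDerivAt_const t q))
  have := integral_const_add_primitive_mul_deriv hT hi hd (hc.comp (by fun_prop))
    (hψ0 _ (by simp)) (hψ0 _ (by simp)) (G q.1 q.2)
  rw [← neg_eq_iff_eq_neg] at this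
  rw [← this]
  congr 1
  refine setIntegral_congr_fun measurableSet_Ioo fun t ht => ?_
  simp only [hq t ht]

lemma integrable_primitive_mul (n : ℕ) {T α : ℝ} (hα' : α < 1)
    {h : ℝ → En n → En n → ℂ} (hh : MeasU n h) (hhfin : L2Hm1 n T α h < ⊤)
    {Φ : En n × En n → ℝ} (hΦ : Measurable Φ) {B : ℝ} (hB : ∀ q, |Φ q| ≤ B)
    {K : Set (En n × En n)} (hK : IsCompact K) (hΦK : ∀ q, q ∉ K → Φ q = 0) :
    Integrable (fun p : ℝ × En n × En n => (∫ σ in Ioo 0 p.1, h σ p.2.1 p.2.2) * (Φ p.2 : ℂ))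
      ((volume.restrict (Ioo 0 T)).prod volume) := by
  have i1 := integrable_mul_of_L2Hm1 n hα' hh hhfin (hΦ.comp measurable_snd)
    (fun p => hB p.2) hK (fun p hp => hΦK p.2 hp)
  have i2 : Integrable (fun q : En n × En n =>
      ∫ σ in Ioo 0 T, ‖h σ q.1 q.2 * (Φ q : ℂ)‖) := i1.norm.integral_prod_right
  have i3 : Integrable (fun p : ℝ × En n × En n =>
      ∫ σ in Ioo 0 T, ‖h σ p.2.1 p.2.2 * (Φ p.2 : ℂ)‖)
      ((volume.restrict (Ioo 0 T)).prod volume) :=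
    i2.comp_snd (volume.restrict (Ioo 0 T))
  refine i3.mono' ((measurable_primitive n hh).mul
    (Complex.measurable_ofReal.comp (hΦ.comp measurable_snd))).aestronglyMeasurable ?_
  have hS : (volume.restrict (Ioo 0 T)).prod (volume : Measure (En n × En n)) =
      ((volume : Measure ℝ).prod volume).restrict (Ioo 0 T ×ˢ univ) := by
    rw [← Measure.prod_restrict, Measure.restrict_univ]
  have hae : ∀ᵐ p ∂((volume.restrict (Ioo 0 T)).prod (volume : Measure (En n × En n))),
      p.1 ∈ Ioo 0 T := by
    rw [hS]
    exact (ae_restrict_mem (measurableSet_Ioo.prod .univ)).mono fun p hp => hp.1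
  have hae2 : ∀ᵐ p ∂((volume.restrict (Ioo 0 T)).prod (volume : Measure (En n × En n))),
      IntegrableOn (fun t => h t p.2.1 p.2.2) (Ioo 0 T) :=
    Measure.quasiMeasurePreserving_snd.ae (ae_integrableOn_of_L2Hm1 n hα' hh hhfin)
  filter_upwards [hae, hae2] with p hp hi
  rw [← integral_mul_const]
  refine (norm_integral_le_integral_norm _).trans ?_
  refine setIntegral_mono_set (hi.mul_const _).norm (ae_of_all _ fun _ => norm_nonneg _) ?_
  exact (Ioo_subset_Ioo_right hp.2.le).eventuallyLE

lemma integral_integral_mul_eq (n : ℕ) {T α : ℝ} (hα' : α < 1)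
    {h : ℝ → En n → En n → ℂ} (hh : MeasU n h) (hhfin : L2Hm1 n T α h < ⊤)
    {Φ : En n × En n → ℝ} (hΦ : Measurable Φ) {B : ℝ} (hB : ∀ q, |Φ q| ≤ B)
    {K : Set (En n × En n)} (hK : IsCompact K) (hΦK : ∀ q, q ∉ K → Φ q = 0)
    {t : ℝ} (ht : t ≤ T) :
    ∫ σ in Ioo 0 t, ∫ q : En n × En n, h σ q.1 q.2 * (Φ q : ℂ)
      = ∫ q : En n × En n, (∫ σ in Ioo 0 t, h σ q.1 q.2) * (Φ q : ℂ) := by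
  have i1 := integrable_mul_of_L2Hm1 n hα' hh hhfin (hΦ.comp measurable_snd)
    (fun p => hB p.2) hK (fun p hp => hΦK p.2 hp)
  have i2 : Integrable (fun p : ℝ × En n × En n => h p.1 p.2.1 p.2.2 * (Φ p.2 : ℂ))
      ((volume.restrict (Ioo 0 t)).prod volume) :=
    i1.mono_measure (Measure.prod_mono
      (Measure.restrict_mono (Ioo_subset_Ioo_right ht) le_rfl) le_rfl)
  rw [integral_integral_swap (f := fun σ (q : En n × En n) => h σ q.1 q.2 * (Φ q : ℂ)) i2]
  simp_rw [integral_mul_const]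

lemma fderiv_tensor_apply (n : ℕ) {θ : ℝ → ℝ} {χ : En n × En n → ℝ}
    (hθ : Differentiable ℝ θ) (hχ : Differentiable ℝ χ) (t : ℝ) (q : En n × En n) :
    fderiv ℝ (fun p : ℝ × En n × En n => θ p.1 * χ p.2) (t, q) ((1 : ℝ), (0 : En n × En n))
      = deriv θ t * χ q := by
  have hd : DifferentiableAt ℝ (fun p : ℝ × En n × En n => θ p.1 * χ p.2) (t, q) := by fun_prop
  have h1 : HasDerivAt (fun r => θ r * χ q)
      (fderiv ℝ (fun p : ℝ × En n × En n => θ p.1 * χ p.2) (t, q)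
        ((1 : ℝ), (0 : En n × En n))) t :=
    HasFDerivAt.comp_hasDerivAt (f := fun r => (r, q)) t hd.hasFDerivAt
      ((hasDerivAt_id t).prodMk (hasDerivAt_const t q))
  exact h1.unique ((hθ t).hasDerivAt.mul_const _)

/-- A weak solution of `∂_t V = h` with initial trace `G` is given by integration in time. -/
lemma ae_mild_of_isWeakTimeDeriv (n : ℕ) {T α : ℝ} (hT : 0 < T) (hα' : α < 1)
    {V h : ℝ → En n → En n → ℂ} (hV : MeasU n V) (hVfin : L2Hm1 n T α V < ⊤)
    (hh : MeasU n h) (hhfin : L2Hm1 n T α h < ⊤) {G : En n → En n → ℂ}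
    (hG : LocallyIntegrable (fun q : En n × En n => G q.1 q.2))
    (hweak : IsWeakTimeDeriv n T V h)
    (htrace : ∀ χ : En n × En n → ℝ, Continuous χ → HasCompactSupport χ →
      Tendsto (fun t => ∫ q : En n × En n, V t q.1 q.2 * (χ q : ℂ)) (nhdsWithin 0 (Ioo 0 T))
        (nhds (∫ q : En n × En n, G q.1 q.2 * (χ q : ℂ)))) :
    ∀ᵐ q : En n × En n, ∀ᵐ t ∂(volume.restrict (Ioo 0 T)),
      V t q.1 q.2 = G q.1 q.2 + ∫ σ in Ioo 0 t, h σ q.1 q.2 := by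
  set D : ℝ × En n × En n → ℂ := fun p =>
    V p.1 p.2.1 p.2.2 - (G p.2.1 p.2.2 + ∫ σ in Ioo 0 p.1, h σ p.2.1 p.2.2) with hD
  have hGint : ∀ {Φ : En n × En n → ℝ}, Measurable Φ → ∀ {B : ℝ}, (∀ q, |Φ q| ≤ B) →
      ∀ {K : Set (En n × En n)}, IsCompact K → (∀ q, q ∉ K → Φ q = 0) →
      Integrable (fun q : En n × En n => G q.1 q.2 * (Φ q : ℂ)) := by
    intro Φ hΦ B hB K hK hΦK
    have : IntegrableOn (fun q : En n × En n => G q.1 q.2 * (Φ q : ℂ)) K :=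
      Integrable.mul_bdd (c := B) (hG.integrableOn_isCompact hK)
        (Complex.measurable_ofReal.comp hΦ).aestronglyMeasurable
        (ae_of_all _ fun q => by simpa using hB q)
    refine (integrableOn_iff_integrable_of_support_subset ?_).1 this
    intro q hq
    by_contra hqK
    exact hq (by simp [hΦK q hqK])
  have hDint : ∀ {Φ : En n × En n → ℝ}, Measurable Φ → ∀ {B : ℝ}, (∀ q, |Φ q| ≤ B) →
      ∀ {K : Set (En n × En n)}, IsCompact K → (∀ q, q ∉ K → Φ q = 0) →
      Integrable (fun p => D p * (Φ p.2 : ℂ)) ((volume.restrict (Ioo 0 T)).prod volume) := by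
    intro Φ hΦ B hB K hK hΦK
    have i1 := integrable_mul_of_L2Hm1 n hα' hV hVfin (hΦ.comp measurable_snd)
      (fun p => hB p.2) hK (fun p hp => hΦK p.2 hp)
    have i2 := (hGint hΦ hB hK hΦK).comp_snd (volume.restrict (Ioo 0 T))
    have i3 := integrable_primitive_mul n hα' hh hhfin hΦ hB hK hΦK
    refine (i1.sub (i2.add i3)).congr (ae_of_all _ fun p => ?_)
    simp only [hD, Pi.sub_apply, Pi.add_apply, Function.comp]
    ring
  have hzero : ∀ χ : En n × En n → ℝ, ContDiff ℝ ((⊤ : ℕ∞) : WithTop ℕ∞) χ →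
      HasCompactSupport χ → ∀ᵐ t ∂(volume.restrict (Ioo 0 T)),
      ∫ q, D (t, q) * (χ q : ℂ) = 0 := by
    intro χ hχ hχc
    obtain ⟨B, hB⟩ := hχc.exists_bound_of_continuous hχ.continuous
    have hm := hχ.continuous.measurable
    have hχK : ∀ q, q ∉ tsupport χ → χ q = 0 := fun q => image_eq_zero_of_notMem_tsupport
    have iV : Integrable (fun p : ℝ × En n × En n => V p.1 p.2.1 p.2.2 * (χ p.2 : ℂ))
        ((volume.restrict (Ioo 0 T)).prod volume) := integrable_mul_of_L2Hm1 n hα' hV hVfin (hm.comp measurable_snd)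
      (fun p => hB p.2) hχc.isCompact (fun p hp => hχK p.2 hp)
    have ih : Integrable (fun p : ℝ × En n × En n => h p.1 p.2.1 p.2.2 * (χ p.2 : ℂ))
        ((volume.restrict (Ioo 0 T)).prod volume) := integrable_mul_of_L2Hm1 n hα' hh hhfin (hm.comp measurable_snd)
      (fun p => hB p.2) hχc.isCompact (fun p hp => hχK p.2 hp)
    have iP := integrable_primitive_mul n hα' hh hhfin hm hB hχc.isCompact hχK
    have iG := hGint hm hB hχc.isCompact hχK
    have key := ae_eq_const_add_primitive_of_weak hT iV.integral_prod_left
      ih.integral_prod_left (htrace χ hχ.continuous hχc) (fun θ hθ hθ0 => by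
        have hw := hweak (fun p => θ p.1 * χ p.2)
          ((hθ.comp contDiff_fst).mul (hχ.comp contDiff_snd))
          (HasCompactSupport.intro ((isCompact_Icc (a := (0:ℝ)) (b := T)).prod hχc.isCompact)
            (fun p hp => by
              by_cases h1 : p.1 ∈ Icc 0 T
              · have h2 : p.2 ∉ tsupport χ := fun h2 => hp ⟨h1, h2⟩
                simp [hχK _ h2]
              · simp [hθ0 p.1 (fun h => h1 (Ioo_subset_Icc_self h))]))
          (fun p hp => by simp [hθ0 p.1 hp])
        simp_rw [fderiv_tensor_apply n (hθ.differentiable (by simp))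
          (hχ.differentiable (by simp))] at hw
        have e : ∀ (W : ℝ → En n → En n → ℂ) (θ' : ℝ → ℝ) (t : ℝ),
            (∫ q : En n × En n, W t q.1 q.2 * (χ q : ℂ)) * (θ' t : ℂ) =
              ∫ q : En n × En n, W t q.1 q.2 * ((θ' t * χ q : ℝ) : ℂ) := fun W θ' t => by
          rw [← integral_mul_const]
          congr 1; ext q; push_cast; ring
        simp only [e]
        exact hw)
    filter_upwards [key, iV.prod_right_ae, iP.prod_right_ae,
      ae_restrict_mem measurableSet_Ioo] with t ht i1 i2 htT
    rw [integral_integral_mul_eq n hα' hh hhfin hm hB hχc.isCompact hχK htT.2.le,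
      ← integral_add iG i2] at ht
    have : ∀ q, D (t, q) * (χ q : ℂ) = V t q.1 q.2 * (χ q : ℂ) - (G q.1 q.2 * (χ q : ℂ) +
        (∫ σ in Ioo 0 t, h σ q.1 q.2) * (χ q : ℂ)) := fun q => by simp only [hD]; ring
    simp_rw [this]
    have i3 : Integrable (fun q : En n × En n => G q.1 q.2 * (χ q : ℂ) +
        (∫ σ in Ioo 0 t, h σ q.1 q.2) * (χ q : ℂ)) := iG.add i2
    rw [integral_sub i1 i3, ht, sub_self]
  have hE : ∀ S : Set ℝ, ∀ᵐ q : En n × En n,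
      ∫ t, D (t, q) ∂((volume.restrict (Ioo 0 T)).restrict S) = 0 := by
    intro S
    have hDS : ∀ {Φ : En n × En n → ℝ}, Measurable Φ → ∀ {B : ℝ}, (∀ q, |Φ q| ≤ B) →
      ∀ {K : Set (En n × En n)}, IsCompact K → (∀ q, q ∉ K → Φ q = 0) →
      Integrable (fun p => D p * (Φ p.2 : ℂ))
        (((volume.restrict (Ioo 0 T)).restrict S).prod volume) := fun hΦ _ hB _ hK hΦK =>
      (hDint hΦ hB hK hΦK).mono_measure (Measure.prod_mono Measure.restrict_le_self le_rfl)
    apply ae_eq_zero_of_integral_contDiff_smul_eq_zero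
    · rw [locallyIntegrable_iff]
      intro K hK
      have := (hDS (Φ := K.indicator 1) (measurable_one.indicator hK.measurableSet) (B := 1)
        (fun q => by by_cases hq : q ∈ K <;> simp [hq]) hK
        (fun q hq => by simp [hq])).integral_prod_right
      rw [← integrable_indicator_iff hK.measurableSet]
      refine this.congr (ae_of_all _ fun q => ?_)
      by_cases hq : q ∈ K <;> simp [hq]
    · intro χ hχ hχc
      obtain ⟨B, hB⟩ := hχc.exists_bound_of_continuous hχ.continuous
      have hχK : ∀ q, q ∉ tsupport χ → χ q = 0 := fun q => image_eq_zero_of_notMem_tsupport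
      have i := hDS hχ.continuous.measurable hB hχc.isCompact hχK
      have e : ∀ q, χ q • ∫ t, D (t, q) ∂((volume.restrict (Ioo 0 T)).restrict S) =
          ∫ t, D (t, q) * (χ q : ℂ) ∂((volume.restrict (Ioo 0 T)).restrict S) := fun q => by
        rw [integral_mul_const, mul_comm]; simp
      simp_rw [e]
      rw [← integral_integral_swap (f := fun t q => D (t, q) * (χ q : ℂ)) i]
      rw [integral_congr_ae (g := fun _ => (0:ℂ)) (ae_restrict_of_ae (hzero χ hχ hχc))]
      simp
  have hE' : ∀ᵐ q : En n × En n, ∀ a b : ℚ,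
      ∫ t, D (t, q) ∂((volume.restrict (Ioo 0 T)).restrict (Ioo (a:ℝ) b)) = 0 :=
    ae_all_iff.2 fun a => ae_all_iff.2 fun b => hE _
  filter_upwards [hE', hE univ, ae_integrableOn_of_L2Hm1 n hα' hh hhfin,
    ae_integrableOn_of_L2Hm1 n hα' hV hVfin] with q hq hq1 hi hiV
  have iD : IntegrableOn (fun t => D (t, q)) (Ioo 0 T) := by
    have i1 : IntegrableOn (fun t => G q.1 q.2 + ∫ σ in Ioo 0 t, h σ q.1 q.2) (Ioo 0 T) :=
      ((continuousOn_const.add (continuousOn_primitive_Ioo hi)).integrableOn_compact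
        isCompact_Icc).mono_set Ioo_subset_Icc_self
    exact hiV.sub i1
  have := ae_eq_zero_of_forall_integral_Ioo_rat
    (f := (Ioo 0 T).indicator (fun t => D (t, q))) (iD.integrable_indicator measurableSet_Ioo)
    (fun a b => by
      rw [integral_indicator measurableSet_Ioo, Measure.restrict_restrict measurableSet_Ioo,
        inter_comm, ← Measure.restrict_restrict measurableSet_Ioo]
      exact hq a b)
    (by rw [integral_indicator measurableSet_Ioo]; simpa using hq1)
  rw [ae_restrict_iff' measurableSet_Ioo]
  filter_upwards [this] with t ht htT
  rw [indicator_of_mem htT] at ht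
  exact sub_eq_zero.1 ht

lemma Hm1_lt_top_of_Xnorm (n : ℕ) {β s : ℝ} (hβ : β ∈ Ioc (0:ℝ) 2) (hs : -1 ≤ 2 * s)
    {w : En n → En n → ℂ} (hw : Measurable (fun q : En n × En n => w q.1 q.2))
    (h : Xnorm n β s w < ⊤) : Hm1 n w < ⊤ := by
  rw [Xnorm_eq n hβ.1 s hw] at h
  rw [Hm1_eq n hw]
  refine lt_of_le_of_lt ?_ (ENNReal.mul_lt_top (a := 3) (by simp) h)
  rw [← lintegral_const_mul' _ _ (by simp)]
  refine lintegral_mono fun q => ?_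
  rw [← mul_assoc]
  gcongr
  rw [show (3:ℝ≥0∞) = ENNReal.ofReal 3 by simp, ← ENNReal.ofReal_mul (by norm_num)]
  exact ENNReal.ofReal_le_ofReal (hweight_le_omegaB_rpow n hβ hs _ _)

lemma exists_setLIntegral_enorm_le_Hm1 (n : ℕ) {K : Set (En n × En n)} (hK : IsCompact K) :
    ∃ C : ℝ≥0∞, C ≠ ⊤ ∧ ∀ w : En n → En n → ℂ,
      Measurable (fun q : En n × En n => w q.1 q.2) →
      ∫⁻ q in K, ‖w q.1 q.2‖ₑ ≤ (C * Hm1 n w) ^ (1 / 2 : ℝ) := by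
  have hmc := continuous_hweight n
  have hm := hmc.measurable
  have hpos : ∀ q : En n × En n, 0 < hweight n q.1 q.2 := fun q => hweight_pos n q.1 q.2
  refine ⟨∫⁻ q in K, ENNReal.ofReal ((hweight n q.1 q.2)⁻¹), ?_, fun w hw => ?_⟩
  · have : IntegrableOn (fun q : En n × En n => (hweight n q.1 q.2)⁻¹) K :=
      (hmc.inv₀ fun q => (hpos q).ne').continuousOn.integrableOn_compact hK
    exact this.lintegral_lt_top.ne
  · rw [Hm1_eq n hw, one_div, ENNReal.le_rpow_inv_iff (by norm_num), ENNReal.rpow_two]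
    have e : ∀ q : En n × En n, ‖w q.1 q.2‖ₑ = ENNReal.ofReal (√(hweight n q.1 q.2)⁻¹) *
        (ENNReal.ofReal (√(hweight n q.1 q.2)) * ‖w q.1 q.2‖ₑ) := fun q => by
      rw [← mul_assoc, ← ENNReal.ofReal_mul (Real.sqrt_nonneg _), Real.sqrt_inv,
        inv_mul_cancel₀ (Real.sqrt_pos.2 (hpos q)).ne', ENNReal.ofReal_one, one_mul]
    have hsq : ∀ x : ℝ, 0 ≤ x → ENNReal.ofReal (√x) ^ 2 = ENNReal.ofReal x := fun x hx => by
      rw [← ENNReal.ofReal_pow (Real.sqrt_nonneg _), Real.sq_sqrt hx]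
    calc (∫⁻ q in K, ‖w q.1 q.2‖ₑ) ^ 2
        = (∫⁻ q in K, ENNReal.ofReal (√(hweight n q.1 q.2)⁻¹) *
          (ENNReal.ofReal (√(hweight n q.1 q.2)) * ‖w q.1 q.2‖ₑ)) ^ 2 := by simp_rw [← e]
      _ ≤ (∫⁻ q in K, ENNReal.ofReal (√(hweight n q.1 q.2)⁻¹) ^ 2) *
          ∫⁻ q in K, (ENNReal.ofReal (√(hweight n q.1 q.2)) * ‖w q.1 q.2‖ₑ) ^ 2 :=
        sq_lintegral_mul_le (hm.inv.sqrt.ennreal_ofReal.aemeasurable)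
          ((hm.sqrt.ennreal_ofReal.mul hw.enorm).aemeasurable)
      _ ≤ _ := by
        simp_rw [mul_pow, hsq _ (inv_nonneg.2 (hpos _).le), hsq _ (hpos _).le]
        gcongr
        exact Measure.restrict_le_self

lemma locallyIntegrable_of_Hm1 (n : ℕ) {w : En n → En n → ℂ}
    (hw : Measurable (fun q : En n × En n => w q.1 q.2)) (h : Hm1 n w < ⊤) :
    LocallyIntegrable (fun q : En n × En n => w q.1 q.2) := by
  rw [locallyIntegrable_iff]
  intro K hK
  obtain ⟨C, hC, hle⟩ := exists_setLIntegral_enorm_le_Hm1 n hK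
  exact ⟨hw.aestronglyMeasurable, (hle w hw).trans_lt
    (ENNReal.rpow_lt_top_of_nonneg (by norm_num) (ENNReal.mul_lt_top hC.lt_top h).ne)⟩

lemma integrable_mul_of_locallyIntegrable {X : Type*} [TopologicalSpace X] [MeasurableSpace X]
    [OpensMeasurableSpace X] [T2Space X] {ν : Measure X} {f : X → ℂ} (hf : LocallyIntegrable f ν)
    {χ : X → ℝ} (hχ : Continuous χ) (hχc : HasCompactSupport χ) :
    Integrable (fun q => f q * (χ q : ℂ)) ν := by
  have := hf.integrable_smul_left_of_hasCompactSupport hχ hχc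
  refine this.congr (ae_of_all _ fun q => ?_)
  simp [mul_comm]

lemma tendsto_integral_alongChar_mul (n : ℕ) {T : ℝ} {U : ℝ → En n → En n → ℂ} (hU : MeasU n U)
    {G : En n → En n → ℂ} (hG : Measurable (fun q : En n × En n => G q.1 q.2))
    (hGfin : Hm1 n G < ⊤) (htr : HasTrace n T U G)
    (χ : En n × En n → ℝ) (hχ : Continuous χ) (hχc : HasCompactSupport χ) :
    Tendsto (fun t => ∫ q : En n × En n, alongChar n U t q.1 q.2 * (χ q : ℂ))
      (nhdsWithin 0 (Ioo 0 T)) (nhds (∫ q : En n × En n, G q.1 q.2 * (χ q : ℂ))) := by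
  set K : Set (En n × En n) :=
    (fun p : ℝ × En n × En n => shear n p.1 p.2) '' (Icc 0 T ×ˢ tsupport χ) with hKdef
  have hK : IsCompact K := (isCompact_Icc.prod hχc.isCompact).image (continuous_shear_uncurry n)
  obtain ⟨B, hB⟩ := hχc.exists_bound_of_continuous hχ
  have hB0 : 0 ≤ B := (norm_nonneg _).trans (hB 0)
  obtain ⟨C, hC, hle⟩ := exists_setLIntegral_enorm_le_Hm1 n hK
  have hχK : ∀ t ∈ Ioo 0 T, ∀ q, q ∉ K → χ ((shear n t).symm q) = 0 := by
    intro t ht q hq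
    refine image_eq_zero_of_notMem_tsupport fun h => hq ?_
    exact ⟨(t, (shear n t).symm q), ⟨Ioo_subset_Icc_self ht, h⟩, by simp⟩
  have hGloc := locallyIntegrable_of_Hm1 n hG hGfin
  have hχt : ∀ t, Continuous (fun q => χ ((shear n t).symm q)) := fun t =>
    hχ.comp (shear n t).symm.continuous
  have hχtc : ∀ t, HasCompactSupport (fun q => χ ((shear n t).symm q)) := fun t =>
    hχc.comp_homeomorph (shear n t).symm
  have hshear : ∀ t, ∫ q : En n × En n, alongChar n U t q.1 q.2 * (χ q : ℂ) =
      ∫ q : En n × En n, U t q.1 q.2 * (χ ((shear n t).symm q) : ℂ) := fun t => by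
    rw [← integral_shear n t (fun q => U t q.1 q.2 * (χ ((shear n t).symm q) : ℂ))]
    congr 1; ext q; simp [alongChar, shear_apply, shear_symm_apply]
  simp_rw [hshear]
  have hUt : ∀ t, Measurable (fun q : En n × En n => U t q.1 q.2 - G q.1 q.2) := fun t =>
    (hU.comp (measurable_const.prodMk measurable_id)).sub hG
  have hdiff : Tendsto (fun t => ∫ q : En n × En n, (U t q.1 q.2 - G q.1 q.2) *
      (χ ((shear n t).symm q) : ℂ)) (nhdsWithin 0 (Ioo 0 T)) (nhds 0) := by
    rw [tendsto_zero_iff_enorm_tendsto_zero]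
    have hlim : Tendsto (fun t => ENNReal.ofReal B *
        (C * Hm1 n (fun k ξ => U t k ξ - G k ξ)) ^ (1 / 2 : ℝ))
        (nhdsWithin 0 (Ioo 0 T)) (nhds 0) := by
      have h1 := ENNReal.Tendsto.const_mul (a := C) htr (Or.inr hC)
      have h2 := (ENNReal.continuous_rpow_const (y := (1 / 2 : ℝ))).tendsto _ |>.comp h1
      have h3 := ENNReal.Tendsto.const_mul (a := ENNReal.ofReal B) h2
        (Or.inr ENNReal.ofReal_ne_top)
      simpa using h3
    refine tendsto_of_tendsto_of_tendsto_of_le_of_le' tendsto_const_nhds hlim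
      (Eventually.of_forall fun _ => zero_le) ?_
    filter_upwards [self_mem_nhdsWithin] with t ht
    calc _ ≤ ∫⁻ q : En n × En n, ‖(U t q.1 q.2 - G q.1 q.2) * (χ ((shear n t).symm q) : ℂ)‖ₑ :=
          enorm_integral_le_lintegral_enorm _
      _ = ∫⁻ q in K, ‖(U t q.1 q.2 - G q.1 q.2) * (χ ((shear n t).symm q) : ℂ)‖ₑ := by
          rw [setLIntegral_eq_of_support_subset]
          intro q hq
          by_contra hqK
          exact hq (by simp [hχK t ht q hqK])
      _ ≤ ∫⁻ q in K, ENNReal.ofReal B * ‖U t q.1 q.2 - G q.1 q.2‖ₑ := by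
          refine lintegral_mono fun q => ?_
          rw [enorm_mul, mul_comm]
          gcongr
          rw [← ofReal_norm, Complex.norm_real]
          exact ENNReal.ofReal_le_ofReal (hB _)
      _ = ENNReal.ofReal B * ∫⁻ q in K, ‖U t q.1 q.2 - G q.1 q.2‖ₑ :=
          lintegral_const_mul' _ _ ENNReal.ofReal_ne_top
      _ ≤ _ := by gcongr; exact hle (fun k ξ => U t k ξ - G k ξ) (hUt t)
  have hGlim : Tendsto (fun t => ∫ q : En n × En n, G q.1 q.2 * (χ ((shear n t).symm q) : ℂ))
      (nhdsWithin 0 (Ioo 0 T)) (nhds (∫ q : En n × En n, G q.1 q.2 * (χ q : ℂ))) := by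
    refine tendsto_integral_filter_of_dominated_convergence
      (K.indicator fun q => ‖G q.1 q.2‖ * B) ?_ ?_ ?_ ?_
    · exact Eventually.of_forall fun t => (hG.mul
        (Complex.measurable_ofReal.comp (hχt t).measurable)).aestronglyMeasurable
    · filter_upwards [self_mem_nhdsWithin] with t ht
      refine ae_of_all _ fun q => ?_
      by_cases hq : q ∈ K
      · rw [indicator_of_mem hq, norm_mul, Complex.norm_real]
        exact mul_le_mul_of_nonneg_left (hB _) (norm_nonneg _)
      · simp [hχK t ht q hq, hq]
    · rw [integrable_indicator_iff hK.measurableSet]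
      exact (hGloc.integrableOn_isCompact hK).norm.mul_const B
    · refine ae_of_all _ fun q => ?_
      have : Continuous (fun t : ℝ => G q.1 q.2 * (χ (q.1, q.2 + t • q.1) : ℂ)) := by fun_prop
      have h0 := (this.tendsto 0).mono_left (nhdsWithin_le_nhds (s := Ioo 0 T))
      simpa [shear_symm_apply] using h0
  have hsum := hdiff.add hGlim
  rw [zero_add] at hsum
  refine hsum.congr' ?_
  filter_upwards [htr.eventually (gt_mem_nhds (show (0:ℝ≥0∞) < ⊤ by simp))] with t ht
  rw [← integral_add (integrable_mul_of_locallyIntegrable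
    (locallyIntegrable_of_Hm1 n (w := fun k ξ => U t k ξ - G k ξ) (hUt t) ht) (hχt t) (hχtc t))
    (integrable_mul_of_locallyIntegrable hGloc (hχt t) (hχtc t))]
  congr 1; ext q; ring

lemma ae_eq_zero_of_ae_eq_neg_primitive {T : ℝ} (hT : 0 < T) {a : ℝ → ℝ} (ha : Continuous a)
    {D : ℝ → ℂ} (hD : IntegrableOn D (Ioo 0 T))
    (h : ∀ᵐ t ∂(volume.restrict (Ioo 0 T)), D t = -∫ σ in Ioo 0 t, (a σ : ℂ) * D σ) :
    ∀ᵐ t ∂(volume.restrict (Ioo 0 T)), D t = 0 := by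
  obtain ⟨K, hK⟩ := (isCompact_Icc (a := (0:ℝ)) (b := T)).exists_bound_of_continuousOn
    ha.continuousOn
  have hac : Continuous (fun t => (a t : ℂ)) := Complex.continuous_ofReal.comp ha
  have haD : IntegrableOn (fun σ => (a σ : ℂ) * D σ) (Ioo 0 T) := by
    refine Integrable.bdd_mul (c := K) hD hac.aestronglyMeasurable ?_
    refine (ae_restrict_iff' measurableSet_Ioo).2 (ae_of_all _ fun t ht => ?_)
    simpa using hK t (Ioo_subset_Icc_self ht)
  set P : ℝ → ℂ := fun t => ∫ σ in Ioo 0 t, (a σ : ℂ) * D σ with hP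
  have hPc : ContinuousOn P (Icc 0 T) := continuousOn_primitive_Ioo haD
  set c : ℝ → ℝ := fun t => max 0 (min t T) with hcdef
  have hcmem : ∀ t, c t ∈ Icc 0 T := fun t =>
    ⟨le_max_left _ _, max_le hT.le (min_le_right _ _)⟩
  have hceq : ∀ t ∈ Icc 0 T, c t = t := fun t ht => by
    simp only [hcdef, min_eq_left ht.2, max_eq_right ht.1]
  have hPt : Continuous (fun t => P (c t)) := hPc.comp_continuous (by fun_prop) hcmem
  set g : ℝ → ℂ := fun t => -((a t : ℂ) * P (c t)) with hg
  have hgc : Continuous g := (hac.mul hPt).neg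
  set Q : ℝ → ℂ := fun t => ∫ σ in (0:ℝ)..t, g σ with hQ
  have hQd : ∀ t, HasDerivAt Q (g t) t := fun t =>
    intervalIntegral.integral_hasDerivAt_right (hgc.intervalIntegrable _ _)
      (hgc.stronglyMeasurableAtFilter _ _) hgc.continuousAt
  have hQP : ∀ t ∈ Icc 0 T, P t = Q t := by
    intro t ht
    simp only [hQ, hP]
    rw [intervalIntegral.integral_of_le ht.1, integral_Ioc_eq_integral_Ioo]
    apply integral_congr_ae
    have h' := ae_restrict_of_ae_restrict_of_subset (Ioo_subset_Ioo_right ht.2) h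
    filter_upwards [h', ae_restrict_mem measurableSet_Ioo] with σ hσ hmem
    simp only [hg]
    rw [hceq σ ⟨hmem.1.le, hmem.2.le.trans ht.2⟩, hσ]
    ring
  have hQ0 : ∀ t ∈ Icc 0 T, ‖Q t‖ ≤ gronwallBound 0 K 0 (t - 0) := by
    refine norm_le_gronwallBound_of_norm_deriv_right_le (f' := g)
      (fun t _ => (hQd t).continuousAt.continuousWithinAt)
      (fun t _ => (hQd t).hasDerivWithinAt) (by simp [hQ]) ?_
    intro t ht
    have htI := Ico_subset_Icc_self ht
    simp only [hg]
    rw [hceq t htI, hQP t htI, norm_neg, norm_mul, Complex.norm_real, add_zero]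
    exact mul_le_mul_of_nonneg_right (hK t htI) (norm_nonneg _)
  filter_upwards [h, ae_restrict_mem measurableSet_Ioo] with t ht hmem
  have h1 := hQ0 t (Ioo_subset_Icc_self hmem)
  rw [gronwallBound_ε0, zero_mul] at h1
  have h2 : P t = 0 := by
    rw [hQP t (Ioo_subset_Icc_self hmem)]; exact norm_le_zero_iff.1 h1
  rw [ht]
  simpa [hP] using h2

/-- Uniqueness for the integrated equation `V(t) = G + ∫₀ᵗ (f - a V)`. -/
lemma ae_eq_of_mild {T : ℝ} (hT : 0 < T) {a : ℝ → ℝ} (ha : Continuous a) {f V W : ℝ → ℂ} {c : ℂ}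
    (hV : IntegrableOn V (Ioo 0 T)) (hW : IntegrableOn W (Ioo 0 T))
    (hfV : IntegrableOn (fun σ => f σ - (a σ : ℂ) * V σ) (Ioo 0 T))
    (hfW : IntegrableOn (fun σ => f σ - (a σ : ℂ) * W σ) (Ioo 0 T))
    (h1 : ∀ᵐ t ∂(volume.restrict (Ioo 0 T)),
      V t = c + ∫ σ in Ioo 0 t, (f σ - (a σ : ℂ) * V σ))
    (h2 : ∀ᵐ t ∂(volume.restrict (Ioo 0 T)),
      W t = c + ∫ σ in Ioo 0 t, (f σ - (a σ : ℂ) * W σ)) :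
    ∀ᵐ t ∂(volume.restrict (Ioo 0 T)), V t = W t := by
  have := ae_eq_zero_of_ae_eq_neg_primitive hT ha (D := fun t => V t - W t) (hV.sub hW) (by
    filter_upwards [h1, h2, ae_restrict_mem measurableSet_Ioo] with t e1 e2 ht
    have hs : Ioo 0 t ⊆ Ioo 0 T := Ioo_subset_Ioo_right ht.2.le
    rw [e1, e2, add_sub_add_left_eq_sub, ← integral_sub (hfV.mono_set hs) (hfW.mono_set hs),
      ← integral_neg]
    congr 1; ext σ; ring)
  exact this.mono fun t ht => sub_eq_zero.1 ht

lemma ae_ae_ae_eq_of_alongChar (n : ℕ) {T : ℝ} {U W : ℝ → En n → En n → ℂ}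
    (hU : MeasU n U) (hW : MeasU n W)
    (h : ∀ᵐ q : En n × En n, ∀ᵐ t ∂(volume.restrict (Ioo 0 T)),
      alongChar n U t q.1 q.2 = alongChar n W t q.1 q.2) :
    ∀ᵐ t ∂(volume.restrict (Ioo 0 T)), ∀ᵐ (k : En n) ∂(volume : Measure (En n)),
      ∀ᵐ (ξ : En n) ∂(volume : Measure (En n)), U t k ξ = W t k ξ := by
  set f : ℝ × En n × En n → ℝ≥0∞ := fun p => ‖U p.1 p.2.1 p.2.2 - W p.1 p.2.1 p.2.2‖ₑ with hf
  have hfm : Measurable f := (hU.sub hW).enorm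
  have h0 : ∫⁻ t in Ioo 0 T, ∫⁻ q, f (t, q) = 0 := by
    rw [lintegral_lintegral_shear_swap n T hfm]
    rw [lintegral_congr_ae (g := fun _ => 0)]
    · simp
    filter_upwards [h] with q hq
    rw [lintegral_congr_ae (g := fun _ => 0)]
    · simp
    filter_upwards [hq] with t ht
    simp only [hf, enorm_eq_zero, sub_eq_zero]
    exact ht
  rw [lintegral_eq_zero_iff hfm.lintegral_prod_right'] at h0
  filter_upwards [h0] with t ht
  have hft : Measurable (fun q => f (t, q)) := hfm.comp (measurable_const.prodMk measurable_id)
  rw [Pi.zero_apply, lintegral_eq_zero_iff hft] at ht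
  have hq : ∀ᵐ q ∂((volume : Measure (En n)).prod (volume : Measure (En n))),
      U t q.1 q.2 = W t q.1 q.2 := by
    filter_upwards [ht] with q hq
    simpa [hf, sub_eq_zero] using hq
  exact Measure.ae_ae_of_ae_prod hq

/-- Variation of constants: the explicit formula solves `V(t) = c + ∫₀ᵗ (f - a V)`. -/
lemma mild_of_variation_of_constants {T : ℝ} {a : ℝ → ℝ} (ha : Continuous a) {f : ℝ → ℂ}
    (hf : IntegrableOn f (Ioo 0 T)) (c : ℂ) {φ : ℝ → ℝ} (hφ : ∀ t, φ t = ∫ r in (0:ℝ)..t, a r)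
    {V : ℝ → ℂ}
    (hV : ∀ t, V t = (Real.exp (-φ t) : ℂ) *
      (c + ∫ σ in Ioo 0 t, (Real.exp (φ σ) : ℂ) * f σ)) {t : ℝ} (ht : t ∈ Ioo 0 T) :
    V t = c + ∫ σ in Ioo 0 t, (f σ - (a σ : ℂ) * V σ) := by
  have hφd : ∀ t, HasDerivAt φ (a t) t := fun t => by
    rw [show φ = fun t => ∫ r in (0:ℝ)..t, a r from funext hφ]
    exact intervalIntegral.integral_hasDerivAt_right (ha.intervalIntegrable _ _)
      (ha.stronglyMeasurableAtFilter _ _) ha.continuousAt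
  have hφc : Continuous φ := continuous_iff_continuousAt.2 fun t => (hφd t).continuousAt
  set ψ : ℝ → ℝ := fun t => Real.exp (-φ t) with hψ
  set ψ' : ℝ → ℝ := fun t => Real.exp (-φ t) * (-a t) with hψ'
  have hψd : ∀ t, HasDerivAt ψ (ψ' t) t := fun t => (hφd t).neg.exp
  have hψ'c : Continuous ψ' := by fun_prop
  have hψc : Continuous (fun t => (ψ' t : ℂ)) := Complex.continuous_ofReal.comp hψ'c
  have hft : IntegrableOn f (Ioo 0 t) := hf.mono_set (Ioo_subset_Ioo_right ht.2.le)
  set h : ℝ → ℂ := fun σ => (Real.exp (φ σ) : ℂ) * f σ with hh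
  have hhi : IntegrableOn h (Ioo 0 t) := by
    have hc : Continuous (fun σ => Real.exp (φ σ)) := by fun_prop
    obtain ⟨K, hK⟩ := (isCompact_Icc (a := (0:ℝ)) (b := t)).exists_bound_of_continuousOn
      hc.continuousOn
    refine Integrable.bdd_mul (c := K) hft
      (Complex.continuous_ofReal.comp hc).aestronglyMeasurable ?_
    refine (ae_restrict_iff' measurableSet_Ioo).2 (ae_of_all _ fun σ hσ => ?_)
    rw [Complex.norm_real]
    exact hK σ (Ioo_subset_Icc_self hσ)
  have i1 : IntegrableOn (fun s => c * (ψ' s : ℂ)) (Ioo 0 t) :=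
    ((continuous_const.mul hψc).continuousOn.integrableOn_compact
      isCompact_Icc).mono_set Ioo_subset_Icc_self
  have i2 : IntegrableOn (fun s => (∫ σ in Ioo 0 s, h σ) * (ψ' s : ℂ)) (Ioo 0 t) :=
    (((continuousOn_primitive_Ioo hhi).mul hψc.continuousOn).integrableOn_compact
      isCompact_Icc).mono_set Ioo_subset_Icc_self
  have e1 : ∀ σ, f σ - (a σ : ℂ) * V σ =
      f σ + (c * (ψ' σ : ℂ) + (∫ r in Ioo 0 σ, h r) * (ψ' σ : ℂ)) := fun σ => by
    rw [hV]; simp only [hψ']; push_cast; ring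
  have e2 : ∫ σ in Ioo 0 t, h σ * ((ψ t - ψ σ : ℝ) : ℂ) =
      (ψ t : ℂ) * (∫ σ in Ioo 0 t, h σ) - ∫ σ in Ioo 0 t, f σ := by
    rw [← integral_const_mul, ← integral_sub (hhi.const_mul _) hft]
    congr 1; ext σ
    have : (ψ σ : ℂ) * (Real.exp (φ σ) : ℂ) = 1 := by
      rw [← Complex.ofReal_mul, ← Real.exp_add]; simp
    simp only [hh]
    rw [Complex.ofReal_sub]
    linear_combination -(f σ) * this
  have e3 : ∫ σ in Ioo 0 t, (ψ' σ : ℂ) = (ψ t : ℂ) - 1 := by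
    rw [← integral_Ioc_eq_integral_Ioo, ← intervalIntegral.integral_of_le ht.1.le,
      intervalIntegral.integral_ofReal, intervalIntegral.integral_eq_sub_of_hasDerivAt
        (fun t _ => hψd t) (hψ'c.intervalIntegrable _ _)]
    have : ψ 0 = 1 := by simp [hψ, hφ]
    rw [this]; push_cast; rfl
  simp_rw [e1]
  have i3 : IntegrableOn (fun s => c * (ψ' s : ℂ) + (∫ σ in Ioo 0 s, h σ) * (ψ' s : ℂ))
      (Ioo 0 t) := i1.add i2
  rw [integral_add hft i3, integral_add i1 i2,
    integral_primitive_mul_deriv hhi hψd hψ'c, e2, integral_const_mul, e3, hV]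
  ring

/-- The solution along characteristics. -/
def duhamelAlong (n : ℕ) (β : ℝ) (F : ℝ → En n → En n → ℂ) (G : En n → En n → ℂ) :
    ℝ → En n → En n → ℂ :=
  fun t k η => (Real.exp (-phase n β t k η) : ℂ) *
    (G k η + ∫ σ in Ioo 0 t, (Real.exp (phase n β σ k η) : ℂ) * alongChar n F σ k η)

/-- The solution of the Fourier-transformed fractional Kolmogorov equation. -/
def duhamel (n : ℕ) (β : ℝ) (F : ℝ → En n → En n → ℂ) (G : En n → En n → ℂ) :
    ℝ → En n → En n → ℂ :=
  fun t k ξ => duhamelAlong n β F G t k (ξ + t • k)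

lemma alongChar_duhamel (n : ℕ) (β : ℝ) (F : ℝ → En n → En n → ℂ) (G : En n → En n → ℂ) :
    alongChar n (duhamel n β F G) = duhamelAlong n β F G := by
  ext t k η; simp [alongChar, duhamel]

lemma measU_duhamelAlong (n : ℕ) {β : ℝ} (hβ : 0 < β) {F : ℝ → En n → En n → ℂ} (hF : MeasU n F)
    {G : En n → En n → ℂ} (hG : Measurable (fun q : En n × En n => G q.1 q.2)) :
    MeasU n (duhamelAlong n β F G) := by
  have hp := (continuous_phase n hβ).measurable
  have h1 : MeasU n (fun σ k η => (Real.exp (phase n β σ k η) : ℂ) * alongChar n F σ k η) :=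
    (Complex.measurable_ofReal.comp hp.exp).mul (measU_alongChar n hF)
  exact (Complex.measurable_ofReal.comp hp.neg.exp).mul
    ((hG.comp measurable_snd).add (measurable_primitive n h1))

lemma measU_duhamel (n : ℕ) {β : ℝ} (hβ : 0 < β) {F : ℝ → En n → En n → ℂ} (hF : MeasU n F)
    {G : En n → En n → ℂ} (hG : Measurable (fun q : En n × En n => G q.1 q.2)) :
    MeasU n (duhamel n β F G) := by
  have hc : Continuous (fun p : ℝ × En n × En n => (p.1, p.2.1, p.2.2 + p.1 • p.2.1)) := by
    fun_prop
  have h : Measurable (fun p : ℝ × En n × En n => duhamelAlong n β F G p.1 p.2.1 p.2.2) :=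
    measU_duhamelAlong n hβ hF hG
  change Measurable ((fun p : ℝ × En n × En n => duhamelAlong n β F G p.1 p.2.1 p.2.2) ∘
    (fun p : ℝ × En n × En n => (p.1, p.2.1, p.2.2 + p.1 • p.2.1)))
  exact h.comp hc.measurable

/-- The right-hand side `F - |ξ|^β U`. -/
def kolmogorovRHS (n : ℕ) (β : ℝ) (F U : ℝ → En n → En n → ℂ) : ℝ → En n → En n → ℂ :=
  fun t k ξ => F t k ξ - ((‖ξ‖ ^ β : ℝ) : ℂ) * U t k ξ

lemma measU_kolmogorovRHS (n : ℕ) {β : ℝ} {F U : ℝ → En n → En n → ℂ}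
    (hF : MeasU n F) (hU : MeasU n U) : MeasU n (kolmogorovRHS n β F U) := by
  have : Measurable (fun p : ℝ × En n × En n => ((‖p.2.2‖ ^ β : ℝ) : ℂ)) := by fun_prop
  exact hF.sub (this.mul hU)

lemma mild_duhamelAlong (n : ℕ) {T β : ℝ} (hβ : 0 < β) (F : ℝ → En n → En n → ℂ)
    (G : En n → En n → ℂ) {q : En n × En n}
    (hq : IntegrableOn (fun t => alongChar n F t q.1 q.2) (Ioo 0 T)) {t : ℝ} (ht : t ∈ Ioo 0 T) :
    duhamelAlong n β F G t q.1 q.2 = G q.1 q.2 +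
      ∫ σ in Ioo 0 t, alongChar n (kolmogorovRHS n β F (duhamel n β F G)) σ q.1 q.2 := by
  have hc : Continuous (fun r : ℝ => ‖q.2 - r • q.1‖ ^ β) :=
    continuous_norm_rpow n hβ q.1 q.2
  have := mild_of_variation_of_constants hc hq (G q.1 q.2)
    (φ := fun t => phase n β t q.1 q.2) (fun t => rfl)
    (V := fun t => duhamelAlong n β F G t q.1 q.2) (fun t => rfl) ht
  rw [this]
  congr 2; ext σ
  rw [← alongChar_duhamel]
  rfl

lemma ENNReal.add_sq_le_four_mul (a b : ℝ≥0∞) : (a + b) ^ 2 ≤ 4 * a ^ 2 + 4 * b ^ 2 := by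
  rcases le_total a b with h | h
  · calc (a + b) ^ 2 ≤ (b + b) ^ 2 := by gcongr
      _ = 4 * b ^ 2 := by ring
      _ ≤ _ := le_add_self
  · calc (a + b) ^ 2 ≤ (a + a) ^ 2 := by gcongr
      _ = 4 * a ^ 2 := by ring
      _ ≤ _ := le_self_add

lemma lintegral_lintegral_triangle_swap (T : ℝ) {g : ℝ × ℝ → ℝ≥0∞} (hg : Measurable g) :
    ∫⁻ t in Ioo 0 T, ∫⁻ σ in Ioo 0 t, g (t, σ)
      = ∫⁻ σ in Ioo 0 T, ∫⁻ t in Ioo σ T, g (t, σ) := by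
  have hS : MeasurableSet {p : ℝ × ℝ | p.2 < p.1} := measurableSet_lt measurable_snd measurable_fst
  calc ∫⁻ t in Ioo 0 T, ∫⁻ σ in Ioo 0 t, g (t, σ)
      = ∫⁻ t in Ioo 0 T, ∫⁻ σ in Ioo 0 T, {p : ℝ × ℝ | p.2 < p.1}.indicator g (t, σ) := by
        refine setLIntegral_congr_fun measurableSet_Ioo fun t ht => ?_
        have : (fun σ => {p : ℝ × ℝ | p.2 < p.1}.indicator g (t, σ)) =
            (Iio t).indicator (fun σ => g (t, σ)) := by
          ext σ; simp [indicator]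
        simp only [this]
        rw [lintegral_indicator measurableSet_Iio, Measure.restrict_restrict measurableSet_Iio,
          inter_comm, Ioo_inter_Iio, min_eq_right ht.2.le]
    _ = ∫⁻ σ in Ioo 0 T, ∫⁻ t in Ioo 0 T, {p : ℝ × ℝ | p.2 < p.1}.indicator g (t, σ) :=
        lintegral_lintegral_swap (hg.indicator hS).aemeasurable
    _ = _ := by
        refine setLIntegral_congr_fun measurableSet_Ioo fun σ hσ => ?_
        have : (fun t => {p : ℝ × ℝ | p.2 < p.1}.indicator g (t, σ)) =
            (Ioi σ).indicator (fun t => g (t, σ)) := by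
          ext t; simp [indicator]
        simp only [this]
        rw [lintegral_indicator measurableSet_Ioi, Measure.restrict_restrict measurableSet_Ioi,
          inter_comm, Ioo_inter_Ioi, max_eq_right hσ.1.le]

lemma exists_lintegral_duhamel_sq_le (n : ℕ) {β : ℝ} (hβ : β ∈ Ioc (0:ℝ) 2) (T p α : ℝ) (hT : 0 < T)
    (hp : 0 ≤ p) (hα : 0 ≤ α) (hα' : α < 1) :
    ∃ C : ℝ, 0 < C ∧ ∀ (k η : En n) (f : ℝ → ℝ≥0∞), Measurable f →
      ∫⁻ t in Ioo 0 T, ENNReal.ofReal (t ^ α) * (ENNReal.ofReal (omegaB n β k (η - t • k) ^ (p + 1))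
        * (∫⁻ σ in Ioo 0 t,
          ENNReal.ofReal (Real.exp (-(phase n β t k η - phase n β σ k η))) * f σ) ^ 2)
      ≤ ENNReal.ofReal C * ∫⁻ σ in Ioo 0 T, ENNReal.ofReal (σ ^ α) *
        (ENNReal.ofReal (omegaB n β k (η - σ • k) ^ (p - 1)) * f σ ^ 2) := by
  obtain ⟨C1, hC1, h1⟩ := exists_lintegral_backward_le n hβ T α hT hα hα'
  obtain ⟨C2, hC2, h2⟩ := exists_lintegral_forward_le n hβ T p hT hp
  refine ⟨C1 * C2, by positivity, fun k η f hf => ?_⟩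
  have hω : ∀ t : ℝ, 0 < omegaB n β k (η - t • k) := fun t => omegaB_pos _ _ _ _
  have hφm : Measurable (fun t => phase n β t k η) :=
    ((continuous_phase n hβ.1).comp (by fun_prop :
      Continuous fun t : ℝ => ((t, k, η) : ℝ × En n × En n))).measurable
  have hωm : Measurable (fun t : ℝ => omegaB n β k (η - t • k)) :=
    ((continuous_omegaB n hβ.1).comp (by fun_prop :
      Continuous fun t : ℝ => ((k, η - t • k) : En n × En n))).measurable
  set K : ℝ → ℝ → ℝ := fun t σ => Real.exp (-(phase n β t k η - phase n β σ k η)) with hK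
  have hKpos : ∀ t σ, 0 < K t σ := fun t σ => Real.exp_pos _
  have hKm : Measurable (fun x : ℝ × ℝ => K x.1 x.2) :=
    ((hφm.comp measurable_fst).sub (hφm.comp measurable_snd)).neg.exp
  have hKm' : ∀ t, Measurable (K t) := fun t => hKm.comp (measurable_const.prodMk measurable_id)
  have hpow : ∀ r : ℝ, Measurable (fun σ : ℝ => σ ^ r) := fun r => measurable_id.pow_const r
  have hsqr : ∀ x : ℝ, 0 ≤ x → ENNReal.ofReal (√x) ^ 2 = ENNReal.ofReal x := fun x hx => by
    rw [← ENNReal.ofReal_pow (Real.sqrt_nonneg _), Real.sq_sqrt hx]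
  have hcs : ∀ t : ℝ, (∫⁻ σ in Ioo 0 t, ENNReal.ofReal (K t σ) * f σ) ^ 2 ≤
      (∫⁻ σ in Ioo 0 t, ENNReal.ofReal (σ ^ (-α) * K t σ)) *
        ∫⁻ σ in Ioo 0 t, ENNReal.ofReal (K t σ) * (ENNReal.ofReal (σ ^ α) * f σ ^ 2) := fun t => by
    have e : ∫⁻ σ in Ioo 0 t, ENNReal.ofReal (K t σ) * f σ = ∫⁻ σ in Ioo 0 t,
        ENNReal.ofReal (√(σ ^ (-α) * K t σ)) * (ENNReal.ofReal (√(K t σ * σ ^ α)) * f σ) := by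
      refine setLIntegral_congr_fun measurableSet_Ioo fun σ hσ => ?_
      have h0 : 0 < σ ^ α := Real.rpow_pos_of_pos hσ.1 _
      rw [← mul_assoc, ← ENNReal.ofReal_mul (Real.sqrt_nonneg _), ← Real.sqrt_mul
        (mul_nonneg (Real.rpow_nonneg hσ.1.le _) (hKpos t σ).le), Real.rpow_neg hσ.1.le]
      congr 2
      rw [show (σ ^ α)⁻¹ * K t σ * (K t σ * σ ^ α) = K t σ ^ 2 by field_simp,
        Real.sqrt_sq (hKpos t σ).le]
    rw [e]
    refine (sq_lintegral_mul_le ?_ ?_).trans (le_of_eq ?_)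
    · exact (((hpow _).mul (hKm' t)).sqrt.ennreal_ofReal).aemeasurable
    · exact ((((hKm' t).mul (hpow _)).sqrt.ennreal_ofReal).mul hf).aemeasurable
    · congr 1
      · refine setLIntegral_congr_fun measurableSet_Ioo fun σ hσ => ?_
        exact hsqr _ (mul_nonneg (Real.rpow_nonneg hσ.1.le _) (hKpos t σ).le)
      · refine setLIntegral_congr_fun measurableSet_Ioo fun σ hσ => ?_
        rw [mul_pow, hsqr _ (mul_nonneg (hKpos t σ).le (Real.rpow_nonneg hσ.1.le _)),
          ENNReal.ofReal_mul (hKpos t σ).le, mul_assoc]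
  have hgm : Measurable (fun x : ℝ × ℝ => ENNReal.ofReal (omegaB n β k (η - x.1 • k) ^ p) *
      (ENNReal.ofReal (K x.1 x.2) * (ENNReal.ofReal (x.2 ^ α) * f x.2 ^ 2))) :=
    (((hωm.comp measurable_fst).pow_const p).ennreal_ofReal).mul (hKm.ennreal_ofReal.mul
      ((((hpow α).comp measurable_snd).ennreal_ofReal).mul ((hf.comp measurable_snd).pow_const 2)))
  calc _ ≤ ∫⁻ t in Ioo 0 T, ENNReal.ofReal C1 * ∫⁻ σ in Ioo 0 t,
          ENNReal.ofReal (omegaB n β k (η - t • k) ^ p) *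
          (ENNReal.ofReal (K t σ) * (ENNReal.ofReal (σ ^ α) * f σ ^ 2)) := by
        refine setLIntegral_mono' measurableSet_Ioo fun t ht => ?_
        rw [lintegral_const_mul' _ _ ENNReal.ofReal_ne_top]
        have hb := h1 k η t ht.1 ht.2.le
        have hb' : ENNReal.ofReal (omegaB n β k (η - t • k) * t ^ α) *
            (∫⁻ σ in Ioo 0 t, ENNReal.ofReal (σ ^ (-α) * K t σ)) ≤ ENNReal.ofReal C1 := by
          rw [← lintegral_const_mul' _ _ ENNReal.ofReal_ne_top]
          refine le_trans (le_of_eq ?_) hb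
          congr 1; ext σ
          rw [← ENNReal.ofReal_mul (mul_nonneg (hω t).le (Real.rpow_nonneg ht.1.le _))]
        have e1 : ENNReal.ofReal (t ^ α) * ENNReal.ofReal (omegaB n β k (η - t • k) ^ (p + 1)) =
            ENNReal.ofReal (omegaB n β k (η - t • k) * t ^ α) *
              ENNReal.ofReal (omegaB n β k (η - t • k) ^ p) := by
          rw [← ENNReal.ofReal_mul (Real.rpow_nonneg ht.1.le _),
            ← ENNReal.ofReal_mul (mul_nonneg (hω t).le (Real.rpow_nonneg ht.1.le _)),
            Real.rpow_add_one (hω t).ne']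
          congr 1; ring
        rw [← mul_assoc, e1]
        calc _ ≤ ENNReal.ofReal (omegaB n β k (η - t • k) * t ^ α) *
              ENNReal.ofReal (omegaB n β k (η - t • k) ^ p) *
              ((∫⁻ σ in Ioo 0 t, ENNReal.ofReal (σ ^ (-α) * K t σ)) *
              ∫⁻ σ in Ioo 0 t, ENNReal.ofReal (K t σ) * (ENNReal.ofReal (σ ^ α) * f σ ^ 2)) := by
              gcongr; exact hcs t
          _ = (ENNReal.ofReal (omegaB n β k (η - t • k) * t ^ α) *
              (∫⁻ σ in Ioo 0 t, ENNReal.ofReal (σ ^ (-α) * K t σ))) *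
              (ENNReal.ofReal (omegaB n β k (η - t • k) ^ p) *
              ∫⁻ σ in Ioo 0 t, ENNReal.ofReal (K t σ) * (ENNReal.ofReal (σ ^ α) * f σ ^ 2)) := by
              ring
          _ ≤ _ := by gcongr
    _ = ENNReal.ofReal C1 * ∫⁻ σ in Ioo 0 T, ∫⁻ t in Ioo σ T,
          ENNReal.ofReal (omegaB n β k (η - t • k) ^ p) *
          (ENNReal.ofReal (K t σ) * (ENNReal.ofReal (σ ^ α) * f σ ^ 2)) := by
        rw [lintegral_const_mul' _ _ ENNReal.ofReal_ne_top,
          lintegral_lintegral_triangle_swap T (g := fun x : ℝ × ℝ =>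
            ENNReal.ofReal (omegaB n β k (η - x.1 • k) ^ p) *
            (ENNReal.ofReal (K x.1 x.2) * (ENNReal.ofReal (x.2 ^ α) * f x.2 ^ 2))) hgm]
    _ ≤ ENNReal.ofReal C1 * ∫⁻ σ in Ioo 0 T, ENNReal.ofReal C2 * (ENNReal.ofReal (σ ^ α) *
        (ENNReal.ofReal (omegaB n β k (η - σ • k) ^ (p - 1)) * f σ ^ 2)) := by
        refine mul_le_mul_right ?_ _
        refine setLIntegral_mono' measurableSet_Ioo fun σ hσ => ?_
        have hb := h2 k η σ hσ.1.le
        calc _ = (∫⁻ t in Ioo σ T, ENNReal.ofReal (omegaB n β k (η - t • k) ^ p * K t σ)) *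
              (ENNReal.ofReal (σ ^ α) * f σ ^ 2) := by
              rw [← lintegral_mul_const]
              · congr 1; ext t
                rw [ENNReal.ofReal_mul (Real.rpow_nonneg (hω t).le _)]
                ring
              · exact ((hωm.pow_const p).mul
                  (hKm.comp (measurable_id.prodMk measurable_const))).ennreal_ofReal
          _ ≤ ENNReal.ofReal (C2 * omegaB n β k (η - σ • k) ^ (p - 1)) *
              (ENNReal.ofReal (σ ^ α) * f σ ^ 2) := by gcongr
          _ = _ := by rw [ENNReal.ofReal_mul hC2.le]; ring
    _ = _ := by
        rw [lintegral_const_mul' _ _ ENNReal.ofReal_ne_top, ENNReal.ofReal_mul hC1.le, mul_assoc]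

lemma enorm_duhamelAlong_le (n : ℕ) (β : ℝ) (F : ℝ → En n → En n → ℂ) (G : En n → En n → ℂ)
    (t : ℝ) (k η : En n) :
    ‖duhamelAlong n β F G t k η‖ₑ ≤
      ENNReal.ofReal (Real.exp (-phase n β t k η)) * ‖G k η‖ₑ +
      ∫⁻ σ in Ioo 0 t, ENNReal.ofReal (Real.exp (-(phase n β t k η - phase n β σ k η))) *
        ‖alongChar n F σ k η‖ₑ := by
  have he : ∀ x : ℝ, ‖(Real.exp x : ℂ)‖ₑ = ENNReal.ofReal (Real.exp x) := fun x => by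
    rw [← ofReal_norm, Complex.norm_real, Real.norm_of_nonneg (Real.exp_pos x).le]
  unfold duhamelAlong
  rw [enorm_mul, he]
  calc _ ≤ ENNReal.ofReal (Real.exp (-phase n β t k η)) * (‖G k η‖ₑ + ∫⁻ σ in Ioo 0 t,
        ‖(Real.exp (phase n β σ k η) : ℂ) * alongChar n F σ k η‖ₑ) := by
        gcongr
        exact (enorm_add_le _ _).trans (by gcongr; exact enorm_integral_le_lintegral_enorm _)
    _ = _ := by
        rw [mul_add, ← lintegral_const_mul' _ _ ENNReal.ofReal_ne_top]
        congr 2; ext σ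
        rw [enorm_mul, he, ← mul_assoc, ← ENNReal.ofReal_mul (Real.exp_pos _).le, ← Real.exp_add]
        congr 3; ring

lemma measurable_omegaB_shear (n : ℕ) {β : ℝ} (hβ : 0 < β) (k η : En n) :
    Measurable (fun t : ℝ => omegaB n β k (η - t • k)) :=
  ((continuous_omegaB n hβ).comp (by fun_prop :
    Continuous fun t : ℝ => ((k, η - t • k) : En n × En n))).measurable

lemma continuous_phase_time (n : ℕ) {β : ℝ} (hβ : 0 < β) (k η : En n) :
    Continuous (fun t : ℝ => phase n β t k η) := by
  have hc : Continuous fun t : ℝ => ((t, k, η) : ℝ × En n × En n) := by fun_prop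
  simpa only [Function.comp_def] using (continuous_phase n hβ).comp hc

lemma continuous_phase_space (n : ℕ) {β : ℝ} (hβ : 0 < β) (t : ℝ) :
    Continuous (fun q : En n × En n => phase n β t q.1 q.2) := by
  have hc : Continuous fun q : En n × En n => ((t, q.1, q.2) : ℝ × En n × En n) := by fun_prop
  simpa only [Function.comp_def] using (continuous_phase n hβ).comp hc

lemma measurable_time_section (n : ℕ) {U : ℝ → En n → En n → ℂ} (hU : MeasU n U) (k η : En n) :
    Measurable (fun t => U t k η) := by
  have hm : Measurable (fun t : ℝ => ((t, k, η) : ℝ × En n × En n)) := by fun_prop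
  exact Measurable.comp (g := fun p : ℝ × En n × En n => U p.1 p.2.1 p.2.2) hU hm

lemma measurable_space_section (n : ℕ) {U : ℝ → En n → En n → ℂ} (hU : MeasU n U) (t : ℝ) :
    Measurable (fun q : En n × En n => U t q.1 q.2) :=
  Measurable.comp (g := fun p : ℝ × En n × En n => U p.1 p.2.1 p.2.2) hU
    (measurable_const.prodMk measurable_id)

lemma measurable_L2X_integrand (n : ℕ) {β : ℝ} (hβ : 0 < β) (α p : ℝ)
    {U : ℝ → En n → En n → ℂ} (hU : MeasU n U) :
    Measurable (fun x : ℝ × En n × En n => ENNReal.ofReal (x.1 ^ α) *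
      (ENNReal.ofReal (omegaB n β x.2.1 x.2.2 ^ p) * ‖U x.1 x.2.1 x.2.2‖ₑ ^ 2)) :=
  (measurable_fst.pow_const α).ennreal_ofReal.mul
    ((((continuous_omegaB n hβ).measurable.comp measurable_snd).pow_const p).ennreal_ofReal.mul
      (hU.enorm.pow_const 2))

lemma L2X_eq_alongChar (n : ℕ) {β : ℝ} (hβ : 0 < β) (s T μ : ℝ) {U : ℝ → En n → En n → ℂ}
    (hU : MeasU n U) :
    L2X n β s T μ U = ∫⁻ q : En n × En n, ∫⁻ t in Ioo 0 T, ENNReal.ofReal (t ^ (2 - 2 * μ)) *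
      (ENNReal.ofReal (omegaB n β q.1 (q.2 - t • q.1) ^ (2 * s)) *
        ‖alongChar n U t q.1 q.2‖ₑ ^ 2) := by
  rw [L2X_eq n hβ s T μ hU]
  exact lintegral_lintegral_shear_swap n T (measurable_L2X_integrand n hβ (2 - 2 * μ) (2 * s) hU)

lemma L2X_duhamel_lt_top (n : ℕ) {T μ β s : ℝ} (hT : 0 < T) (hμ : μ ∈ Ioc (1 / 2 : ℝ) 1)
    (hβ : β ∈ Ioc (0:ℝ) 2) (hs : -(1 / 2 : ℝ) ≤ s)
    {F : ℝ → En n → En n → ℂ} (hF : MeasU n F) (hFfin : L2X n β s T μ F < ⊤)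
    {G : En n → En n → ℂ} (hG : Measurable (fun p : En n × En n => G p.1 p.2))
    (hGfin : Xnorm n β (s + 1 / 2 - (1 - μ)) G < ⊤) :
    L2X n β (s + 1) T μ (duhamel n β F G) < ⊤ := by
  obtain ⟨hμ1, hμ2⟩ := hμ
  obtain ⟨C1, hC1, h1⟩ := exists_lintegral_free_le n hβ T (2 * (s + 1)) (2 - 2 * μ) hT
    (by linarith) (by linarith) (by linarith)
  obtain ⟨C2, hC2, h2⟩ := exists_lintegral_duhamel_sq_le n hβ T (2 * s + 1) (2 - 2 * μ) hT
    (by linarith) (by linarith) (by linarith)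
  rw [Xnorm_eq n hβ.1 _ hG] at hGfin
  rw [L2X_eq_alongChar n hβ.1 s T μ hF] at hFfin
  rw [L2X_eq_alongChar n hβ.1 (s + 1) T μ (measU_duhamel n hβ.1 hF hG), alongChar_duhamel]
  set α := 2 - 2 * μ with hα
  have hFa := measU_alongChar n hF
  have key : ∀ q : En n × En n, ∫⁻ t in Ioo 0 T, ENNReal.ofReal (t ^ α) *
      (ENNReal.ofReal (omegaB n β q.1 (q.2 - t • q.1) ^ (2 * (s + 1))) *
        ‖duhamelAlong n β F G t q.1 q.2‖ₑ ^ 2) ≤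
      4 * ENNReal.ofReal C1 * (ENNReal.ofReal (omegaB n β q.1 q.2 ^
        (2 * (s + 1 / 2 - (1 - μ)))) * ‖G q.1 q.2‖ₑ ^ 2) +
      4 * ENNReal.ofReal C2 * ∫⁻ t in Ioo 0 T, ENNReal.ofReal (t ^ α) *
      (ENNReal.ofReal (omegaB n β q.1 (q.2 - t • q.1) ^ (2 * s)) *
        ‖alongChar n F t q.1 q.2‖ₑ ^ 2) := fun q => by
    have hωm := measurable_omegaB_shear n hβ.1 q.1 q.2
    have hφm := (continuous_phase_time n hβ.1 q.1 q.2).measurable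
    have hpow : Measurable (fun t : ℝ => t ^ α) := measurable_id.pow_const α
    have b1 := h1 q.1 q.2
    have b2 := h2 q.1 q.2 (fun t => ‖alongChar n F t q.1 q.2‖ₑ)
      (measurable_time_section n hFa q.1 q.2).enorm
    calc _ ≤ ∫⁻ t in Ioo 0 T, ((4 * ‖G q.1 q.2‖ₑ ^ 2) * ENNReal.ofReal
          (t ^ α * (omegaB n β q.1 (q.2 - t • q.1) ^ (2 * (s + 1)) *
            Real.exp (-phase n β t q.1 q.2) ^ 2)) +
          4 * (ENNReal.ofReal (t ^ α) *
          (ENNReal.ofReal (omegaB n β q.1 (q.2 - t • q.1) ^ (2 * s + 1 + 1)) *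
            (∫⁻ σ in Ioo 0 t, ENNReal.ofReal (Real.exp
              (-(phase n β t q.1 q.2 - phase n β σ q.1 q.2))) *
                ‖alongChar n F σ q.1 q.2‖ₑ) ^ 2))) := by
          refine setLIntegral_mono' measurableSet_Ioo fun t ht => ?_
          have hb := (pow_le_pow_left' (enorm_duhamelAlong_le n β F G t q.1 q.2) 2).trans
            (ENNReal.add_sq_le_four_mul _ _)
          have hw : 0 ≤ omegaB n β q.1 (q.2 - t • q.1) ^ (2 * (s + 1)) :=
            Real.rpow_nonneg (omegaB_pos _ _ _ _).le _
          rw [show 2 * s + 1 + 1 = 2 * (s + 1) by ring,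
            ENNReal.ofReal_mul (Real.rpow_nonneg ht.1.le _), ENNReal.ofReal_mul hw,
            ENNReal.ofReal_pow (Real.exp_pos _).le]
          refine (mul_le_mul_right (mul_le_mul_right hb _) _).trans (le_of_eq ?_)
          ring
      _ ≤ _ := by
          rw [lintegral_add_left, lintegral_const_mul, lintegral_const_mul' _ _ (by simp)]
          · refine add_le_add ((mul_le_mul_right b1 _).trans (le_of_eq ?_))
              ((mul_le_mul_right b2 _).trans (le_of_eq ?_))
            · rw [ENNReal.ofReal_mul hC1.le, show 2 * (s + 1) - α - 1 =
                2 * (s + 1 / 2 - (1 - μ)) by rw [hα]; ring]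
              ring
            · rw [show 2 * s + 1 - 1 = 2 * s by ring, mul_assoc]
          · exact (hpow.mul ((hωm.pow_const _).mul (hφm.neg.exp.pow_const 2))).ennreal_ofReal
          · exact ((hpow.mul ((hωm.pow_const _).mul
              (hφm.neg.exp.pow_const 2))).ennreal_ofReal).const_mul _
  refine (lintegral_mono key).trans_lt ?_
  have hωm := (continuous_omegaB n hβ.1).measurable
  rw [lintegral_add_left, lintegral_const_mul' _ _ (by finiteness),
    lintegral_const_mul' _ _ (by finiteness)]
  · exact ENNReal.add_lt_top.2 ⟨ENNReal.mul_lt_top (by finiteness) hGfin,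
      ENNReal.mul_lt_top (by finiteness) hFfin⟩
  · exact (((hωm.pow_const _).ennreal_ofReal).mul (hG.enorm.pow_const 2)).const_mul _

lemma L2X_lt_top_of_succ (n : ℕ) {T μ β s : ℝ} (hβ : 0 < β) {U : ℝ → En n → En n → ℂ}
    (hU : MeasU n U) (h : L2X n β (s + 1) T μ U < ⊤) : L2X n β s T μ U < ⊤ := by
  rw [L2X_eq n hβ _ T μ hU] at h ⊢
  refine lt_of_le_of_lt ?_ h
  gcongr with t q
  · exact one_le_omegaB _ _ _ _
  · linarith

lemma L2X_kolmogorovRHS_lt_top (n : ℕ) {T μ β s : ℝ} (hβ : 0 < β) {F U : ℝ → En n → En n → ℂ}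
    (hF : MeasU n F) (hU : MeasU n U) (hFfin : L2X n β s T μ F < ⊤)
    (h : L2X n β (s + 1) T μ U < ⊤) : L2X n β s T μ (kolmogorovRHS n β F U) < ⊤ := by
  rw [L2X_eq n hβ _ T μ hU] at h
  rw [L2X_eq n hβ _ T μ hF] at hFfin
  rw [L2X_eq n hβ _ T μ (measU_kolmogorovRHS n hF hU)]
  set α := 2 - 2 * μ
  have hm := measurable_L2X_integrand n hβ α (2 * s) hF
  calc _ ≤ ∫⁻ t in Ioo 0 T, ∫⁻ q : En n × En n, (4 * (ENNReal.ofReal (t ^ α) *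
          (ENNReal.ofReal (omegaB n β q.1 q.2 ^ (2 * s)) * ‖F t q.1 q.2‖ₑ ^ 2)) +
        4 * (ENNReal.ofReal (t ^ α) *
          (ENNReal.ofReal (omegaB n β q.1 q.2 ^ (2 * (s + 1))) * ‖U t q.1 q.2‖ₑ ^ 2))) := by
        refine lintegral_mono fun t => lintegral_mono fun q => ?_
        have hω := omegaB_pos n β q.1 q.2
        have hle : ‖q.2‖ ^ β ≤ omegaB n β q.1 q.2 := by
          unfold omegaB
          have := Real.rpow_nonneg (norm_nonneg q.1) (β / (β + 1))
          linarith
        have hb : ‖kolmogorovRHS n β F U t q.1 q.2‖ₑ ≤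
            ‖F t q.1 q.2‖ₑ + ENNReal.ofReal (omegaB n β q.1 q.2) * ‖U t q.1 q.2‖ₑ := by
          unfold kolmogorovRHS
          refine (enorm_sub_le).trans (add_le_add le_rfl ?_)
          rw [enorm_mul]
          gcongr
          rw [← ofReal_norm, Complex.norm_real,
            Real.norm_of_nonneg (Real.rpow_nonneg (norm_nonneg _) _)]
          exact ENNReal.ofReal_le_ofReal hle
        have hb2 := (pow_le_pow_left' hb 2).trans (ENNReal.add_sq_le_four_mul _ _)
        have e : ENNReal.ofReal (omegaB n β q.1 q.2 ^ (2 * (s + 1))) =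
            ENNReal.ofReal (omegaB n β q.1 q.2 ^ (2 * s)) *
              ENNReal.ofReal (omegaB n β q.1 q.2) ^ 2 := by
          rw [← ENNReal.ofReal_pow hω.le, ← ENNReal.ofReal_mul (Real.rpow_nonneg hω.le _),
            ← Real.rpow_natCast _ 2, ← Real.rpow_add hω]
          congr 2; push_cast; ring
        rw [e]
        refine (mul_le_mul_right (mul_le_mul_right hb2 _) _).trans (le_of_eq ?_)
        ring
    _ = ∫⁻ t in Ioo 0 T, (4 * (∫⁻ q : En n × En n, ENNReal.ofReal (t ^ α) *
          (ENNReal.ofReal (omegaB n β q.1 q.2 ^ (2 * s)) * ‖F t q.1 q.2‖ₑ ^ 2)) +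
        4 * ∫⁻ q : En n × En n, ENNReal.ofReal (t ^ α) *
          (ENNReal.ofReal (omegaB n β q.1 q.2 ^ (2 * (s + 1))) * ‖U t q.1 q.2‖ₑ ^ 2)) := by
        congr 1; ext t
        rw [lintegral_add_left, lintegral_const_mul' (4 : ℝ≥0∞) _ (by simp),
          lintegral_const_mul' (4 : ℝ≥0∞) _ (by simp)]
        exact (hm.comp (measurable_const.prodMk measurable_id)).const_mul 4
    _ < ⊤ := by
        rw [lintegral_add_left, lintegral_const_mul' _ _ (by simp),
          lintegral_const_mul' _ _ (by simp)]
        · exact ENNReal.add_lt_top.2 ⟨ENNReal.mul_lt_top (by simp) hFfin,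
            ENNReal.mul_lt_top (by simp) h⟩
        · exact (hm.lintegral_prod_right').const_mul 4

lemma tendsto_lintegral_sub_comp_shear (n : ℕ) {g : En n × En n → ℂ} (hg : MemLp g 2 volume) :
    Tendsto (fun t : ℝ => ∫⁻ q, ‖g q - g (shear n t q)‖ₑ ^ 2) (nhds 0) (nhds 0) := by
  let S : ℝ → C(En n × En n, En n × En n) := fun t => ⟨shear n t, (shear n t).continuous⟩
  have hS : Continuous S := ContinuousMap.continuous_of_continuous_uncurry _
    (continuous_shear_uncurry n)
  have hSm : ∀ t, MeasurePreserving (S t) (volume : Measure (En n × En n)) volume :=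
    fun t => measurePreserving_shear n t
  have hc := (continuous_const (y := hg.toLp g)).compMeasurePreservingLp (p := 2) hS hSm (by simp)
  have h0 := hc.tendsto 0
  have h1 : Tendsto (fun t => edist (hg.toLp g) (Lp.compMeasurePreserving (S t) (hSm t)
      (hg.toLp g))) (nhds 0) (nhds 0) := by
    have e0 : Lp.compMeasurePreserving (S 0) (hSm 0) (hg.toLp g) = hg.toLp g := by
      rw [Lp.toLp_compMeasurePreserving]
      congr 1
      ext q
      simp [S, shear_apply]
    rw [e0] at h0
    simpa using (tendsto_const_nhds (x := hg.toLp g)).edist h0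
  have h2 := (ENNReal.continuous_pow 2).tendsto 0 |>.comp h1
  simp only [ne_eq, OfNat.ofNat_ne_zero, not_false_eq_true, zero_pow] at h2
  refine h2.congr fun t => ?_
  simp only [Function.comp]
  rw [Lp.toLp_compMeasurePreserving, Lp.edist_toLp_toLp,
    eLpNorm_eq_lintegral_rpow_enorm_toReal (by simp) (by simp)]
  simp only [ENNReal.toReal_ofNat, one_div]
  rw [← ENNReal.rpow_natCast, ← ENNReal.rpow_mul]
  norm_num
  rfl

lemma tendsto_lintegral_weight_sub (n : ℕ) {β : ℝ} (hβ : 0 < β) {T : ℝ}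
    {G : En n → En n → ℂ} (hG : Measurable (fun q : En n × En n => G q.1 q.2))
    (hGfin : Hm1 n G < ⊤) :
    Tendsto (fun t : ℝ => ∫⁻ q : En n × En n, ENNReal.ofReal
      ((√(hweight n q.1 (q.2 - t • q.1)) * Real.exp (-phase n β t q.1 q.2)
        - √(hweight n q.1 q.2)) ^ 2) * ‖G q.1 q.2‖ₑ ^ 2)
      (nhdsWithin 0 (Ioo 0 T)) (nhds 0) := by
  rw [Hm1_eq n hG] at hGfin
  have hw := continuous_hweight n
  have key := tendsto_lintegral_filter_of_dominated_convergence
    (μ := (volume : Measure (En n × En n))) (l := nhdsWithin (0:ℝ) (Ioo 0 T))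
    (F := fun t q => ENNReal.ofReal
      ((√(hweight n q.1 (q.2 - t • q.1)) * Real.exp (-phase n β t q.1 q.2)
        - √(hweight n q.1 q.2)) ^ 2) * ‖G q.1 q.2‖ₑ ^ 2) (f := fun _ => 0)
    (fun q => ENNReal.ofReal (2 * (2 + 2 * T ^ 2) + 2) *
      (ENNReal.ofReal (hweight n q.1 q.2) * ‖G q.1 q.2‖ₑ ^ 2)) ?_ ?_ ?_ ?_
  · simpa using key
  · refine Eventually.of_forall fun t => ?_
    have h1 : Continuous (fun q : En n × En n => hweight n q.1 (q.2 - t • q.1)) :=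
      hw.comp (shear n t).continuous
    have h2 : Continuous (fun q : En n × En n => phase n β t q.1 q.2) :=
      continuous_phase_space n hβ t
    have h3 : Continuous (fun q : En n × En n => (√(hweight n q.1 (q.2 - t • q.1)) *
        Real.exp (-phase n β t q.1 q.2) - √(hweight n q.1 q.2)) ^ 2) :=
      ((h1.sqrt.mul h2.neg.rexp).sub hw.sqrt).pow 2
    exact h3.measurable.ennreal_ofReal.mul (hG.enorm.pow_const 2)
  · filter_upwards [self_mem_nhdsWithin] with t ht
    refine ae_of_all _ fun q => ?_
    rw [← mul_assoc, ← ENNReal.ofReal_mul (by positivity)]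
    gcongr
    have h0 := hweight_pos n q.1 q.2
    have h1 := hweight_pos n q.1 (q.2 - t • q.1)
    have h2 : hweight n q.1 (q.2 - t • q.1) ≤ (2 + 2 * T ^ 2) * hweight n q.1 q.2 := by
      have := hweight_le_mul_hweight_sub_smul n (τ := -t) (T := T)
        (by rw [abs_neg, abs_of_pos ht.1]; exact ht.2.le) q.1 (q.2 - t • q.1)
      simpa using this
    have he0 := (Real.exp_pos (-phase n β t q.1 q.2)).le
    have he1 : Real.exp (-phase n β t q.1 q.2) ≤ 1 :=
      Real.exp_le_one_iff.2 (neg_nonpos.2 (phase_nonneg n β ht.1.le _ _))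
    have s0 := Real.sq_sqrt h0.le
    have s1 := Real.sq_sqrt h1.le
    set e := Real.exp (-phase n β t q.1 q.2)
    set a := √(hweight n q.1 (q.2 - t • q.1))
    set b := √(hweight n q.1 q.2)
    have he2 : e ^ 2 ≤ 1 := pow_le_one₀ he0 he1
    nlinarith [sq_nonneg (a * e + b), mul_le_mul_of_nonneg_left he2 (sq_nonneg a)]
  · rw [lintegral_const_mul' _ _ (by finiteness)]
    exact ENNReal.mul_ne_top (by finiteness) hGfin.ne
  · refine ae_of_all _ fun q => ?_
    have h1 : Continuous (fun t : ℝ => hweight n q.1 (q.2 - t • q.1)) :=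
      hw.comp (by fun_prop : Continuous fun t : ℝ => ((q.1, q.2 - t • q.1) : En n × En n))
    have h2 : Continuous (fun t : ℝ => phase n β t q.1 q.2) :=
      continuous_phase_time n hβ q.1 q.2
    have h3 : Continuous (fun t : ℝ => (√(hweight n q.1 (q.2 - t • q.1)) *
        Real.exp (-phase n β t q.1 q.2) - √(hweight n q.1 q.2)) ^ 2) :=
      ((h1.sqrt.mul h2.neg.rexp).sub continuous_const).pow 2
    have h4 := (ENNReal.continuous_ofReal.comp h3).tendsto 0
    have h5 := (ENNReal.Tendsto.mul_const h4 (b := ‖G q.1 q.2‖ₑ ^ 2)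
      (Or.inr (by finiteness))).mono_left (nhdsWithin_le_nhds (s := Ioo 0 T))
    simpa [phase] using h5

lemma tendsto_lintegral_sq_primitive (n : ℕ) {T α : ℝ} (hα' : α < 1)
    {U : ℝ → En n → En n → ℂ} (hU : MeasU n U) (h : L2Hm1 n T α U < ⊤) :
    Tendsto (fun t : ℝ => ∫⁻ q : En n × En n, ENNReal.ofReal (hweight n q.1 q.2) *
      (∫⁻ σ in Ioo 0 t, ‖U σ q.1 q.2‖ₑ) ^ 2) (nhdsWithin 0 (Ioo 0 T)) (nhds 0) := by
  have hub : Tendsto (fun t : ℝ => ENNReal.ofReal (t ^ (1 - α) / (1 - α)) * L2Hm1 n T α U)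
      (nhdsWithin 0 (Ioo 0 T)) (nhds 0) := by
    have h1 : Tendsto (fun t : ℝ => t ^ (1 - α) / (1 - α)) (nhdsWithin 0 (Ioo 0 T)) (nhds 0) := by
      have := (Real.continuous_rpow_const (q := 1 - α) (by linarith)).div_const (1 - α) |>.tendsto 0
      rw [Real.zero_rpow (by linarith), zero_div] at this
      exact this.mono_left nhdsWithin_le_nhds
    simpa using ENNReal.Tendsto.mul_const (ENNReal.tendsto_ofReal h1) (Or.inr h.ne)
  refine tendsto_of_tendsto_of_tendsto_of_le_of_le' tendsto_const_nhds hub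
    (Eventually.of_forall fun _ => zero_le) ?_
  filter_upwards [self_mem_nhdsWithin] with t ht
  have hw := (continuous_hweight n).measurable
  have hsqr : ∀ x : ℝ, 0 ≤ x → ENNReal.ofReal (√x) ^ 2 = ENNReal.ofReal x := fun x hx => by
    rw [← ENNReal.ofReal_pow (Real.sqrt_nonneg _), Real.sq_sqrt hx]
  have hpow : ∀ r : ℝ, Measurable (fun σ : ℝ => σ ^ r) := fun r => measurable_id.pow_const r
  have hcs : ∀ q : En n × En n, (∫⁻ σ in Ioo 0 t, ‖U σ q.1 q.2‖ₑ) ^ 2 ≤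
      ENNReal.ofReal (t ^ (1 - α) / (1 - α)) *
        ∫⁻ σ in Ioo 0 T, ENNReal.ofReal (σ ^ α) * ‖U σ q.1 q.2‖ₑ ^ 2 := fun q => by
    have hUm := (measurable_time_section n hU q.1 q.2).enorm
    have e : ∫⁻ σ in Ioo 0 t, ‖U σ q.1 q.2‖ₑ = ∫⁻ σ in Ioo 0 t,
        ENNReal.ofReal (√(σ ^ (-α))) * (ENNReal.ofReal (√(σ ^ α)) * ‖U σ q.1 q.2‖ₑ) := by
      refine setLIntegral_congr_fun measurableSet_Ioo fun σ hσ => ?_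
      have h0 : 0 < σ ^ α := Real.rpow_pos_of_pos hσ.1 _
      rw [← mul_assoc, ← ENNReal.ofReal_mul (Real.sqrt_nonneg _), ← Real.sqrt_mul
        (Real.rpow_nonneg hσ.1.le _), Real.rpow_neg hσ.1.le, inv_mul_cancel₀ h0.ne']
      simp
    rw [e]
    refine (sq_lintegral_mul_le (hpow _).sqrt.ennreal_ofReal.aemeasurable
      ((hpow _).sqrt.ennreal_ofReal.mul hUm).aemeasurable).trans (mul_le_mul' ?_ ?_)
    · rw [← lintegral_Ioo_rpow_neg hα' ht.1]
      refine le_of_eq (setLIntegral_congr_fun measurableSet_Ioo fun σ hσ => ?_)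
      exact hsqr _ (Real.rpow_nonneg hσ.1.le _)
    · refine (lintegral_mono_set (Ioo_subset_Ioo_right ht.2.le)).trans (le_of_eq ?_)
      refine setLIntegral_congr_fun measurableSet_Ioo fun σ hσ => ?_
      simp only [Pi.mul_apply]
      rw [mul_pow, hsqr _ (Real.rpow_nonneg hσ.1.le _)]
  have hm : Measurable (fun x : ℝ × En n × En n => ENNReal.ofReal (x.1 ^ α) *
      (ENNReal.ofReal (hweight n x.2.1 x.2.2) * ‖U x.1 x.2.1 x.2.2‖ₑ ^ 2)) :=
    (measurable_fst.pow_const α).ennreal_ofReal.mul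
      ((hw.comp measurable_snd).ennreal_ofReal.mul (hU.enorm.pow_const 2))
  calc _ ≤ ∫⁻ q : En n × En n, ENNReal.ofReal (t ^ (1 - α) / (1 - α)) *
        ∫⁻ σ in Ioo 0 T, ENNReal.ofReal (σ ^ α) * (ENNReal.ofReal (hweight n q.1 q.2) *
          ‖U σ q.1 q.2‖ₑ ^ 2) := by
        refine lintegral_mono fun q => (mul_le_mul_right (hcs q) _).trans (le_of_eq ?_)
        rw [← mul_assoc, mul_comm (ENNReal.ofReal (hweight n q.1 q.2)), mul_assoc,
          ← lintegral_const_mul' _ _ ENNReal.ofReal_ne_top]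
        congr 2; ext σ; ring
    _ = _ := by
        rw [lintegral_const_mul' _ _ ENNReal.ofReal_ne_top, L2Hm1]
        congr 1
        exact (lintegral_lintegral_swap (f := fun (t : ℝ) (q : En n × En n) =>
          ENNReal.ofReal (t ^ α) * (ENNReal.ofReal (hweight n q.1 q.2) * ‖U t q.1 q.2‖ₑ ^ 2))
          hm.aemeasurable).symm

lemma hasTrace_duhamel (n : ℕ) {T α β : ℝ} (hβ : 0 < β) (hα' : α < 1)
    {F : ℝ → En n → En n → ℂ} (hF : MeasU n F) (hFfin : L2Hm1 n T α (alongChar n F) < ⊤)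
    {G : En n → En n → ℂ} (hG : Measurable (fun p : En n × En n => G p.1 p.2))
    (hGfin : Hm1 n G < ⊤) : HasTrace n T (duhamel n β F G) G := by
  have hw := continuous_hweight n
  have hFa := measU_alongChar n hF
  set g : En n × En n → ℂ := fun q => (√(hweight n q.1 q.2) : ℂ) * G q.1 q.2 with hg
  have hgm : Measurable g := (Complex.measurable_ofReal.comp hw.sqrt.measurable).mul hG
  have hesq : ∀ (x : ℝ) (z : ℂ), ‖(x : ℂ) * z‖ₑ ^ 2 = ENNReal.ofReal (x ^ 2) * ‖z‖ₑ ^ 2 :=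
    fun x z => by
      rw [enorm_mul, mul_pow, ← ofReal_norm (x : ℂ), Complex.norm_real,
        ← ENNReal.ofReal_pow (norm_nonneg _), Real.norm_eq_abs, sq_abs]
  have hgL : MemLp g 2 volume := by
    refine ⟨hgm.aestronglyMeasurable, ?_⟩
    rw [eLpNorm_lt_top_iff_lintegral_rpow_enorm_lt_top (by simp) (by simp)]
    rw [Hm1_eq n hG] at hGfin
    refine lt_of_le_of_lt (le_of_eq ?_) hGfin
    congr 1; ext q
    simp only [ENNReal.toReal_ofNat, ENNReal.rpow_ofNat]
    rw [hesq, Real.sq_sqrt (hweight_pos _ _ _).le]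
  have t1 := tendsto_lintegral_sq_primitive n hα' hFa hFfin
  have t2 := tendsto_lintegral_weight_sub n hβ (T := T) hG hGfin
  have t3 := (tendsto_lintegral_sub_comp_shear n hgL).mono_left
    (nhdsWithin_le_nhds (s := Ioo 0 T))
  have hub := ((ENNReal.Tendsto.const_mul t1 (a := 4 * ENNReal.ofReal (2 + 2 * T ^ 2))
    (Or.inr (by finiteness))).add ((ENNReal.Tendsto.const_mul t2 (a := 16)
    (Or.inr (by simp))).add (ENNReal.Tendsto.const_mul t3 (a := 16) (Or.inr (by simp)))))
  simp only [mul_zero, add_zero] at hub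
  refine tendsto_of_tendsto_of_tendsto_of_le_of_le' tendsto_const_nhds hub
    (Eventually.of_forall fun _ => zero_le) ?_
  filter_upwards [self_mem_nhdsWithin] with t ht
  have hDm : Measurable (fun q : En n × En n => duhamel n β F G t q.1 q.2 - G q.1 q.2) :=
    (measurable_space_section n (measU_duhamel n hβ hF hG) t).sub hG
  have hpm : Measurable (fun q : En n × En n => phase n β t q.1 q.2) :=
    (continuous_phase_space n hβ t).measurable
  have hwt : Measurable (fun q : En n × En n => hweight n q.1 (q.2 - t • q.1)) :=
    (hw.comp (shear n t).continuous).measurable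
  rw [Hm1_eq n hDm, ← lintegral_shear n t]
  have hpt : ∀ q : En n × En n, ENNReal.ofReal (hweight n (shear n t q).1 (shear n t q).2) *
      ‖duhamel n β F G t (shear n t q).1 (shear n t q).2 - G (shear n t q).1 (shear n t q).2‖ₑ ^ 2
      ≤ 4 * ENNReal.ofReal (2 + 2 * T ^ 2) * (ENNReal.ofReal (hweight n q.1 q.2) *
          (∫⁻ σ in Ioo 0 t, ‖alongChar n F σ q.1 q.2‖ₑ) ^ 2) +
        (16 * (ENNReal.ofReal ((√(hweight n q.1 (q.2 - t • q.1)) *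
          Real.exp (-phase n β t q.1 q.2) - √(hweight n q.1 q.2)) ^ 2) * ‖G q.1 q.2‖ₑ ^ 2) +
        16 * ‖g q - g (shear n t q)‖ₑ ^ 2) := fun q => by
    have hw0 := hweight_pos n q.1 q.2
    have hw1 := hweight_pos n q.1 (q.2 - t • q.1)
    have hw2 : hweight n q.1 (q.2 - t • q.1) ≤ (2 + 2 * T ^ 2) * hweight n q.1 q.2 := by
      have := hweight_le_mul_hweight_sub_smul n (τ := -t) (T := T)
        (by rw [abs_neg, abs_of_pos ht.1]; exact ht.2.le) q.1 (q.2 - t • q.1)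
      simpa using this
    have hD : duhamel n β F G t (shear n t q).1 (shear n t q).2 =
        duhamelAlong n β F G t q.1 q.2 := by
      rw [← alongChar_duhamel]; rfl
    rw [hD]
    set P : ℂ := (Real.exp (-phase n β t q.1 q.2) : ℂ) *
      ∫ σ in Ioo 0 t, (Real.exp (phase n β σ q.1 q.2) : ℂ) * alongChar n F σ q.1 q.2 with hP
    set h1 := hweight n q.1 (q.2 - t • q.1) with hh1
    set R : ℂ := ((√h1 * Real.exp (-phase n β t q.1 q.2) - √(hweight n q.1 q.2) : ℝ) : ℂ) *
      G q.1 q.2 with hR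
    have e1 : (√h1 : ℂ) * (duhamelAlong n β F G t q.1 q.2 - G (shear n t q).1 (shear n t q).2) =
        (√h1 : ℂ) * P + (R + (g q - g (shear n t q))) := by
      have : g (shear n t q) = (√h1 : ℂ) * G (shear n t q).1 (shear n t q).2 := rfl
      rw [this, hR, hP, hg]
      unfold duhamelAlong
      push_cast
      ring
    have hPle : ‖P‖ₑ ≤ ∫⁻ σ in Ioo 0 t, ‖alongChar n F σ q.1 q.2‖ₑ := by
      have h0 := enorm_duhamelAlong_le n β F (fun _ _ => 0) t q.1 q.2
      have : duhamelAlong n β F (fun _ _ => 0) t q.1 q.2 = P := by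
        simp [duhamelAlong, hP]
      rw [this] at h0
      refine h0.trans ?_
      simp only [enorm_zero, mul_zero, zero_add]
      refine setLIntegral_mono' measurableSet_Ioo fun σ hσ => ?_
      refine mul_le_of_le_one_left zero_le ?_
      rw [ENNReal.ofReal_le_one, Real.exp_le_one_iff, neg_nonpos, phase_sub_phase n hβ]
      exact phase_nonneg n β (by linarith [hσ.2]) _ _
    have e2 : ENNReal.ofReal (hweight n (shear n t q).1 (shear n t q).2) *
        ‖duhamelAlong n β F G t q.1 q.2 - G (shear n t q).1 (shear n t q).2‖ₑ ^ 2 =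
        ‖(√h1 : ℂ) * P + (R + (g q - g (shear n t q)))‖ₑ ^ 2 := by
      rw [← e1, hesq, Real.sq_sqrt hw1.le]; rfl
    rw [e2]
    calc _ ≤ (‖(√h1 : ℂ) * P‖ₑ + (‖R‖ₑ + ‖g q - g (shear n t q)‖ₑ)) ^ 2 := by
          gcongr
          exact (enorm_add_le _ _).trans (by gcongr; exact enorm_add_le _ _)
      _ ≤ 4 * ‖(√h1 : ℂ) * P‖ₑ ^ 2 + 4 * (4 * ‖R‖ₑ ^ 2 + 4 * ‖g q - g (shear n t q)‖ₑ ^ 2) :=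
          (ENNReal.add_sq_le_four_mul _ _).trans
            (by gcongr; exact ENNReal.add_sq_le_four_mul _ _)
      _ ≤ 4 * (ENNReal.ofReal ((2 + 2 * T ^ 2) * hweight n q.1 q.2) *
            (∫⁻ σ in Ioo 0 t, ‖alongChar n F σ q.1 q.2‖ₑ) ^ 2) +
          4 * (4 * ‖R‖ₑ ^ 2 + 4 * ‖g q - g (shear n t q)‖ₑ ^ 2) := by
          rw [hesq, Real.sq_sqrt hw1.le]
          gcongr
      _ = _ := by
          rw [hR, hesq, ENNReal.ofReal_mul (by positivity)]
          ring
  refine (lintegral_mono hpt).trans (le_of_eq ?_)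
  have m3 : Measurable (fun q : En n × En n => 16 * ‖g q - g (shear n t q)‖ₑ ^ 2) :=
    ((hgm.sub (hgm.comp (shear n t).continuous.measurable)).enorm.pow_const 2).const_mul _
  have m2 : Measurable (fun q : En n × En n => 16 * (ENNReal.ofReal
      ((√(hweight n q.1 (q.2 - t • q.1)) * Real.exp (-phase n β t q.1 q.2)
        - √(hweight n q.1 q.2)) ^ 2) * ‖G q.1 q.2‖ₑ ^ 2)) :=
    ((((hwt.sqrt.mul hpm.neg.exp).sub hw.sqrt.measurable).pow_const 2).ennreal_ofReal.mul
      (hG.enorm.pow_const 2)).const_mul _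
  have m23 := m2.add m3
  simp only [Pi.add_def] at m23
  rw [lintegral_add_right _ m23, lintegral_add_right _ m3,
    lintegral_const_mul' _ _ (by finiteness), lintegral_const_mul' _ _ (by finiteness),
    lintegral_const_mul' _ _ (by finiteness)]

lemma ae_mild_duhamel (n : ℕ) {T α β : ℝ} (hβ : 0 < β) (hα' : α < 1)
    {F : ℝ → En n → En n → ℂ} (hF : MeasU n F) (hFfin : L2Hm1 n T α (alongChar n F) < ⊤)
    (G : En n → En n → ℂ) :
    ∀ᵐ q : En n × En n, ∀ t ∈ Ioo 0 T, alongChar n (duhamel n β F G) t q.1 q.2 = G q.1 q.2 +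
      ∫ σ in Ioo 0 t, alongChar n (kolmogorovRHS n β F (duhamel n β F G)) σ q.1 q.2 := by
  filter_upwards [ae_integrableOn_of_L2Hm1 n hα' (measU_alongChar n hF) hFfin] with q hq t ht
  rw [alongChar_duhamel]
  exact mild_duhamelAlong n hβ F G hq ht

/-- A solution with trace `G` coincides with the Duhamel formula. -/
lemma ae_eq_duhamel (n : ℕ) {T α β : ℝ} (hT : 0 < T) (hβ : 0 < β) (hα' : α < 1)
    {F : ℝ → En n → En n → ℂ} (hF : MeasU n F) (hFfin : L2Hm1 n T α (alongChar n F) < ⊤)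
    {G : En n → En n → ℂ} (hG : Measurable (fun p : En n × En n => G p.1 p.2))
    (hGfin : Hm1 n G < ⊤) {U : ℝ → En n → En n → ℂ} (hU : MeasU n U)
    (hUfin : L2Hm1 n T α (alongChar n U) < ⊤)
    (hRU : L2Hm1 n T α (alongChar n (kolmogorovRHS n β F U)) < ⊤)
    (hDfin : L2Hm1 n T α (alongChar n (duhamel n β F G)) < ⊤)
    (hRD : L2Hm1 n T α (alongChar n (kolmogorovRHS n β F (duhamel n β F G))) < ⊤)
    (hweak : IsFTransportDeriv n T U (kolmogorovRHS n β F U)) (htr : HasTrace n T U G) :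
    ∀ᵐ t ∂(volume.restrict (Ioo 0 T)), ∀ᵐ (k : En n) ∂(volume : Measure (En n)),
      ∀ᵐ (ξ : En n) ∂(volume : Measure (En n)), U t k ξ = duhamel n β F G t k ξ := by
  have hD := measU_duhamel n hβ hF hG
  have hUa := measU_alongChar n hU
  have hDa := measU_alongChar n hD
  have hRUa := measU_alongChar n (measU_kolmogorovRHS (β := β) n hF hU)
  have hRDa := measU_alongChar n (measU_kolmogorovRHS (β := β) n hF hD)
  refine ae_ae_ae_eq_of_alongChar n hU hD ?_
  filter_upwards [ae_mild_of_isWeakTimeDeriv n hT hα' hUa hUfin hRUa hRU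
      (locallyIntegrable_of_Hm1 n hG hGfin) ((isFTransportDeriv_iff n T _ _).1 hweak)
      (tendsto_integral_alongChar_mul n hU hG hGfin htr),
    ae_mild_duhamel n hβ hα' hF hFfin G,
    ae_integrableOn_of_L2Hm1 n hα' hUa hUfin, ae_integrableOn_of_L2Hm1 n hα' hDa hDfin,
    ae_integrableOn_of_L2Hm1 n hα' hRUa hRU, ae_integrableOn_of_L2Hm1 n hα' hRDa hRD]
    with q h1 h2 i1 i2 i3 i4
  exact ae_eq_of_mild hT (continuous_norm_rpow n hβ q.1 q.2)
    (f := fun σ => alongChar n F σ q.1 q.2) (c := G q.1 q.2) i1 i2 i3 i4 h1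
    ((ae_restrict_iff' measurableSet_Ioo).2 (ae_of_all _ h2))

theorem stmt15 (n : ℕ) (hn : 1 ≤ n) (T μ β s : ℝ) (hT : 0 < T)
    (hμ : μ ∈ Ioc (1/2 : ℝ) 1) (hβ : β ∈ Ioc (0:ℝ) 2) (hs : -(1/2 : ℝ) ≤ s)
    -- data: `f ∈ L²_μ((0,T);X_β^s)` and `g ∈ X_β^{s+1/2−(1−μ)}`
    (F : ℝ → En n → En n → ℂ) (hF : MeasU n F) (hFfin : L2X n β s T μ F < ⊤)
    (G : En n → En n → ℂ) (hG : Measurable (fun p : En n × En n => G p.1 p.2))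
    (hGfin : Xnorm n β (s + 1/2 - (1 - μ)) G < ⊤) :
    -- there is a unique `u ∈ T_μ((0,T);X_β^s) ∩ L²_μ((0,T);X_β^{s+1})` solving
    -- `∂_t u + v·∇ₓ u + (−Δ_v)^{β/2} u = f`, `u(0) = g`
    ∃ U H : ℝ → En n → En n → ℂ, SolSpace n β s T μ U H ∧
      IsFTransportDeriv n T U (fun t k ξ => F t k ξ - ((‖ξ‖ ^ β : ℝ) : ℂ) * U t k ξ) ∧
      HasTrace n T U G ∧
      ∀ U' H' : ℝ → En n → En n → ℂ, SolSpace n β s T μ U' H' →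
        IsFTransportDeriv n T U' (fun t k ξ => F t k ξ - ((‖ξ‖ ^ β : ℝ) : ℂ) * U' t k ξ) →
        HasTrace n T U' G →
        ∀ᵐ t ∂(volume.restrict (Ioo 0 T)), ∀ᵐ (k : En n) ∂(volume : Measure (En n)),
          ∀ᵐ (ξ : En n) ∂(volume : Measure (En n)), U' t k ξ = U t k ξ := by
  have hα' : 2 - 2 * μ < 1 := by linarith [hμ.1]
  have hchar : ∀ W : ℝ → En n → En n → ℂ, MeasU n W → L2X n β s T μ W < ⊤ →
      L2Hm1 n T (2 - 2 * μ) (alongChar n W) < ⊤ := fun W hW h =>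
    L2Hm1_alongChar_lt_top n (L2Hm1_lt_top n hβ hs hW h)
  have hFa := hchar F hF hFfin
  have hG1 : Hm1 n G < ⊤ := Hm1_lt_top_of_Xnorm n hβ (by linarith [hμ.1]) hG hGfin
  have hD := measU_duhamel n hβ.1 hF hG
  have hR := measU_kolmogorovRHS (β := β) n hF hD
  have hD1 := L2X_duhamel_lt_top n hT hμ hβ hs hF hFfin hG hGfin
  have hD0 := L2X_lt_top_of_succ n hβ.1 hD hD1
  have hR0 := L2X_kolmogorovRHS_lt_top n hβ.1 hF hD hFfin hD1
  have hweak : IsFTransportDeriv n T (duhamel n β F G)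
      (kolmogorovRHS n β F (duhamel n β F G)) :=
    (isFTransportDeriv_iff n T _ _).2 <| isWeakTimeDeriv_of_mild n hT.le hα'
      (measU_alongChar n hD) (hchar _ hD hD0) (measU_alongChar n hR) (hchar _ hR hR0)
      (ae_mild_duhamel n hβ.1 hα' hF hFa G)
  refine ⟨duhamel n β F G, kolmogorovRHS n β F (duhamel n β F G),
    ⟨hD, hR, hweak, hD0, hR0, hD1⟩, hweak, hasTrace_duhamel n hβ.1 hα' hF hFa hG hG1, ?_⟩
  rintro U' H' ⟨hU, -, -, hU0, -, hU1⟩ hweak' htr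
  exact ae_eq_duhamel n hT hβ.1 hα' hF hFa hG hG1 hU (hchar _ hU hU0)
    (hchar _ (measU_kolmogorovRHS n hF hU) (L2X_kolmogorovRHS_lt_top n hβ.1 hF hU hFfin hU1))
    (hchar _ hD hD0) (hchar _ hR hR0) hweak' htr
end
end

section
/- Let β ∈ (0,2]. There exists a constant c = c(β) > 0 such that for every measurable function G : ℝⁿ × ℝⁿ → ℂ with ∫_{ℝ^{2n}} |k|^{β/(β+1)} |G(k,ξ)|² dk dξ < ∞, the function U(t,k,ξ) = G(k,ξ+tk) e_β(t,k,ξ) satisfies ∫₀^∞ ∫_{ℝ^{2n}} t^{2β} |k|^{2β} |U(t,k,ξ)|² dk dξ dt ≤ c ∫_{ℝ^{2n}} |k|^{β/(β+1)} |G(k,ξ)|² dk dξ. -/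
open MeasureTheory Set Filter
open scoped ENNReal

noncomputable section

/-- `e_β(t,k,ξ) = exp(−∫₀ᵗ ‖ξ + σ k‖^β dσ)`. -/
def eB (n : ℕ) (β t : ℝ) (k ξ : En n) : ℝ :=
  Real.exp (-(∫ σ in (0:ℝ)..t, ‖ξ + σ • k‖ ^ β))

lemma rpow_le_add_rpow_of_two_mul_le_add {a b d β : ℝ} (ha : 0 ≤ a) (hb : 0 ≤ b)
    (hd : 0 ≤ d) (hβ : 0 ≤ β) (h : 2 * d ≤ a + b) : d ^ β ≤ a ^ β + b ^ β := by
  have ha' := Real.rpow_nonneg ha β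
  have hb' := Real.rpow_nonneg hb β
  rcases le_total d a with h1 | h1
  · have := Real.rpow_le_rpow hd h1 hβ
    linarith
  · have := Real.rpow_le_rpow hd (show d ≤ b by linarith) hβ
    linarith

/-- The integral of `‖ξ + σ k‖ ^ β` along a segment is bounded below uniformly in `ξ`. -/
lemma le_integral_norm_add_smul_rpow {n : ℕ} {β t : ℝ} (hβ : 0 ≤ β) (ht : 0 ≤ t) (k ξ : En n) :
    t / 2 * (t * ‖k‖ / 4) ^ β ≤ ∫ σ in (0:ℝ)..t, ‖ξ + σ • k‖ ^ β := by
  set f : ℝ → ℝ := fun σ => ‖ξ + σ • k‖ ^ β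
  have hf : Continuous f :=
    Continuous.rpow_const (by fun_prop) fun _ => Or.inr hβ
  have hf' : Continuous fun σ => f (σ + t / 2) := hf.comp (continuous_add_const _)
  have hsplit : ∫ σ in (0:ℝ)..t, f σ = ∫ σ in (0:ℝ)..(t / 2), (f σ + f (σ + t / 2)) := by
    rw [intervalIntegral.integral_add (hf.intervalIntegrable _ _) (hf'.intervalIntegrable _ _),
      intervalIntegral.integral_comp_add_right, zero_add, add_halves,
      intervalIntegral.integral_add_adjacent_intervals (hf.intervalIntegrable _ _)
        (hf.intervalIntegrable _ _)]
  have hconst : t / 2 * (t * ‖k‖ / 4) ^ β = ∫ _ in (0:ℝ)..(t / 2), (t * ‖k‖ / 4) ^ β := by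
    simp
  rw [hsplit, hconst]
  refine intervalIntegral.integral_mono_on (by positivity) (by simp)
    ((hf.add hf').intervalIntegrable _ _) fun σ _ => ?_
  refine rpow_le_add_rpow_of_two_mul_le_add (norm_nonneg _) (norm_nonneg _) (by positivity) hβ ?_
  have h1 : (t / 2) • k = (ξ + (σ + t / 2) • k) - (ξ + σ • k) := by module
  have h2 : ‖(t / 2) • k‖ = t / 2 * ‖k‖ := by
    rw [norm_smul, Real.norm_of_nonneg (by positivity)]
  have h3 := norm_sub_le (ξ + (σ + t / 2) • k) (ξ + σ • k)
  rw [← h1, h2] at h3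
  linarith

lemma eB_sq_le {n : ℕ} {β t : ℝ} (hβ : 0 < β) (ht : 0 < t) (k ξ : En n) :
    eB n β t k ξ ^ 2 ≤ Real.exp (-((4 ^ β)⁻¹ * ‖k‖ ^ β) * t ^ (β + 1)) := by
  rw [eB, ← Real.exp_nat_mul, Real.exp_le_exp]
  have h := le_integral_norm_add_smul_rpow hβ.le ht.le k ξ
  rw [Real.div_rpow (by positivity) (by norm_num), Real.mul_rpow ht.le (norm_nonneg _)] at h
  have h2 : ((4:ℝ) ^ β)⁻¹ * ‖k‖ ^ β * t ^ (β + 1)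
      = 2 * (t / 2 * (t ^ β * ‖k‖ ^ β / 4 ^ β)) := by
    rw [Real.rpow_add_one ht.ne']
    field_simp
  push_cast
  rw [neg_mul, h2]
  linarith

lemma lintegral_weight_eq {β r : ℝ} (hβ : 0 < β) (hr : 0 ≤ r) :
    ∫⁻ t in Ioi (0:ℝ), ENNReal.ofReal
        (t ^ (2 * β) * r ^ (2 * β) * Real.exp (-((4 ^ β)⁻¹ * r ^ β) * t ^ (β + 1)))
      = ENNReal.ofReal (((4 ^ β)⁻¹ ^ (-(2 * β + 1) / (β + 1)) * (1 / (β + 1)) *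
          Real.Gamma ((2 * β + 1) / (β + 1))) * r ^ (β / (β + 1))) := by
  rcases hr.eq_or_lt with rfl | hr
  · rw [Real.zero_rpow (by positivity), Real.zero_rpow (by positivity)]
    simp [Real.zero_rpow (show β / (β + 1) ≠ 0 by positivity)]
  have hb : 0 < ((4:ℝ) ^ β)⁻¹ * r ^ β := by positivity
  have hint := integrableOn_rpow_mul_exp_neg_mul_rpow (s := 2 * β) (p := β + 1)
    (b := (4 ^ β)⁻¹ * r ^ β) (by linarith) (by linarith) hb
  have heq : ∀ t : ℝ,
      t ^ (2 * β) * r ^ (2 * β) * Real.exp (-((4 ^ β)⁻¹ * r ^ β) * t ^ (β + 1))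
        = r ^ (2 * β) * (t ^ (2 * β) * Real.exp (-((4 ^ β)⁻¹ * r ^ β) * t ^ (β + 1))) :=
    fun t => by ring
  simp_rw [heq]
  rw [← ofReal_integral_eq_lintegral_ofReal (hint.const_mul _)
    (ae_restrict_of_forall_mem measurableSet_Ioi fun t ht => by
      have : 0 < t := ht
      positivity),
    integral_const_mul, integral_rpow_mul_exp_neg_mul_rpow (by linarith) (by linarith) hb,
    Real.mul_rpow (by positivity) (by positivity), ← Real.rpow_mul hr.le]
  congr 1
  have hpow : r ^ (β / (β + 1)) = r ^ (2 * β) * r ^ (β * (-(2 * β + 1) / (β + 1))) := by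
    rw [← Real.rpow_add hr]
    congr 1
    field_simp
    ring
  rw [hpow]
  ring

theorem stmt16 (n : ℕ) (hn : 1 ≤ n) (β : ℝ) (hβ : β ∈ Ioc (0:ℝ) 2) :
    ∃ c : ℝ, 0 < c ∧ ∀ G : En n → En n → ℂ,
      Measurable (fun p : En n × En n => G p.1 p.2) →
      (∫⁻ (k : En n), ∫⁻ (ξ : En n),
          ENNReal.ofReal (‖k‖ ^ (β / (β + 1)) * ‖G k ξ‖ ^ 2)) < ⊤ →
      (∫⁻ t in Ioi (0:ℝ), ∫⁻ (k : En n), ∫⁻ (ξ : En n),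
          ENNReal.ofReal (t ^ (2 * β) * ‖k‖ ^ (2 * β) *
            ‖G k (ξ + t • k) * (eB n β t k ξ : ℂ)‖ ^ 2))
        ≤ ENNReal.ofReal c *
          ∫⁻ (k : En n), ∫⁻ (ξ : En n),
            ENNReal.ofReal (‖k‖ ^ (β / (β + 1)) * ‖G k ξ‖ ^ 2) := by
  have hβ0 : 0 < β := hβ.1
  set c : ℝ := (4 ^ β)⁻¹ ^ (-(2 * β + 1) / (β + 1)) * (1 / (β + 1)) *
    Real.Gamma ((2 * β + 1) / (β + 1))
  have hcpos : 0 < c := by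
    have := Real.Gamma_pos_of_pos (s := (2 * β + 1) / (β + 1)) (by positivity)
    positivity
  refine ⟨c, hcpos, fun G hG _ => ?_⟩
  set W : ℝ → En n → ℝ := fun t k =>
    t ^ (2 * β) * ‖k‖ ^ (2 * β) * Real.exp (-((4 ^ β)⁻¹ * ‖k‖ ^ β) * t ^ (β + 1)) with hW
  set N : En n → ℝ≥0∞ := fun k => ∫⁻ ξ, ENNReal.ofReal (‖G k ξ‖ ^ 2)
  have hN : ∀ k, N k = ∫⁻ ξ, ENNReal.ofReal (‖G k ξ‖ ^ 2) := fun _ => rfl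
  have hNm : Measurable N :=
    Measurable.lintegral_prod_right' (hG.norm.pow_const 2).ennreal_ofReal
  have hWm : Measurable fun p : ℝ × En n => ENNReal.ofReal (W p.1 p.2) := by
    simp only [hW]
    fun_prop
  calc _ ≤ ∫⁻ t in Ioi (0:ℝ), ∫⁻ k : En n, ENNReal.ofReal (W t k) * N k := by
        refine setLIntegral_mono' measurableSet_Ioi fun t ht => lintegral_mono fun k => ?_
        have ht : 0 < t := ht
        have hW0 : 0 ≤ W t k := by positivity
        rw [hN k, ← lintegral_add_right_eq_self (fun ξ => ENNReal.ofReal (‖G k ξ‖ ^ 2)) (t • k),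
          ← lintegral_const_mul' _ _ ENNReal.ofReal_ne_top]
        refine lintegral_mono fun ξ => ?_
        rw [← ENNReal.ofReal_mul hW0]
        refine ENNReal.ofReal_le_ofReal ?_
        rw [norm_mul, mul_pow, Complex.norm_real, Real.norm_eq_abs, sq_abs,
          mul_comm (‖G k (ξ + t • k)‖ ^ 2), ← mul_assoc]
        simp only [hW]
        gcongr
        exact eB_sq_le hβ0 ht k ξ
    _ = ∫⁻ k : En n, ∫⁻ t in Ioi (0:ℝ), ENNReal.ofReal (W t k) * N k :=
        lintegral_lintegral_swap (hWm.mul (hNm.comp measurable_snd)).aemeasurable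
    _ = ∫⁻ k : En n, ENNReal.ofReal c * (ENNReal.ofReal (‖k‖ ^ (β / (β + 1))) * N k) := by
        refine lintegral_congr fun k => ?_
        rw [lintegral_mul_const (N k) (f := fun t => ENNReal.ofReal (W t k))
            (hWm.comp (measurable_prodMk_right (y := k))),
          lintegral_weight_eq hβ0 (norm_nonneg k), ENNReal.ofReal_mul hcpos.le, mul_assoc]
    _ = _ := by
        rw [lintegral_const_mul' _ _ ENNReal.ofReal_ne_top]
        congr 1
        refine lintegral_congr fun k => ?_
        rw [hN k, ← lintegral_const_mul' _ _ ENNReal.ofReal_ne_top]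
        refine lintegral_congr fun ξ => ?_
        rw [ENNReal.ofReal_mul (by positivity)]
end
end
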